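/- arXiv:1203.4295 — 2 statements merged into one kernel-verified Lean document; each statement's English description precedes it below -/
import Mathlib

section
/- Let α be an irrational real number. Then the one-sided inhomogeneous approximation spectrum S₊(α) = {M₊(α,β) : β ∈ ℝ} contains an interval of the form [0, μ_α] for some real μ_α > 0. -/
open Filter Finset

/-- Distance from `x` to the nearest integer. -/
noncomputable def nint (x : ℝ) : ℝ := |x - (round x : ℝ)|

/-- One-sided inhomogeneous approximation constant
`M₊(α,β) = liminf_{q→∞} q‖qα−β‖` over positive integers `q`. -/
noncomputable def Mplus (α β : ℝ) : ℝ :=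
  Filter.liminf (fun q : ℕ => (q : ℝ) * nint (q * α - β)) Filter.atTop

/-- Complete quotients of the negative continued fraction: `ncq α i = α_{i+1}`,
so `ncq α 0 = α₁ = α` and `α_{i+1} = a_i - 1/α_i` with `a_i = ⌈1/α_i⌉`. -/
noncomputable def ncq (α : ℝ) : ℕ → ℝ
  | 0 => α
  | i + 1 => (⌈(ncq α i)⁻¹⌉ : ℝ) - (ncq α i)⁻¹

/-- Partial quotients of the negative continued fraction: `npq α i = a_i = ⌈1/α_i⌉` for `i ≥ 1`. -/
noncomputable def npq (α : ℝ) (i : ℕ) : ℤ := ⌈(ncq α (i - 1))⁻¹⌉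

/-- Convergent denominators: `q₀ = 1`, `q₁ = a₁`, `q_{i+2} = a_{i+2} q_{i+1} − q_i`. -/
noncomputable def nq (α : ℝ) : ℕ → ℤ
  | 0 => 1
  | 1 => npq α 1
  | i + 2 => npq α (i + 2) * nq α (i + 1) - nq α i

/-- Convergent numerators: `p₀ = 0`, `p₁ = 1`, `p_{i+2} = a_{i+2} p_{i+1} − p_i`. -/
noncomputable def np (α : ℝ) : ℕ → ℤ
  | 0 => 0
  | 1 => 1
  | i + 2 => npq α (i + 2) * np α (i + 1) - np α i

/-- `Dk α k = α₁α₂⋯α_k` (with `Dk α 0 = 1`). -/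
noncomputable def Dk (α : ℝ) (k : ℕ) : ℝ := ∏ j ∈ Finset.range k, ncq α j

/-- Davenport remainders: `drem α β i = β_{i+1}`, so `drem α β 0 = β₁ = β` and
`β_{i+1} = β_i/α_i − ⌊β_i/α_i⌋`. -/
noncomputable def drem (α β : ℝ) : ℕ → ℝ
  | 0 => β
  | i + 1 => Int.fract (drem α β i / ncq α i)

/-- Davenport coefficients: `db α β i = b_i = ⌊β_i/α_i⌋` for `i ≥ 1`. -/
noncomputable def db (α β : ℝ) (i : ℕ) : ℤ := ⌊drem α β (i - 1) / ncq α (i - 1)⌋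

/-- `Qn α β n = Σ_{k=1}^n b_k q_{k−1}`. -/
noncomputable def Qn (α β : ℝ) (n : ℕ) : ℤ :=
  ∑ k ∈ Finset.Icc 1 n, db α β k * nq α (k - 1)

/-- `Q′_n`. -/
noncomputable def Qn' (α β : ℝ) (n : ℕ) : ℤ :=
  if Qn α β n < nq α n - nq α (n - 1) then Qn α β n + nq α (n - 1)
  else Qn α β n + nq α (n - 1) - nq α n

/-- `λ_n(β) = Q_n D_n β_{n+1}`. -/
noncomputable def lam (α β : ℝ) (n : ℕ) : ℝ :=
  (Qn α β n : ℝ) * Dk α n * drem α β n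

/-- `ρ_n(β)`. -/
noncomputable def rho (α β : ℝ) (n : ℕ) : ℝ :=
  if Qn α β n < nq α n - nq α (n - 1)
  then (Qn' α β n : ℝ) * Dk α n * (1 - drem α β n)
  else (Qn' α β n : ℝ) * Dk α n * (1 - ncq α n - drem α β n)

/-- Reversed quotients: `ᾱ₀ = 0`, `ᾱ_i = 1/(a_i − ᾱ_{i−1})`. -/
noncomputable def rq (α : ℝ) : ℕ → ℝ
  | 0 => 0
  | i + 1 => ((npq α (i + 1) : ℝ) - rq α i)⁻¹

theorem exists_pos_forall_le_abs_mul_sub {α : ℝ} (hα : Irrational α) (M : ℕ) :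
    ∃ ρ : ℝ, 0 < ρ ∧ ∀ m : ℕ, 0 < m → m ≤ M → ∀ p : ℤ, ρ ≤ |m * α - p| := by
  induction M with
  | zero => exact ⟨1, one_pos, fun m h1 h2 => by omega⟩
  | succ M ih =>
    obtain ⟨ρ, hρ, h⟩ := ih
    have hirr : Irrational (((M + 1 : ℕ) : ℝ) * α) := hα.natCast_mul (by omega)
    refine ⟨min ρ |((M + 1 : ℕ) : ℝ) * α - round (((M + 1 : ℕ) : ℝ) * α)|,
      lt_min hρ (abs_pos.2 (sub_ne_zero.2 (hirr.ne_int _))), fun m h1 h2 p => ?_⟩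
    rcases Nat.lt_or_ge M m with hm | hm
    · obtain rfl : m = M + 1 := by omega
      exact (min_le_right _ _).trans (round_le _ _)
    · exact (min_le_left _ _).trans (h m h1 hm p)

theorem half_le_mul_abs_of_lt {α : ℝ} {w X : ℕ} {p P : ℤ} (hwX : w < X)
    (h : |X * α - P| < |w * α - p|) : 1 / 2 ≤ X * |w * α - p| := by
  have hw' : (w : ℝ) < X := by exact_mod_cast hwX
  have h0 := abs_nonneg (X * α - P)
  have hw0 : (0 : ℝ) ≤ w := by positivity
  have hD : w * P - X * p ≠ 0 := by
    intro hD
    have hD' : (w * P - X * p : ℝ) = 0 := by exact_mod_cast hD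
    have e : (X : ℝ) * (w * α - p) = w * (X * α - P) := by linear_combination hD'
    have e' := congrArg abs e
    rw [abs_mul, abs_mul, Nat.abs_cast, Nat.abs_cast] at e'
    nlinarith
  have h1 : (1 : ℝ) ≤ |(w * P - X * p : ℝ)| := by exact_mod_cast Int.one_le_abs hD
  have e : (w * P - X * p : ℝ) = X * (w * α - p) - w * (X * α - P) := by ring
  rw [e] at h1
  have h2 := abs_sub (X * (w * α - p)) (w * (X * α - P))
  rw [abs_mul, abs_mul, Nat.abs_cast, Nat.abs_cast] at h2
  nlinarith

/-- Good rational approximations with bounded denominators all lie on the same side of `α`. -/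
theorem exists_sign_forall_mul_nonpos (α Q K : ℝ) (hQ : 0 < Q) (hK : 0 < K) :
    ∃ s : ℝ, |s| = 1 ∧ ∀ (m : ℕ) (p : ℤ), 0 < m → (m : ℝ) ≤ K * Q →
      |m * α - p| < 1 / (2 * K * Q) → s * (m * α - p) ≤ 0 := by
  by_cases hex : ∃ (m : ℕ) (p : ℤ), 0 < m ∧ (m : ℝ) ≤ K * Q ∧
      |m * α - p| < 1 / (2 * K * Q) ∧ 0 < m * α - p
  · obtain ⟨m, p, hm, hmK, hs, hpos⟩ := hex
    refine ⟨-1, by norm_num, fun n r hn hnK hr => ?_⟩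
    have hKQ : 0 < K * Q := by positivity
    have e1 : K * Q * (1 / (2 * K * Q)) = 1 / 2 := by field_simp
    have hlt : |(n * p - m * r : ℝ)| < 1 := by
      have e : (n * p - m * r : ℝ) = m * (n * α - r) - n * (m * α - p) := by ring
      have h2 := abs_sub (m * (n * α - r)) (n * (m * α - p))
      rw [abs_mul, abs_mul, Nat.abs_cast, Nat.abs_cast] at h2
      have hm' : (0 : ℝ) < m := by exact_mod_cast hm
      have hn' : (0 : ℝ) < n := by exact_mod_cast hn
      have a1 : m * |n * α - r| < m * (1 / (2 * K * Q)) := by gcongr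
      have a2 : n * |m * α - p| < n * (1 / (2 * K * Q)) := by gcongr
      have a3 : m * (1 / (2 * K * Q)) ≤ K * Q * (1 / (2 * K * Q)) := by gcongr
      have a4 : n * (1 / (2 * K * Q)) ≤ K * Q * (1 / (2 * K * Q)) := by gcongr
      rw [e]; linarith
    have hz : n * p - m * r = 0 := by
      have : |n * p - m * r| < 1 := by exact_mod_cast hlt
      exact Int.abs_lt_one_iff.1 this
    have hz' : (n * p - m * r : ℝ) = 0 := by exact_mod_cast hz
    have hm' : (0 : ℝ) < m := by exact_mod_cast hm
    have e : (m : ℝ) * (n * α - r) = n * (m * α - p) := by linear_combination hz'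
    have : 0 ≤ (m : ℝ) * (n * α - r) := by rw [e]; positivity
    have := nonneg_of_mul_nonneg_right this hm'
    linarith
  · push Not at hex
    exact ⟨1, by norm_num, fun m p hm hmK hs => by simpa using hex m p hm hmK hs⟩

theorem half_le_or_exists_multiple {α : ℝ} {w t : ℕ} {P p : ℤ} (hw : 0 < w)
    (hcop : IsCoprime (w : ℤ) P) (ht : t * |w * α - P| ≤ 1 / 2) :
    1 / 2 ≤ w * |t * α - p| ∨ ∃ i : ℕ, t = i * w ∧ |t * α - p| = i * |w * α - P| := by
  by_cases hD : t * P - w * p = 0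
  · right
    have hdvd : (w : ℤ) ∣ t := hcop.dvd_of_dvd_mul_right ⟨p, by linarith⟩
    obtain ⟨i, rfl⟩ := Int.natCast_dvd_natCast.1 hdvd
    refine ⟨i, mul_comm _ _, ?_⟩
    have hp : p = i * P := by
      have hw' : (w : ℤ) ≠ 0 := by exact_mod_cast hw.ne'
      apply mul_left_cancel₀ hw'
      push_cast at hD
      linarith
    have e : ((w * i : ℕ) : ℝ) * α - ((i * P : ℤ) : ℝ) = i * (w * α - P) := by
      push_cast
      ring
    rw [hp, e, abs_mul, Nat.abs_cast]
  · left
    have h1 : (1 : ℝ) ≤ |(t * P - w * p : ℝ)| := by exact_mod_cast Int.one_le_abs hD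
    have e : (t * P - w * p : ℝ) = w * (t * α - p) - t * (w * α - P) := by ring
    rw [e] at h1
    have h2 := abs_sub (w * (t * α - p)) (t * (w * α - P))
    rw [abs_mul, abs_mul, Nat.abs_cast, Nat.abs_cast] at h2
    linarith

/-- Among `w` consecutive integers some `N` has `N α` close to `β` modulo one. -/
theorem exists_mem_window_abs_sub_le (α x β : ℝ) {w : ℕ} {P : ℤ} (hw : 0 < w)
    (hcop : IsCoprime (w : ℤ) P) :
    ∃ N p : ℤ, x - w ≤ N ∧ (N : ℝ) ≤ x ∧
      |N * α - p - β| ≤ 1 / (2 * w) + |w * α - P| := by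
  have hw' : (0 : ℝ) < w := by exact_mod_cast hw
  have hwz : (0 : ℤ) < w := by exact_mod_cast hw
  set θ : ℝ := α - P / w with hθ
  have hθw : w * |θ| = |w * α - P| := by
    rw [← Nat.abs_cast w, ← abs_mul, Nat.abs_cast, hθ]
    congr 1
    field_simp
  set k : ℤ := round (w * (β - x * θ)) with hk
  obtain ⟨u, v, huv⟩ := hcop
  set N : ℤ := ⌊x⌋ - (⌊x⌋ - v * k) % w with hN
  have hmod0 := Int.emod_nonneg (⌊x⌋ - v * k) hwz.ne'
  have hmod1 := Int.emod_lt_of_pos (⌊x⌋ - v * k) hwz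
  have hdiv := Int.emod_add_mul_ediv (⌊x⌋ - v * k) w
  set d : ℤ := (⌊x⌋ - v * k) / w
  set p : ℤ := d * P - u * k with hp
  have hNk : N * P - k = w * p := by
    have : N = v * k + w * d := by rw [hN]; linarith
    rw [this, hp]
    linear_combination k * huv
  have hNle : (N : ℝ) ≤ x := by
    have : N ≤ ⌊x⌋ := by omega
    exact (Int.cast_le.2 this).trans (Int.floor_le x)
  have hNge : x - w ≤ N := by
    have : ⌊x⌋ + 1 - w ≤ N := by omega
    have h1 : ((⌊x⌋ + 1 - w : ℤ) : ℝ) ≤ N := Int.cast_le.2 this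
    push_cast at h1
    linarith [Int.lt_floor_add_one x]
  refine ⟨N, p, hNge, hNle, ?_⟩
  have hNk' : (N * P - k : ℝ) = w * p := by exact_mod_cast hNk
  have e : N * α - p - β = -(w * (β - x * θ) - k) / w + (N - x) * θ := by
    have : (p : ℝ) = (N * P - k) / w := by rw [hNk']; field_simp
    rw [this, hθ]
    field_simp
    ring
  rw [e]
  refine (abs_add_le _ _).trans (add_le_add ?_ ?_)
  · rw [abs_div, abs_neg, Nat.abs_cast, div_le_div_iff₀ hw' (by positivity)]
    have := abs_sub_round (w * (β - x * θ))
    nlinarith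
  · rw [abs_mul, ← hθw]
    gcongr
    rw [abs_le]
    constructor <;> linarith

/-- At every scale `σ / 8 ^ j` the set `F j` is locally contained in one short interval. -/
def IsSparse (F : ℕ → Set ℝ) (a σ : ℝ) : Prop :=
  ∀ (j : ℕ) (b : ℝ), a ≤ b → b + σ / 8 ^ j ≤ a + σ →
    ∃ z, ∀ y ∈ F j, b ≤ y → y ≤ b + σ / 8 ^ j → |y - z| < σ / 8 ^ j / 8

theorem exists_subinterval_avoiding {S T : Set ℝ} {b ℓ z₁ z₂ : ℝ} (hℓ : 0 < ℓ)
    (hS : ∀ y ∈ S, b ≤ y → y ≤ b + ℓ → |y - z₁| < ℓ / 8)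
    (hT : ∀ y ∈ T, b ≤ y → y ≤ b + ℓ → |y - z₂| < ℓ / 8) :
    ∃ b', b ≤ b' ∧ b' + ℓ / 8 ≤ b + ℓ ∧ ∀ y, b' ≤ y → y ≤ b' + ℓ / 8 → y ∉ S ∧ y ∉ T := by
  by_contra! hcon
  have key : ∀ b', b ≤ b' → b' + ℓ / 8 ≤ b + ℓ →
      (∃ y, b' ≤ y ∧ y ≤ b' + ℓ / 8 ∧ |y - z₁| < ℓ / 8) ∨
      (∃ y, b' ≤ y ∧ y ≤ b' + ℓ / 8 ∧ |y - z₂| < ℓ / 8) := by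
    intro b' h1 h2
    obtain ⟨y, hy1, hy2, hy⟩ := hcon b' h1 h2
    by_cases hyS : y ∈ S
    · exact Or.inl ⟨y, hy1, hy2, hS y hyS (by linarith) (by linarith)⟩
    · exact Or.inr ⟨y, hy1, hy2, hT y (hy hyS) (by linarith) (by linarith)⟩
  have k1 := key b (by linarith) (by linarith)
  have k2 := key (b + 3 * ℓ / 8) (by linarith) (by linarith)
  have k3 := key (b + 6 * ℓ / 8) (by linarith) (by linarith)
  rcases k1 with ⟨y1, a1, b1, c1⟩ | ⟨y1, a1, b1, c1⟩ <;>
  rcases k2 with ⟨y2, a2, b2, c2⟩ | ⟨y2, a2, b2, c2⟩ <;>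
  rcases k3 with ⟨y3, a3, b3, c3⟩ | ⟨y3, a3, b3, c3⟩ <;>
  rw [abs_lt] at c1 c2 c3 <;> linarith [c1.1, c1.2, c2.1, c2.2, c3.1, c3.2]

theorem exists_avoiding_of_isSparse {F G : ℕ → Set ℝ} {a σ : ℝ} (hσ : 0 < σ)
    (hF : IsSparse F a σ) (hG : IsSparse G a σ) :
    ∃ x, a ≤ x ∧ x ≤ a + σ ∧ ∀ j, x ∉ F j ∧ x ∉ G j := by
  have step : ∀ (j : ℕ) (b : ℝ), ∃ b', a ≤ b → b + σ / 8 ^ j ≤ a + σ →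
      b ≤ b' ∧ b' + σ / 8 ^ (j + 1) ≤ b + σ / 8 ^ j ∧
        ∀ y, b' ≤ y → y ≤ b' + σ / 8 ^ (j + 1) → y ∉ F j ∧ y ∉ G j := by
    intro j b
    by_cases h : a ≤ b ∧ b + σ / 8 ^ j ≤ a + σ
    · obtain ⟨z₁, hz₁⟩ := hF j b h.1 h.2
      obtain ⟨z₂, hz₂⟩ := hG j b h.1 h.2
      obtain ⟨b', h1, h2, h3⟩ := exists_subinterval_avoiding (by positivity) hz₁ hz₂
      rw [div_div, ← pow_succ] at h2 h3
      exact ⟨b', fun _ _ => ⟨h1, h2, h3⟩⟩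
    · exact ⟨b, fun h1 h2 => absurd ⟨h1, h2⟩ h⟩
  choose nxt hnxt using step
  set b : ℕ → ℝ := fun j => Nat.rec a nxt j with hb
  have hsucc : ∀ j, b (j + 1) = nxt j (b j) := fun j => rfl
  have hinv : ∀ j, a ≤ b j ∧ b j + σ / 8 ^ j ≤ a + σ := by
    intro j
    induction j with
    | zero => simp [hb]
    | succ j ih =>
      obtain ⟨h1, h2, -⟩ := hnxt j (b j) ih.1 ih.2
      rw [hsucc]
      exact ⟨ih.1.trans h1, h2.trans ih.2⟩
  have hmono : Monotone b := monotone_nat_of_le_succ fun j =>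
    (hnxt j (b j) (hinv j).1 (hinv j).2).1
  have hanti : Antitone fun j => b j + σ / 8 ^ j := antitone_nat_of_succ_le fun j =>
    (hnxt j (b j) (hinv j).1 (hinv j).2).2.1
  have hle : ∀ i j, b i ≤ b j + σ / 8 ^ j := by
    intro i j
    calc b i ≤ b (max i j) := hmono (le_max_left _ _)
      _ ≤ b (max i j) + σ / 8 ^ (max i j) := by
        have : 0 < σ / 8 ^ (max i j) := by positivity
        linarith
      _ ≤ _ := hanti (le_max_right i j)
  have hbdd : BddAbove (Set.range b) := ⟨b 0 + σ / 8 ^ 0, by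
    rintro _ ⟨i, rfl⟩
    exact hle i 0⟩
  have hx1 : ∀ j, b j ≤ ⨆ i, b i := fun j => le_ciSup hbdd j
  have hx2 : ∀ j, ⨆ i, b i ≤ b j + σ / 8 ^ j := fun j => ciSup_le fun i => hle i j
  refine ⟨⨆ i, b i, hx1 0, by simpa [hb] using hx2 0, fun j => ?_⟩
  exact (hnxt j (b j) (hinv j).1 (hinv j).2).2.2 _ (hx1 (j + 1)) (hx2 (j + 1))

/-- The least positive denominator approximating `α` to within `1 / R`. -/
noncomputable def minDen (α R : ℝ) : ℕ := sInf {m : ℕ | 0 < m ∧ ∃ p : ℤ, |m * α - p| < 1 / R}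

theorem minDen_spec (α : ℝ) {R : ℝ} (hR : 0 < R) :
    0 < minDen α R ∧ ∃ p : ℤ, |minDen α R * α - p| < 1 / R := by
  have hne : {m : ℕ | 0 < m ∧ ∃ p : ℤ, |m * α - p| < 1 / R}.Nonempty := by
    obtain ⟨n, hn⟩ := exists_nat_gt R
    have hn0 : 0 < n := by exact_mod_cast hR.trans hn
    obtain ⟨k, hk, -, h⟩ := Real.exists_nat_abs_mul_sub_round_le α hn0
    refine ⟨k, hk, _, h.trans_lt ?_⟩
    apply one_div_lt_one_div_of_lt hR
    linarith
  exact Nat.sInf_mem hne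

theorem one_div_le_of_lt_minDen {α R : ℝ} {m : ℕ} (hm : 0 < m) (h : m < minDen α R) (p : ℤ) :
    1 / R ≤ |m * α - p| := by
  by_contra! hlt
  exact Nat.notMem_of_lt_sInf h ⟨hm, p, hlt⟩

theorem minDen_mono (α : ℝ) {R R' : ℝ} (hR : 0 < R) (h : R ≤ R') : minDen α R ≤ minDen α R' := by
  obtain ⟨h0, p, hp⟩ := minDen_spec α (hR.trans_le h)
  exact Nat.sInf_le ⟨h0, p, hp.trans_le (one_div_le_one_div_of_le hR h)⟩

theorem exists_lt_minDen {α : ℝ} (hα : Irrational α) {R : ℝ} (hR : 0 < R) (M : ℕ) :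
    ∃ j : ℕ, M < minDen α (R * 8 ^ j) := by
  obtain ⟨ρ, hρ, h⟩ := exists_pos_forall_le_abs_mul_sub hα M
  obtain ⟨j, hj⟩ := pow_unbounded_of_one_lt (1 / (ρ * R)) (by norm_num : (1 : ℝ) < 8)
  refine ⟨j, ?_⟩
  by_contra! hle
  obtain ⟨h0, p, hp⟩ := minDen_spec α (R := R * 8 ^ j) (by positivity)
  have := h _ h0 hle p
  rw [div_lt_iff₀ (by positivity)] at hj
  have h2 : 1 / (R * 8 ^ j) < ρ := by
    rw [div_lt_iff₀ (by positivity)]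
    nlinarith
  linarith

/-- A target avoiding the levels starting from `R` is badly approximable, with the possible
exception of the multiples of the first denominator. -/
theorem le_mul_abs_or_multiple {α : ℝ} (hα : Irrational α) {R y : ℝ} (hR : 1 ≤ R)
    (hy : |y| ≤ 1 / (2 * R))
    (havoid : ∀ (j m : ℕ) (p : ℤ), m < minDen α (R * 8 ^ j) →
      1 / 256 / (R * 8 ^ j) ≤ |m * α - p - y|)
    {m : ℕ} (hm : minDen α R ≤ m) (p : ℤ) :
    (1 / 2 ^ 24 : ℝ) ≤ m * |m * α - p - y| ∨
      ((∃ (i : ℕ) (P : ℤ), m = i * minDen α R ∧ p = i * P ∧ |minDen α R * α - P| < 1 / R ∧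
        1 / 2 ^ 11 * |minDen α R * α - P| ≤ |m * α - p - y|) ∧
        ∀ j, minDen α R < minDen α (R * 8 ^ j) → m < minDen α (R * 8 ^ j)) := by
  have hR0 : 0 < R := by linarith
  have hRj : ∀ j : ℕ, 0 < R * 8 ^ j := fun j => by positivity
  have hmono : ∀ i j : ℕ, i ≤ j → minDen α (R * 8 ^ i) ≤ minDen α (R * 8 ^ j) := fun i j hij =>
    minDen_mono α (hRj i) (by gcongr; norm_num)
  -- the first level whose denominator exceeds `m`
  have hex := exists_lt_minDen hα hR0 m
  classical
  have hspec := Nat.find_spec hex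
  have hmin := fun k => Nat.find_min hex (m := k)
  set J := Nat.find hex with hJ
  have hJ0 : J ≠ 0 := by
    intro h0
    rw [h0, pow_zero, mul_one] at hspec
    omega
  obtain ⟨j, hj⟩ := Nat.exists_eq_succ_of_ne_zero hJ0
  have hXm : minDen α (R * 8 ^ j) ≤ m := not_lt.1 (hmin j (by omega))
  rw [hj] at hspec
  obtain ⟨hX0, P, hP⟩ := minDen_spec α (hRj j)
  have hlev := havoid (j + 1) m p hspec
  -- the first level with the same denominator
  have hex' : ∃ k, minDen α (R * 8 ^ k) = minDen α (R * 8 ^ j) := ⟨j, rfl⟩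
  have hspec' := Nat.find_spec hex'
  have hmin' := fun k => Nat.find_min hex' (m := k)
  have hkj : Nat.find hex' ≤ j := Nat.find_min' hex' rfl
  set k := Nat.find hex' with hk
  set X := minDen α (R * 8 ^ j) with hX
  set δ := |X * α - P| with hδ
  have hX0' : (0 : ℝ) < X := by exact_mod_cast hX0
  have hδ0 : 0 ≤ δ := abs_nonneg _
  set i := m / X with hi
  set b := m % X with hb
  have hbX : b < X := Nat.mod_lt _ hX0
  have hmib : m = b + i * X := by rw [hb, hi, mul_comm]; exact (Nat.mod_add_div m X).symm
  have hi1 : 1 ≤ i := (Nat.one_le_div_iff hX0).2 hXm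
  have hi1' : (1 : ℝ) ≤ i := by exact_mod_cast hi1
  have hlevδ : 1 / 2 ^ 11 * δ ≤ |m * α - p - y| := by
    refine le_trans ?_ hlev
    have : δ ≤ 8 / (R * 8 ^ (j + 1)) := hP.le.trans_eq (by field_simp; ring)
    calc 1 / 2 ^ 11 * δ ≤ 1 / 2 ^ 11 * (8 / (R * 8 ^ (j + 1))) := by gcongr
      _ = _ := by field_simp; norm_num
  have hmX : (X : ℝ) ≤ m := by exact_mod_cast hXm
  have hmiX : (i : ℝ) * X ≤ m := by
    rw [hmib]; push_cast
    have : (0 : ℝ) ≤ b := by positivity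
    linarith
  -- the estimate for the remainder suffices
  have main : 1 / 2 ^ 12 ≤ X * |b * α - (p - i * P : ℤ) - y| →
      (1 / 2 ^ 24 : ℝ) ≤ m * |m * α - p - y| := by
    intro hb'
    rcases le_total (i * δ) (1 / 2 ^ 13 / X) with hid | hid
    · have e : m * α - p - y = (b * α - (p - i * P : ℤ) - y) + i * (X * α - P) := by
        rw [hmib]; push_cast; ring
      have h1 : |b * α - (p - i * P : ℤ) - y| ≤ |m * α - p - y| + i * δ := by
        have : (b * α - (p - i * P : ℤ) - y) = (m * α - p - y) - i * (X * α - P) := by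
          rw [e]; ring
        rw [this]
        refine (abs_sub _ _).trans_eq ?_
        rw [abs_mul, Nat.abs_cast]
      have h2 : X * (1 / 2 ^ 13 / X) = (1 / 2 ^ 13 : ℝ) := by field_simp
      have h3 : X * |b * α - (p - i * P : ℤ) - y| ≤
          X * |m * α - p - y| + X * (1 / 2 ^ 13 / X) := by
        rw [← mul_add]; gcongr; linarith
      have h4 : X * |m * α - p - y| ≤ m * |m * α - p - y| := by gcongr
      rw [h2] at h3
      norm_num at *
      linarith
    · have h2 : X * (1 / 2 ^ 13 / X) = (1 / 2 ^ 13 : ℝ) := by field_simp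
      calc (1 / 2 ^ 24 : ℝ) = 1 / 2 ^ 11 * (X * (1 / 2 ^ 13 / X)) := by rw [h2]; norm_num
        _ ≤ 1 / 2 ^ 11 * (X * (i * δ)) := by gcongr
        _ = i * X * (1 / 2 ^ 11 * δ) := by ring
        _ ≤ m * |m * α - p - y| := by gcongr
  rcases Nat.eq_zero_or_pos k with hk0 | hkpos
  · rw [hk0, pow_zero, mul_one] at hspec'
    have hfirst : ∀ z : ℝ, 2 * |y| ≤ |z| → 1 / 2 ≤ X * |z| → 1 / 2 ^ 12 ≤ X * |z - y| := by
      intro z h1 h2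
      have h3 : |z| / 2 ≤ |z - y| := by linarith [abs_sub_abs_le_abs_sub z y]
      have h4 : X * (|z| / 2) ≤ X * |z - y| := by gcongr
      norm_num at *
      linarith
    have hyR : 2 * |y| ≤ 1 / R := by
      calc 2 * |y| ≤ 2 * (1 / (2 * R)) := by gcongr
        _ = 1 / R := by field_simp
    have hyR1 : 1 / R ≤ 1 := by rw [div_le_one hR0]; exact hR
    rcases Nat.eq_zero_or_pos b with hb0 | hbpos
    · by_cases hpP : p = i * P
      · right
        refine ⟨⟨i, P, by rw [hspec']; omega, hpP, ?_, by rw [hspec']; exact hlevδ⟩, ?_⟩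
        · rw [hspec']
          refine hP.trans_le (one_div_le_one_div_of_le hR0 ?_)
          exact le_mul_of_one_le_right hR0.le (one_le_pow₀ (by norm_num))
        · intro l hl
          have : j < l := by
            by_contra! hlj
            have := hmono l j hlj
            omega
          exact hspec.trans_le (hmono _ _ this)
      · left
        apply main
        have hpz : p - i * P ≠ 0 := sub_ne_zero.2 hpP
        have h1 : (1 : ℝ) ≤ |((p - i * P : ℤ) : ℝ)| := by exact_mod_cast Int.one_le_abs hpz
        have hX1 : (1 : ℝ) ≤ X := by exact_mod_cast hX0
        apply hfirst
        · rw [hb0, Nat.cast_zero, zero_mul, zero_sub, abs_neg]; linarith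
        · rw [hb0, Nat.cast_zero, zero_mul, zero_sub, abs_neg]; nlinarith
    · left
      apply main
      have h1 := one_div_le_of_lt_minDen (R := R) hbpos (by rw [hspec']; exact hbX) (p - i * P)
      apply hfirst
      · linarith
      · apply half_le_mul_abs_of_lt (P := P) hbX
        refine lt_of_lt_of_le ?_ h1
        refine hP.trans_le (one_div_le_one_div_of_le hR0 ?_)
        exact le_mul_of_one_le_right hR0.le (one_le_pow₀ (by norm_num))
  · left
    apply main
    obtain ⟨l, hl⟩ := Nat.exists_eq_succ_of_ne_zero hkpos.ne'
    have h1 := havoid k b (p - i * P) (by rw [hspec']; exact hbX)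
    -- the previous denominator is smaller, so `X` is comparable with the level
    obtain ⟨hW0, p', hp'⟩ := minDen_spec α (hRj l)
    have hWX : minDen α (R * 8 ^ l) < X := by
      refine lt_of_le_of_ne (hmono l j (by omega)) ?_
      exact hmin' l (by omega)
    have hWlow := one_div_le_of_lt_minDen (R := R * 8 ^ k) hW0 (by rw [hspec']; exact hWX) p'
    have hPk : δ < 1 / (R * 8 ^ k) := by
      obtain ⟨-, P', hP'⟩ := minDen_spec α (hRj k)
      refine hP.trans_le (one_div_le_one_div_of_le (hRj k) ?_)
      gcongr
      norm_num
    have h2 := half_le_mul_abs_of_lt hWX (hPk.trans_le hWlow)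
    have h3 : (1 / 2 : ℝ) ≤ X * (1 / (R * 8 ^ l)) := h2.trans (by gcongr)
    calc (1 / 2 ^ 12 : ℝ) = 1 / 2 ^ 11 * (1 / 2) := by norm_num
      _ ≤ 1 / 2 ^ 11 * (X * (1 / (R * 8 ^ l))) := by gcongr
      _ = X * (1 / 256 / (R * 8 ^ k)) := by rw [hl]; field_simp; rw [pow_succ]; ring
      _ ≤ _ := by gcongr

theorem eq_of_abs_sub_lt_of_lt_minDen {α R : ℝ} (hR : 1 ≤ R) {m n : ℕ} {p r : ℤ}
    (hm : m < minDen α R) (hn : n < minDen α R)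
    (h : |(m * α - p) - (n * α - r)| < 1 / R) : (m * α - p : ℝ) = n * α - r := by
  rcases lt_trichotomy m n with hlt | rfl | hlt
  · have := one_div_le_of_lt_minDen (α := α) (R := R) (m := n - m) (by omega) (by omega) (r - p)
    rw [Nat.cast_sub hlt.le, abs_sub_comm] at *
    push_cast at this
    rw [show (n * α - r - (m * α - p) : ℝ) = (n - m) * α - (r - p) by ring] at h
    rw [abs_sub_comm] at this
    linarith
  · have h1 : |((r - p : ℤ) : ℝ)| < 1 := by
      have h2 : 1 / R ≤ 1 := by rw [div_le_one (by linarith)]; exact hR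
      push_cast
      rw [show (r - p : ℝ) = m * α - p - (m * α - r) by ring]
      linarith
    have h3 : r - p = 0 := Int.abs_lt_one_iff.1 (by exact_mod_cast h1)
    rw [show p = r by omega]
  · have := one_div_le_of_lt_minDen (α := α) (R := R) (m := m - n) (by omega) (by omega) (p - r)
    rw [Nat.cast_sub hlt.le] at this
    push_cast at this
    rw [show (m * α - p - (n * α - r) : ℝ) = (m - n) * α - (p - r) by ring] at h
    linarith

theorem isSparse_reciprocal (α : ℝ) {Q c s : ℝ} (hQ : 1 ≤ Q) (hc : 0 < c) (hcQ : 4 * c ≤ 1)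
    (hs : |s| = 1) :
    IsSparse (fun j => {x : ℝ | ∃ (m : ℕ) (p : ℤ), m < minDen α (Q / (4 * c) * 8 ^ j) ∧
      |m * α - p - s * (c / x)| < 1 / 256 / (Q / (4 * c) * 8 ^ j)}) (Q / 2) (Q / 2) := by
  intro j b hb1 hb2
  by_cases hex : ∃ z : ℝ, (∃ (m : ℕ) (p : ℤ), m < minDen α (Q / (4 * c) * 8 ^ j) ∧
      |m * α - p - s * (c / z)| < 1 / 256 / (Q / (4 * c) * 8 ^ j)) ∧ b ≤ z ∧ z ≤ b + Q / 2 / 8 ^ j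
  · obtain ⟨z, ⟨m, p, hm, hmz⟩, hz1, hz2⟩ := hex
    refine ⟨z, ?_⟩
    rintro y ⟨n, r, hn, hny⟩ hy1 hy2
    have h8 : (1 : ℝ) ≤ 8 ^ j := one_le_pow₀ (by norm_num)
    have hR : 1 ≤ Q / (4 * c) * 8 ^ j := by
      have : 1 ≤ Q / (4 * c) := by rw [le_div_iff₀ (by positivity)]; linarith
      nlinarith
    have hy0 : 0 < y := by linarith
    have hz0 : 0 < z := by linarith
    have hsub : s * (c / y) - s * (c / z) = s * (c * (z - y) / (y * z)) := by
      field_simp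
    have habs : |s * (c / y) - s * (c / z)| = c * |z - y| / (y * z) := by
      rw [hsub, abs_mul, hs, one_mul, abs_div, abs_mul, abs_of_pos hc,
        abs_of_pos (mul_pos hy0 hz0)]
    have hzy : |z - y| ≤ Q / 2 / 8 ^ j := by
      rw [abs_le]; constructor <;> linarith
    have hyz : Q / 2 * (Q / 2) ≤ y * z := by
      apply mul_le_mul <;> linarith
    have hyz' : y * z ≤ Q * Q := by
      apply mul_le_mul <;> linarith
    have h1 : |s * (c / y) - s * (c / z)| ≤ 1 / 2 / (Q / (4 * c) * 8 ^ j) := by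
      rw [habs]
      calc c * |z - y| / (y * z) ≤ c * (Q / 2 / 8 ^ j) / (Q / 2 * (Q / 2)) := by gcongr
        _ = _ := by field_simp; norm_num
    have hRinv : 0 < 1 / (Q / (4 * c) * 8 ^ j) := by positivity
    have e1 : 1 / 2 / (Q / (4 * c) * 8 ^ j) = 1 / 2 * (1 / (Q / (4 * c) * 8 ^ j)) := by ring
    have e2 : 1 / 256 / (Q / (4 * c) * 8 ^ j) = 1 / 256 * (1 / (Q / (4 * c) * 8 ^ j)) := by ring
    have e3 : 1 / (Q / (4 * c) * 8 ^ j) = 4 * c / (Q * 8 ^ j) := by field_simp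
    rw [e2] at hmz hny
    rw [e1] at h1
    have heq : (n * α - r : ℝ) = m * α - p := by
      apply eq_of_abs_sub_lt_of_lt_minDen hR hn hm
      rw [abs_lt] at *
      rw [abs_le] at h1
      constructor <;> linarith [h1.1, h1.2, hmz.1, hmz.2, hny.1, hny.2]
    have h2 : |s * (c / y) - s * (c / z)| < 1 / 128 * (1 / (Q / (4 * c) * 8 ^ j)) := by
      rw [heq] at hny
      rw [abs_lt] at *
      constructor <;> linarith [hmz.1, hmz.2, hny.1, hny.2]
    rw [habs, e3, div_lt_iff₀ (mul_pos hy0 hz0)] at h2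
    rw [abs_sub_comm]
    have h3 : c * |z - y| < c * (Q / 32 / 8 ^ j) := by
      calc c * |z - y| < 1 / 128 * (4 * c / (Q * 8 ^ j)) * (y * z) := h2
        _ ≤ 1 / 128 * (4 * c / (Q * 8 ^ j)) * (Q * Q) := by gcongr
        _ = _ := by field_simp; norm_num
    have h4 := lt_of_mul_lt_mul_left h3 hc.le
    refine h4.trans_le ?_
    calc Q / 32 / 8 ^ j ≤ Q / 16 / 8 ^ j := by gcongr; norm_num
      _ = Q / 2 / 8 ^ j / 8 := by ring
  · push Not at hex
    refine ⟨0, fun y hy h1 h2 => ?_⟩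
    exact absurd h2 (not_le.2 (hex y hy h1))

/-- A target at distance `c / x` from `0`, with `x` outside a prescribed sparse family, which is
badly approximable and whose approximations by later points have products at least `N * c / x`. -/
theorem exists_target {α : ℝ} (hα : Irrational α) {Q c : ℝ} (hQ : 1 ≤ Q) (hc : 0 < c)
    (hc' : c ≤ 1 / 2 ^ 24) {G : ℕ → Set ℝ} (hG : IsSparse G (Q / 2) (Q / 2)) :
    ∃ x y : ℝ, Q / 2 ≤ x ∧ x ≤ Q ∧ (∀ j, x ∉ G j) ∧ |y| = c / x ∧
      (∃ A : ℕ, ∀ m : ℕ, A ≤ m → ∀ p : ℤ, (1 / 2 ^ 24 : ℝ) ≤ m * |m * α - p - y|) ∧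
      ∀ N : ℝ, Q / 4 ≤ N → N ≤ x → ∀ m : ℕ, 0 < m → ∀ p : ℤ,
        N * (c / x) ≤ (N + m) * |m * α - p - y| := by
  have hQ0 : 0 < Q := by linarith
  have hc24 : (1 / 2 ^ 24 : ℝ) < 1 / 2 ^ 16 := by norm_num
  have hc16 : c < 1 / 2 ^ 16 := hc'.trans_lt hc24
  have hc4 : 4 * c ≤ 1 := by norm_num at hc16; linarith
  obtain ⟨s, hs, hsgn⟩ := exists_sign_forall_mul_nonpos α Q (2 ^ 12) hQ0 (by norm_num)
  obtain ⟨x, hx1, hx2, hx⟩ := exists_avoiding_of_isSparse (by positivity)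
    (isSparse_reciprocal α hQ hc hc4 hs) hG
  have hx2 : x ≤ Q := by linarith
  have hx0 : 0 < x := by linarith
  set R := Q / (4 * c) with hR
  set γ := c / x with hγ
  have hγ0 : 0 < γ := by positivity
  have hγQ : γ ≤ 2 * c / Q := by
    rw [hγ, div_le_div_iff₀ hx0 hQ0]; nlinarith
  have hR1 : 1 ≤ R := by rw [hR, le_div_iff₀ (by positivity)]; linarith
  have hR0 : 0 < R := by linarith
  have habs : |s * γ| = γ := by rw [abs_mul, hs, one_mul, abs_of_pos hγ0]
  have hRγ : 2 * γ ≤ 1 / R := by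
    calc 2 * γ ≤ 2 * (2 * c / Q) := by gcongr
      _ = 1 / R := by rw [hR]; field_simp; norm_num
  have hyR : |s * γ| ≤ 1 / (2 * R) := by
    have : 1 / (2 * R) = 1 / R / 2 := by field_simp
    rw [habs, this]; linarith
  have havoid : ∀ (j m : ℕ) (p : ℤ), m < minDen α (R * 8 ^ j) →
      1 / 256 / (R * 8 ^ j) ≤ |m * α - p - s * γ| := by
    intro j m p hm
    by_contra! hlt
    exact (hx j).1 ⟨m, p, hm, hlt⟩
  have hss : s * s = 1 := by rw [← abs_mul_abs_self, hs, one_mul]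
  have hside : ∀ z : ℝ, s * z ≤ 0 → γ ≤ |z - s * γ| := by
    intro z hz
    have h1 : |z - s * γ| = |s * z - γ| := by
      have : s * z - γ = s * (z - s * γ) := by linear_combination (1 - 0) * γ * hss
      rw [this, abs_mul, hs, one_mul]
    rw [h1, abs_of_nonpos (by linarith)]
    linarith
  refine ⟨x, s * γ, hx1, hx2, fun j => (hx j).2, habs, ?_, ?_⟩
  · obtain ⟨j, hj⟩ := exists_lt_minDen hα hR0 (minDen α R)
    refine ⟨minDen α (R * 8 ^ j), fun m hm p => ?_⟩
    rcases le_mul_abs_or_multiple hα hR1 hyR havoid (hj.le.trans hm) p with h | ⟨-, h⟩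
    · exact h
    · exact absurd (h j hj) (by omega)
  · intro N hN1 hN2 m hm p
    have hN0 : 0 < N := by linarith
    have hm0 : (0 : ℝ) < m := by exact_mod_cast hm
    have hNγ : N * γ ≤ c := by
      calc N * γ ≤ x * γ := by gcongr
        _ = c := by rw [hγ]; field_simp
    have hNγQ : N * γ ≤ Q * γ := by gcongr; linarith
    have of_le : γ ≤ |m * α - p - s * γ| → N * γ ≤ (N + m) * |m * α - p - s * γ| := by
      intro h
      have : N ≤ N + m := by linarith
      gcongr
    have of_le' : ∀ u : ℝ, u ≤ m * |m * α - p - s * γ| → N * γ ≤ u →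
        N * γ ≤ (N + m) * |m * α - p - s * γ| := by
      intro u h1 h2
      have : 0 ≤ N * |m * α - p - s * γ| := by positivity
      linarith
    rcases le_or_gt (m : ℝ) (2 ^ 12 * Q) with hmQ | hmQ
    · rcases lt_or_ge |m * α - p| (1 / (2 * 2 ^ 12 * Q)) with hlt | hge
      · exact of_le (hside _ (hsgn m p hm hmQ hlt))
      · have h1 : |m * α - p| - γ ≤ |m * α - p - s * γ| := by
          have := abs_sub_abs_le_abs_sub (m * α - p) (s * γ)
          rwa [habs] at this
        have h2 : γ ≤ 1 / (4 * 2 ^ 12 * Q) := by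
          refine hγQ.trans ?_
          rw [div_le_div_iff₀ hQ0 (by positivity)]
          norm_num at *
          nlinarith
        have h3 : 1 / (2 * 2 ^ 12 * Q) = 2 * (1 / (4 * 2 ^ 12 * Q)) := by field_simp; norm_num
        have h4 : 1 / (4 * 2 ^ 12 * Q) ≤ |m * α - p - s * γ| := by linarith
        calc N * γ ≤ c := hNγ
          _ ≤ Q / 4 * (1 / (4 * 2 ^ 12 * Q)) := by
            refine hc16.le.trans_eq ?_
            field_simp; norm_num
          _ ≤ (N + m) * |m * α - p - s * γ| := by
            gcongr
            linarith
    rcases lt_or_ge m (minDen α R) with hmX | hmX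
    · apply of_le
      have h1 := one_div_le_of_lt_minDen hm hmX p
      have h2 := abs_sub_abs_le_abs_sub (m * α - p) (s * γ)
      rw [habs] at h2
      linarith
    rcases le_mul_abs_or_multiple hα hR1 hyR havoid hmX p with h |
      ⟨⟨i, P, rfl, rfl, hδR, hδ⟩, -⟩
    · exact of_le' _ h (hNγ.trans hc')
    set X := minDen α R with hX
    have hX0 : 0 < X := (minDen_spec α hR0).1
    have hX0' : (0 : ℝ) < X := by exact_mod_cast hX0
    set δ := |X * α - P| with hδdef
    have hδ0 : 0 ≤ δ := abs_nonneg _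
    have e : ((i * X : ℕ) : ℝ) * α - ((i * P : ℤ) : ℝ) = i * (X * α - P) := by push_cast; ring
    have eabs : |((i * X : ℕ) : ℝ) * α - ((i * P : ℤ) : ℝ)| = i * δ := by
      rw [e, abs_mul, Nat.abs_cast]
    rcases le_total (i * δ) (γ / 2) with hid | hid
    · have h2 := abs_sub_abs_le_abs_sub (s * γ) (((i * X : ℕ) : ℝ) * α - ((i * P : ℤ) : ℝ))
      rw [habs, eabs, abs_sub_comm] at h2
      have h3 : γ / 2 ≤ |((i * X : ℕ) : ℝ) * α - ((i * P : ℤ) : ℝ) - s * γ| := by linarith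
      have h4 : N ≤ ((i * X : ℕ) : ℝ) := by linarith
      calc N * γ = (N + N) * (γ / 2) := by ring
        _ ≤ _ := by gcongr
    · rcases le_or_gt (X : ℝ) (2 ^ 12 * Q) with hXQ | hXQ
      · rcases lt_or_ge δ (1 / (2 * 2 ^ 12 * Q)) with hlt | hge
        · apply of_le
          apply hside
          rw [e]
          have := hsgn X P hX0 hXQ hlt
          have hi : (0 : ℝ) ≤ i := by positivity
          nlinarith
        · apply of_le' (((i * X : ℕ) : ℝ) * (1 / 2 ^ 11 * δ)) (by gcongr)
          calc N * γ ≤ c := hNγ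
            _ ≤ 2 ^ 12 * Q * (1 / 2 ^ 11 * (1 / (2 * 2 ^ 12 * Q))) := by
              refine hc16.le.trans ?_
              rw [show 2 ^ 12 * Q * (1 / 2 ^ 11 * (1 / (2 * 2 ^ 12 * Q))) = 1 / 2 ^ 12 by
                field_simp]
              norm_num
            _ ≤ _ := by gcongr
      · apply of_le' (((i * X : ℕ) : ℝ) * (1 / 2 ^ 11 * δ)) (by gcongr)
        calc N * γ ≤ Q * γ := hNγQ
          _ = 2 ^ 12 * Q * (1 / 2 ^ 11 * (γ / 2)) := by ring
          _ ≤ X * (1 / 2 ^ 11 * (i * δ)) := by gcongr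
          _ = _ := by push_cast; ring

/-- Every badly approximable `β` has arbitrarily large scales `Q` such that, for all `x` in
`[Q / 2, Q]` outside a sparse family, some `N` just below `x` has `N * α` close to `β` modulo one,
and the differences `(N - q) * α` stay away from the integers at the scale `1 / q`. -/
def HasGoodScales (α μ κ : ℝ) : Prop :=
  ∀ (β : ℝ) (A : ℕ), (∀ q : ℕ, A ≤ q → ∀ p : ℤ, (1 / 2 ^ 24 : ℝ) ≤ q * |q * α - p - β|) →
    ∀ η : ℝ, 0 < η → η ≤ 1 / 2 →
    ∃ Q : ℝ, 1 / η ≤ Q ∧ (∀ t : ℕ, 0 < t → (t : ℝ) ≤ Q → ∀ p : ℤ, κ / Q ≤ |t * α - p|) ∧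
    ∃ F : ℕ → Set ℝ, IsSparse F (Q / 2) (Q / 2) ∧
    ∀ x : ℝ, Q / 2 ≤ x → x ≤ Q → (∀ j, x ∉ F j) →
      ∃ (N : ℕ) (p₀ : ℤ), (1 - η) * x ≤ N ∧ (N : ℝ) ≤ x ∧ |N * α - p₀ - β| ≤ η ∧
        ∀ q : ℕ, A ≤ q → q < N → ∀ p : ℤ, μ ≤ q * |((N - q : ℕ) : ℝ) * α - p|

theorem exists_isCoprime_abs_le (α : ℝ) {m : ℕ} (hm : 0 < m) (p : ℤ) :
    ∃ (w : ℕ) (P : ℤ), 0 < w ∧ w ≤ m ∧ IsCoprime (w : ℤ) P ∧ |w * α - P| ≤ |m * α - p| := by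
  have hg : 0 < Int.gcd m p := Int.gcd_pos_of_ne_zero_left _ (by exact_mod_cast hm.ne')
  obtain ⟨P, hP⟩ : (Int.gcd m p : ℤ) ∣ p := Int.gcd_dvd_right ..
  obtain ⟨w, hw⟩ : Int.gcd m p ∣ m := by exact_mod_cast Int.gcd_dvd_left (m : ℤ) p
  have hw0 : 0 < w := by
    rcases Nat.eq_zero_or_pos w with rfl | h
    · omega
    · exact h
  set g := Int.gcd m p with hgdef
  refine ⟨w, P, hw0, ?_, ?_, ?_⟩
  · rw [hw]; exact Nat.le_mul_of_pos_left _ hg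
  · rw [Int.isCoprime_iff_gcd_eq_one]
    have h1 : Int.gcd ((g : ℤ) * w) (g * P) = g * Int.gcd w P := by
      rw [Int.gcd_mul_left]; simp
    have h2 : Int.gcd ((g : ℤ) * w) (g * P) = g := by
      rw [← hP, show ((g : ℤ) * w) = (m : ℤ) by rw [← Nat.cast_mul, ← hw]]
    rw [h2] at h1
    exact Nat.eq_of_mul_eq_mul_left hg (by omega)
  · have e : (m * α - p : ℝ) = g * (w * α - P) := by
      rw [hP]
      conv_lhs => rw [hw]
      push_cast; ring
    rw [e, abs_mul, Nat.abs_cast]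
    exact le_mul_of_one_le_left (abs_nonneg _) (by exact_mod_cast hg)

/-- Transferring a lower bound for `β` at `q` to a lower bound for `(N - q) * α`. -/
theorem le_mul_abs_sub_of_lt {α β c ε : ℝ} {N q : ℕ} {p₀ : ℤ} (hq : q < N)
    (hβ : ∀ p : ℤ, c ≤ q * |q * α - p - β|) (hN : |N * α - p₀ - β| ≤ ε) (p : ℤ) :
    c - q * ε ≤ q * |((N - q : ℕ) : ℝ) * α - p| := by
  have h := hβ (p₀ - p)
  have e : (q * α - (p₀ - p : ℤ) - β : ℝ) =
      (N * α - p₀ - β) - (((N - q : ℕ) : ℝ) * α - p) := by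
    rw [Nat.cast_sub hq.le]; push_cast; ring
  rw [e] at h
  have h2 : |(N * α - p₀ - β) - (((N - q : ℕ) : ℝ) * α - p)| ≤
      ε + |((N - q : ℕ) : ℝ) * α - p| := (abs_sub _ _).trans (by gcongr)
  have h3 : (q : ℝ) * |(N * α - p₀ - β) - (((N - q : ℕ) : ℝ) * α - p)| ≤
      q * (ε + |((N - q : ℕ) : ℝ) * α - p|) := by gcongr
  linarith

theorem isSparse_empty (a σ : ℝ) : IsSparse (fun _ => ∅) a σ :=
  fun _ _ _ _ => ⟨0, fun _ h => h.elim⟩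

theorem hasGoodScales_of_unbounded {α : ℝ} (hα : Irrational α)
    (h : ∀ κ : ℝ, 0 < κ → ∃ m : ℕ, 0 < m ∧ ∃ p : ℤ, m * |m * α - p| < κ) :
    HasGoodScales α (1 / 2 ^ 24 / 64) (1 / 2) := by
  intro β A hβ η hη hη'
  have hc0 : (0 : ℝ) < 1 / 2 ^ 24 := by norm_num
  have hc1 : (1 / 2 ^ 24 : ℝ) ≤ 1 := by norm_num
  generalize (1 / 2 ^ 24 : ℝ) = c at *
  obtain ⟨M, hM⟩ := exists_nat_gt (1 / η)
  obtain ⟨ρ, hρ, hρM⟩ := exists_pos_forall_le_abs_mul_sub hα M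
  obtain ⟨m, hm, p, hmp⟩ := h (min ρ (η / 4)) (by positivity)
  obtain ⟨w, P, hw, hwm, hcop, hwP⟩ := exists_isCoprime_abs_le α hm p
  obtain ⟨ρ', hρ', hρw⟩ := exists_pos_forall_le_abs_mul_sub hα w
  have hδ0 : 0 < |w * α - P| := hρ'.trans_le (hρw w hw le_rfl P)
  have hwδ : w * |w * α - P| < min ρ (η / 4) := by
    refine lt_of_le_of_lt ?_ hmp
    gcongr
  obtain ⟨hwδ1, hwδ2⟩ := lt_min_iff.1 hwδ
  have hw1 : (1 : ℝ) ≤ w := by exact_mod_cast hw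
  have hMw : M < w := by
    by_contra! hle
    have := hρM w hw hle P
    nlinarith
  have hMw' : (M : ℝ) < w := by exact_mod_cast hMw
  have hwη : 1 / w ≤ η := by
    rw [div_le_iff₀ (by linarith)]
    rw [div_lt_iff₀ hη] at hM
    nlinarith
  set δ := |w * α - P| with hδ
  have hw0 : (0 : ℝ) < w := by linarith
  have hδw : δ ≤ 1 / (2 * w) := by
    rw [le_div_iff₀ (by positivity)]; linarith
  have hmul : ∀ t : ℕ, (t : ℝ) ≤ 1 / (2 * δ) → ∀ p : ℤ, 1 / 2 ≤ w * |t * α - p| ∨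
      ∃ i : ℕ, t = i * w ∧ |t * α - p| = i * δ := by
    intro t ht p
    refine half_le_or_exists_multiple hw hcop ?_
    rw [le_div_iff₀ (by positivity)] at ht
    linarith
  refine ⟨1 / (2 * δ), ?_, ?_, fun _ => ∅, isSparse_empty _ _, ?_⟩
  · rw [div_le_div_iff₀ hη (by positivity)]
    nlinarith
  · intro t ht htQ p
    have e : 1 / 2 / (1 / (2 * δ)) = δ := by field_simp
    rw [e]
    rcases hmul t htQ p with h1 | ⟨i, rfl, h1⟩
    · have : w * δ ≤ w * |t * α - p| := by linarith
      exact le_of_mul_le_mul_left this hw0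
    · rw [h1]
      have : 0 < i := Nat.pos_of_mul_pos_right ht
      have : (1 : ℝ) ≤ i := by exact_mod_cast this
      nlinarith
  · intro x hx1 hx2 _
    have e : 1 / (2 * δ) / 2 * δ = 1 / 4 := by field_simp; norm_num
    have hxδ : 1 / 4 ≤ x * δ := by
      rw [← e]; gcongr
    have hwx : w ≤ η * x := by
      have : w * δ ≤ η * x * δ := by nlinarith
      exact le_of_mul_le_mul_right this hδ0
    have hx0 : 0 < x := pos_of_mul_pos_left (by linarith) hδ0.le
    obtain ⟨N, p₀, hN1, hN2, hN3⟩ := exists_mem_window_abs_sub_le α x β hw hcop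
    have hN0 : (0 : ℝ) < N := by nlinarith
    lift N to ℕ using by exact_mod_cast hN0.le
    rw [Int.cast_natCast] at hN1 hN2 hN3 hN0
    have hN3' : |N * α - p₀ - β| ≤ 1 / w := by
      refine hN3.trans ?_
      have : 1 / (2 * (w : ℝ)) + 1 / (2 * w) = 1 / w := by field_simp; norm_num
      linarith
    refine ⟨N, p₀, by linarith, hN2, hN3'.trans hwη, ?_⟩
    intro q hqA hqN p
    have hgood := le_mul_abs_sub_of_lt hqN (hβ q hqA) hN3' p
    set t := N - q with ht
    have ht0 : 0 < t := by omega
    have hsum : (t : ℝ) + q = N := by exact_mod_cast (by omega : t + q = N)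
    have hq0 : (0 : ℝ) ≤ q := by positivity
    rcases le_or_gt (q : ℝ) (c / 4 * w) with hqw | hqw
    · have : (q : ℝ) * (1 / w) ≤ c / 4 := by
        rw [mul_one_div, div_le_iff₀ hw0]; exact hqw
      linarith
    rcases hmul t (by linarith) p with h1 | ⟨i, hi, h1⟩
    · have : c / 4 * w * |t * α - p| ≤ q * |t * α - p| := by gcongr
      have h2 : c / 4 * (1 / 2) ≤ c / 4 * (w * |t * α - p|) := by gcongr
      linarith
    · rw [h1]
      have hi0 : 0 < i := Nat.pos_of_mul_pos_right (hi ▸ ht0)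
      have hi1 : (1 : ℝ) ≤ i := by exact_mod_cast hi0
      have hNδ : 1 / 8 ≤ N * δ := by
        have h2 : η * x ≤ 1 / 2 * x := by gcongr
        have h3 : x / 2 * δ ≤ N * δ := by gcongr; linarith
        linarith
      rcases le_total (N / 2 : ℝ) q with hqN2 | hqN2
      · have h4 : N / 2 * (1 * δ) ≤ q * (i * δ) := by gcongr
        linarith
      · have hti : (t : ℝ) = i * w := by exact_mod_cast hi
        have h3 : 1 / 16 ≤ w * (i * δ) := by
          have h2 : N / 2 * δ ≤ t * δ := by gcongr; linarith
          rw [hti] at h2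
          linarith
        have h4 : c / 4 * w * (i * δ) ≤ q * (i * δ) := by gcongr
        have h5 : c / 4 * (1 / 16) ≤ c / 4 * (w * (i * δ)) := by gcongr
        linarith

/-- If `α` is badly approximable, the points close to some `t` with `t * α` close to an integer
form a sparse family. -/
theorem isSparse_near_multiples {α κ : ℝ} (hκ : 0 < κ)
    (h : ∀ m : ℕ, 0 < m → ∀ p : ℤ, κ ≤ m * |m * α - p|) {a σ : ℝ} (hσ : 0 < σ) :
    IsSparse (fun j => {x : ℝ | ∃ (t : ℕ) (p : ℤ), |t * α - p| < κ / (4 * (σ / 8 ^ j)) ∧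
      |x - t| < σ / 8 ^ j / 16}) a σ := by
  intro j b _ _
  have hsj : 0 < σ / 8 ^ j := by positivity
  simp only [Set.mem_ofPred_eq]
  generalize σ / 8 ^ j = s at *
  by_cases hex : ∃ y : ℝ, (∃ (t : ℕ) (p : ℤ), |t * α - p| < κ / (4 * s) ∧ |y - t| < s / 16) ∧
      b ≤ y ∧ y ≤ b + s
  · obtain ⟨y, ⟨t, p, ht, hty⟩, hy1, hy2⟩ := hex
    refine ⟨t, ?_⟩
    rintro z ⟨u, r, hu, huz⟩ hz1 hz2
    suffices hut : u = t by rw [← hut]; linarith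
    have key : ∀ (u t : ℕ) (r p : ℤ), |u * α - r| < κ / (4 * s) → |t * α - p| < κ / (4 * s) →
        u < t → 2 * s ≤ t - u := by
      intro u t r p hu ht hlt
      have h1 := h (t - u) (by omega) (p - r)
      rw [Nat.cast_sub hlt.le, Int.cast_sub,
        show ((t - u) * α - (p - r) : ℝ) = (t * α - p) - (u * α - r) by ring] at h1
      have hpos : (0 : ℝ) < t - u := by rw [sub_pos]; exact_mod_cast hlt
      have h2 : |(t * α - p) - (u * α - r)| ≤ κ / (4 * s) + κ / (4 * s) :=
        (abs_sub _ _).trans (by gcongr)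
      have e : κ / (4 * s) + κ / (4 * s) = κ / (2 * s) := by field_simp; norm_num
      have h3 : κ ≤ (t - u) * (κ / (2 * s)) := by
        rw [← e]; exact h1.trans (by gcongr)
      rw [← mul_div_assoc, le_div_iff₀ (by positivity)] at h3
      nlinarith
    rw [abs_lt] at hty huz
    rcases lt_trichotomy u t with hlt | heq | hlt
    · have := key u t r p hu ht hlt
      linarith
    · exact heq
    · have := key t u p r ht hu hlt
      linarith
  · push Not at hex
    exact ⟨0, fun y hy h1 h2 => absurd h2 (not_le.2 (hex y hy h1))⟩

theorem hasGoodScales_of_bounded {α κ : ℝ} (hκ : 0 < κ)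
    (h : ∀ m : ℕ, 0 < m → ∀ p : ℤ, κ ≤ m * |m * α - p|) :
    ∃ μ : ℝ, 0 < μ ∧ HasGoodScales α μ κ := by
  have hc0 : (0 : ℝ) < 1 / 2 ^ 24 := by norm_num
  unfold HasGoodScales
  generalize (1 / 2 ^ 24 : ℝ) = c at *
  set C := 32 + 16 / κ with hC
  have hC0 : 0 < C := by positivity
  set κ₂ := c / (2 * C) with hκ₂
  have hκ₂0 : 0 < κ₂ := by positivity
  refine ⟨min (κ / 1024) (min (κ * κ₂ / 4) (c / 2)), by positivity, ?_⟩
  intro β A hβ η hη hη'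
  obtain ⟨J, hJ⟩ := pow_unbounded_of_one_lt (1 / η) (by norm_num : (1 : ℝ) < 8)
  set ρ := max 32 (C / η) with hρ
  have hρ32 : 32 ≤ ρ := le_max_left _ _
  have hρ0 : 0 < ρ := by linarith
  have hCρ : C / ρ ≤ η := by
    have : C / η ≤ ρ := le_max_right _ _
    rw [div_le_iff₀ hη] at this
    rw [div_le_iff₀ hρ0]; linarith
  set S := ρ * 8 ^ J with hS
  have hS0 : 0 < S := by positivity
  have e2 : 2 * S / 2 = S := by ring
  have hηS : ρ ≤ η * S := by
    rw [div_lt_iff₀ hη] at hJ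
    rw [hS]
    nlinarith
  have hQ : ∀ t : ℕ, 0 < t → (t : ℝ) ≤ 2 * S → ∀ p : ℤ, κ / (2 * S) ≤ |t * α - p| := by
    intro t ht htQ p
    rw [div_le_iff₀ (by positivity)]
    calc κ ≤ t * |t * α - p| := h t ht p
      _ ≤ 2 * S * |t * α - p| := by gcongr
      _ = _ := mul_comm _ _
  refine ⟨2 * S, ?_, hQ, ?_⟩
  · rw [div_le_iff₀ hη]; linarith
  rw [e2]
  refine ⟨_, isSparse_near_multiples hκ h hS0, ?_⟩
  intro x hx1 hx2 hx
  -- a denominator `w` of size about `ρ`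
  obtain ⟨w, P, hw, hwρ, hcop, hwP⟩ : ∃ (w : ℕ) (P : ℤ), 0 < w ∧ (w : ℝ) ≤ ρ / 32 ∧
      IsCoprime (w : ℤ) P ∧ |w * α - P| ≤ 32 / ρ := by
    have hn : 0 < ⌊ρ / 32⌋₊ := Nat.floor_pos.2 (by linarith)
    obtain ⟨k, hk, hkn, hk2⟩ := Real.exists_nat_abs_mul_sub_round_le α hn
    obtain ⟨w, P, hw, hwk, hcop, hwP⟩ := exists_isCoprime_abs_le α hk (round (k * α))
    refine ⟨w, P, hw, ?_, hcop, ?_⟩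
    · exact (Nat.cast_le.2 (hwk.trans hkn)).trans (Nat.floor_le (by positivity))
    · refine (hwP.trans hk2).trans ?_
      have := Nat.lt_floor_add_one (ρ / 32)
      rw [div_le_div_iff₀ (by positivity) hρ0]
      linarith
  have hw0 : (0 : ℝ) < w := by exact_mod_cast hw
  have hwlow : κ * ρ / 32 ≤ w := by
    have h1 : κ ≤ w * (32 / ρ) := (h w hw P).trans (by gcongr)
    rw [← mul_div_assoc, le_div_iff₀ hρ0] at h1
    linarith
  obtain ⟨N, p₀, hN1, hN2, hN3⟩ := exists_mem_window_abs_sub_le α x β hw hcop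
  have hN0 : (0 : ℝ) < N := by nlinarith
  lift N to ℕ using by exact_mod_cast hN0.le
  rw [Int.cast_natCast] at hN1 hN2 hN3 hN0
  have hN3' : |N * α - p₀ - β| ≤ C / ρ := by
    refine hN3.trans ?_
    have h1 : 1 / (2 * (w : ℝ)) ≤ 1 / (2 * (κ * ρ / 32)) := by gcongr
    have h2 : 1 / (2 * (κ * ρ / 32)) + 32 / ρ = C / ρ := by
      rw [hC]; field_simp; ring
    linarith
  refine ⟨N, p₀, ?_, hN2, hN3'.trans hCρ, ?_⟩
  · have : η * S ≤ η * x := by gcongr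
    linarith
  intro q hqA hqN p
  have hgood := le_mul_abs_sub_of_lt hqN (hβ q hqA) hN3' p
  set t := N - q with ht
  have ht0 : 0 < t := by omega
  have hsum : (t : ℝ) + q = N := by exact_mod_cast (by omega : t + q = N)
  have hq0 : (0 : ℝ) ≤ q := by positivity
  by_cases hex : ∃ j, j ≤ J ∧ |t * α - p| < κ / (4 * (S / 8 ^ j))
  · refine (min_le_left _ _).trans ?_
    classical
    obtain ⟨hjJ, hj⟩ := Nat.find_spec hex
    have hmin := fun k => Nat.find_min hex (m := k)
    set j := Nat.find hex with hjdef
    have hj0 : j ≠ 0 := by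
      intro h0
      rw [h0, pow_zero, div_one] at hj
      have h1 := hQ t ht0 (by linarith) p
      have h2 : κ / (4 * S) ≤ κ / (2 * S) := by gcongr; norm_num
      linarith
    obtain ⟨k, hk⟩ := Nat.exists_eq_succ_of_ne_zero hj0
    have h1 : κ / (4 * (S / 8 ^ k)) ≤ |t * α - p| := by
      by_contra! hlt
      exact hmin k (by omega) ⟨by omega, hlt⟩
    have h2 : S / 8 ^ j / 16 ≤ |x - t| := by
      by_contra! hlt
      exact hx j ⟨t, p, hj, hlt⟩
    rw [abs_of_nonneg (by linarith)] at h2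
    have h3 : ρ ≤ S / 8 ^ j := by
      rw [le_div_iff₀ (by positivity), hS]
      gcongr
      norm_num
    have h4 : S / 8 ^ j / 32 ≤ q := by linarith
    calc κ / 1024 = S / 8 ^ j / 32 * (κ / (4 * (S / 8 ^ k))) := by
          rw [hk]; field_simp; rw [pow_succ]; ring
      _ ≤ q * |t * α - p| := by gcongr
  · refine (min_le_right _ _).trans ?_
    push Not at hex
    have h1 := hex J le_rfl
    rw [show S / 8 ^ J = ρ by rw [hS]; field_simp] at h1
    rcases le_total (κ₂ * ρ) q with hqρ | hqρ
    · refine (min_le_left _ _).trans ?_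
      calc κ * κ₂ / 4 = κ₂ * ρ * (κ / (4 * ρ)) := by field_simp
        _ ≤ q * |t * α - p| := by gcongr
    · refine (min_le_right _ _).trans ?_
      have h2 : q * (C / ρ) ≤ κ₂ * ρ * (C / ρ) := by gcongr
      have h3 : κ₂ * ρ * (C / ρ) = c / 2 := by rw [hκ₂]; field_simp
      linarith

theorem exists_hasGoodScales {α : ℝ} (hα : Irrational α) :
    ∃ μ κ : ℝ, 0 < μ ∧ 0 < κ ∧ HasGoodScales α μ κ := by
  by_cases h : ∃ κ : ℝ, 0 < κ ∧ ∀ m : ℕ, 0 < m → ∀ p : ℤ, κ ≤ m * |m * α - p|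
  · obtain ⟨κ, hκ, h⟩ := h
    obtain ⟨μ, hμ, h'⟩ := hasGoodScales_of_bounded hκ h
    exact ⟨μ, κ, hμ, hκ, h'⟩
  · push Not at h
    exact ⟨_, _, by norm_num, by norm_num, hasGoodScales_of_unbounded hα h⟩

/-- Perturbing a badly approximable `β` so that the products from `A` on become at least about `c`,
with a product at most `c` attained, while staying badly approximable. -/
theorem HasGoodScales.exists_step {α μ κ : ℝ} (hα : Irrational α) (hs : HasGoodScales α μ κ)
    {c : ℝ} (hc : 0 < c) (hc' : c ≤ 1 / 2 ^ 24) (hcκ : 4 * c ≤ κ) (hcμ : 2 * c ≤ μ)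
    {β : ℝ} {A : ℕ} (hβ : ∀ q : ℕ, A ≤ q → ∀ p : ℤ, (1 / 2 ^ 24 : ℝ) ≤ q * |q * α - p - β|)
    {η : ℝ} (hη : 0 < η) :
    ∃ (β' : ℝ) (A' N : ℕ), |β' - β| ≤ η ∧ A ≤ N ∧ N < A' ∧
      (∃ p : ℤ, N * |N * α - p - β'| ≤ c) ∧
      (∀ q : ℕ, A ≤ q → ∀ p : ℤ, (1 - η) * c ≤ q * |q * α - p - β'|) ∧
      ∀ q : ℕ, A' ≤ q → ∀ p : ℤ, (1 / 2 ^ 24 : ℝ) ≤ q * |q * α - p - β'| := by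
  have hA0 : (0 : ℝ) ≤ A := by positivity
  have hc24 : (1 / 2 ^ 24 : ℝ) ≤ 1 / 4 := by norm_num
  obtain ⟨ε, hε0, hεη, hε4, hεA⟩ : ∃ ε : ℝ, 0 < ε ∧ ε ≤ η / 2 ∧ ε ≤ 1 / 4 ∧
      ε ≤ 1 / (4 * A + 4) :=
    ⟨min (η / 2) (min (1 / 4) (1 / (4 * A + 4))), by positivity, min_le_left _ _,
      (min_le_right _ _).trans (min_le_left _ _), (min_le_right _ _).trans (min_le_right _ _)⟩
  obtain ⟨Q, hQ, hQκ, F, hF, hFx⟩ := hs β A hβ ε hε0 (by linarith)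
  have hQA : 4 * (A : ℝ) + 4 ≤ Q := by
    refine le_trans ?_ hQ
    rw [le_div_iff₀ hε0]
    rw [le_div_iff₀ (by positivity)] at hεA
    linarith
  have hQ0 : 0 < Q := by linarith
  have hQε : 1 ≤ Q * ε := (div_le_iff₀ hε0).1 hQ
  obtain ⟨x, y, hx1, hx2, hxF, hy, ⟨A₀, hA₀⟩, hlater⟩ :=
    exists_target hα (by linarith) hc hc' hF
  obtain ⟨N, p₀, hN1, hN2, hN3, hpast⟩ := hFx x hx1 hx2 hxF
  have hx0 : 0 < x := by linarith
  have hεx : ε * x ≤ 1 / 4 * x := by gcongr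
  have hNQ : Q / 4 ≤ N := by linarith
  have hAN : A ≤ N := by
    have : (A : ℝ) ≤ N := by linarith
    exact_mod_cast this
  have hyQ : |y| ≤ 2 * c / Q := by
    rw [hy, div_le_div_iff₀ hx0 hQ0]; nlinarith
  have hyε : |y| ≤ ε := by
    refine hyQ.trans ?_
    rw [div_le_iff₀ hQ0]; linarith
  have hηN : (1 - η) * c ≤ N * (c / x) := by
    have h1 : (1 - η) * x ≤ N := by
      have : (1 - η) * x ≤ (1 - ε) * x := by gcongr; linarith
      linarith
    calc (1 - η) * c = (1 - η) * x * (c / x) := by field_simp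
      _ ≤ N * (c / x) := by gcongr
  refine ⟨N * α - p₀ + y, N + A₀ + 1, N, ?_, hAN, by omega, ⟨p₀, ?_⟩, ?_, ?_⟩
  · rw [show N * α - p₀ + y - β = (N * α - p₀ - β) + y by ring]
    refine (abs_add_le _ _).trans ?_
    linarith
  · rw [show N * α - p₀ - (N * α - p₀ + y) = -y by ring, abs_neg, hy]
    calc N * (c / x) ≤ x * (c / x) := by gcongr
      _ = c := by field_simp
  · intro q hq p
    rcases lt_trichotomy q N with hlt | rfl | hlt
    · have h1 := hpast q hq hlt (p₀ - p)
      have hNq : ((N - q : ℕ) : ℝ) ≤ N := by exact_mod_cast Nat.sub_le N q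
      have h2 := hQκ (N - q) (by omega) (by linarith) (p₀ - p)
      have h3 : 2 * |y| ≤ |((N - q : ℕ) : ℝ) * α - (p₀ - p : ℤ)| := by
        refine le_trans ?_ h2
        calc 2 * |y| ≤ 2 * (2 * c / Q) := by gcongr
          _ = 4 * c / Q := by ring
          _ ≤ κ / Q := by gcongr
      have e : (q * α - p - (N * α - p₀ + y) : ℝ) =
          -(((N - q : ℕ) : ℝ) * α - (p₀ - p : ℤ) - -y) := by
        rw [Nat.cast_sub hlt.le]; push_cast; ring
      have h4 := abs_sub_abs_le_abs_sub (((N - q : ℕ) : ℝ) * α - (p₀ - p : ℤ)) (-y)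
      rw [abs_neg] at h4
      rw [e, abs_neg]
      generalize |((N - q : ℕ) : ℝ) * α - (p₀ - p : ℤ)| = u at *
      generalize |((N - q : ℕ) : ℝ) * α - (p₀ - p : ℤ) - -y| = v at *
      have h5 : q * (u / 2) ≤ q * v := by gcongr; linarith
      nlinarith
    · refine hηN.trans ?_
      rw [← hy]
      refine mul_le_mul_of_nonneg_left ?_ (by positivity)
      rw [show q * α - p - (q * α - p₀ + y) = (p₀ - p : ℤ) - y by push_cast; ring]
      rcases eq_or_ne p₀ p with rfl | hne
      · simp
      · have h1 : (1 : ℝ) ≤ |((p₀ - p : ℤ) : ℝ)| := by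
          exact_mod_cast Int.one_le_abs (sub_ne_zero.2 hne)
        have h2 := abs_sub_abs_le_abs_sub ((p₀ - p : ℤ) : ℝ) y
        linarith
    · refine hηN.trans ?_
      have h1 := hlater N hNQ hN2 (q - N) (by omega) (p - p₀)
      rw [Nat.cast_sub hlt.le] at h1
      push_cast at h1
      rwa [show (N + (q - N) : ℝ) = q by ring,
        show (q - N) * α - (p - p₀) - y = q * α - p - (N * α - p₀ + y) by ring] at h1
  · intro q hq p
    have h1 := hA₀ (q - N) (by omega) (p - p₀)
    rw [Nat.cast_sub (by omega)] at h1
    push_cast at h1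
    rw [show (q - N) * α - (p - p₀) - y = q * α - p - (N * α - p₀ + y) by ring] at h1
    refine h1.trans ?_
    gcongr
    linarith [Nat.cast_nonneg (α := ℝ) N]

theorem Mplus_eq_of_forall {α β c : ℝ}
    (hlow : ∀ ε : ℝ, 0 < ε → ∀ᶠ q : ℕ in atTop, ∀ p : ℤ, c - ε ≤ q * |q * α - p - β|)
    (hup : ∀ ε : ℝ, 0 < ε → ∃ᶠ q : ℕ in atTop, ∃ p : ℤ, q * |q * α - p - β| ≤ c + ε) :
    Mplus α β = c := by
  have hup' : ∀ ε : ℝ, 0 < ε → ∃ᶠ q : ℕ in atTop, (q : ℝ) * nint (q * α - β) ≤ c + ε := by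
    intro ε hε
    refine (hup ε hε).mono ?_
    rintro q ⟨p, hp⟩
    refine le_trans ?_ hp
    refine mul_le_mul_of_nonneg_left ?_ (Nat.cast_nonneg q)
    exact (round_le (q * α - β) p).trans_eq (congrArg abs (sub_right_comm ..))
  have hlow' : ∀ ε : ℝ, 0 < ε → ∀ᶠ q : ℕ in atTop, c - ε ≤ (q : ℝ) * nint (q * α - β) := by
    intro ε hε
    filter_upwards [hlow ε hε] with q hq
    have := hq (round (q * α - β))
    rwa [sub_right_comm] at this
  apply le_antisymm
  · refine le_of_forall_pos_le_add fun ε hε => ?_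
    refine liminf_le_of_frequently_le (hup' ε hε) ⟨c - 1, ?_⟩
    exact hlow' 1 one_pos
  · refine le_of_forall_pos_le_add fun ε hε => ?_
    rw [← sub_le_iff_le_add]
    exact le_liminf_of_le (IsCoboundedUnder.of_frequently_le (hup' 1 one_pos)) (hlow' ε hε)

theorem exists_Mplus_eq {α μ κ : ℝ} (hα : Irrational α) (hs : HasGoodScales α μ κ)
    {M c : ℝ} (hM : 0 < M) (hM' : M ≤ 1 / 2 ^ 24) (hMκ : 4 * M ≤ κ) (hMμ : 2 * M ≤ μ)
    (hc : 0 ≤ c) (hcM : c ≤ M / 2) : ∃ β : ℝ, Mplus α β = c := by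
  have hM1 : M ≤ 1 := hM'.trans (by norm_num)
  set C : ℕ → ℝ := fun i => c + M / 2 / (i + 1) with hC
  have hcC : ∀ i, c < C i := fun i => by
    have : 0 < M / 2 / ((i : ℝ) + 1) := by positivity
    simp only [hC]; linarith
  have hCM : ∀ i, C i ≤ M := fun i => by
    have : M / 2 / ((i : ℝ) + 1) ≤ M / 2 :=
      div_le_self (by positivity) (by linarith [Nat.cast_nonneg (α := ℝ) i])
    simp only [hC]; linarith
  set Good : ℝ × ℕ → Prop := fun s => ∀ q : ℕ, s.2 ≤ q → ∀ p : ℤ,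
    (1 / 2 ^ 24 : ℝ) ≤ q * |q * α - p - s.1| with hGood
  have step : ∀ (i : ℕ) (s : {s // Good s}), ∃ s' : {s // Good s},
      |s'.1.1 - s.1.1| ≤ 1 / 2 ^ i / (s.1.2 + 1) / 2 ∧ ∃ N : ℕ, s.1.2 ≤ N ∧ N < s'.1.2 ∧
        (∃ p : ℤ, N * |N * α - p - s'.1.1| ≤ C i) ∧
        ∀ q : ℕ, s.1.2 ≤ q → ∀ p : ℤ,
          (1 - 1 / 2 ^ i / (s.1.2 + 1) / 2) * C i ≤ q * |q * α - p - s'.1.1| := by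
    rintro i ⟨⟨β, A⟩, hβ⟩
    obtain ⟨β', A', N, h1, h2, h3, h4, h5, h6⟩ := hs.exists_step hα (c := C i)
      (hc.trans_lt (hcC i)) ((hCM i).trans hM') (by linarith [hCM i]) (by linarith [hCM i]) hβ
      (η := 1 / 2 ^ i / (A + 1) / 2) (by positivity)
    exact ⟨⟨⟨β', A'⟩, h6⟩, h1, N, h2, h3, h4, h5⟩
  choose f hf N hN using step
  obtain ⟨-, y, -, -, -, -, ⟨A₀, hA₀⟩, -⟩ :=
    exists_target hα le_rfl hM hM' (isSparse_empty (1 / 2) (1 / 2))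
  set s : ℕ → {s // Good s} := fun n => Nat.rec ⟨⟨y, A₀⟩, hA₀⟩ f n with hsdef
  set b : ℕ → ℝ := fun n => (s n).1.1 with hb
  set A : ℕ → ℕ := fun n => (s n).1.2 with hA
  have hAN : ∀ n, A n ≤ N n (s n) := fun n => (hN n (s n)).1
  have hNA : ∀ n, N n (s n) < A (n + 1) := fun n => (hN n (s n)).2.1
  have hAmono : StrictMono A := strictMono_nat_of_lt_succ fun n => (hAN n).trans_lt (hNA n)
  have hdist : ∀ i n, dist (b (i + n)) (b (i + (n + 1))) ≤ 1 / 2 ^ i / (A i + 1) / 2 / 2 ^ n := by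
    intro i n
    rw [dist_comm, Real.dist_eq]
    have h1 : |b (i + n + 1) - b (i + n)| ≤ 1 / 2 ^ (i + n) / (A (i + n) + 1) / 2 :=
      hf (i + n) (s (i + n))
    have h2 : (A i : ℝ) ≤ A (i + n) := by
      exact_mod_cast hAmono.monotone (Nat.le_add_right i n)
    calc |b (i + n + 1) - b (i + n)| ≤ 1 / 2 ^ (i + n) / (A (i + n) + 1) / 2 := h1
      _ ≤ 1 / 2 ^ (i + n) / (A i + 1) / 2 := by gcongr
      _ = _ := by rw [pow_add]; field_simp
  obtain ⟨β, hβ⟩ := cauchySeq_tendsto_of_complete (cauchySeq_of_le_geometric_two (f := b)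
    (C := 1 / 2 ^ 0 / (A 0 + 1)) fun n => by simpa only [zero_add] using hdist 0 n)
  have hlim : ∀ i, |b i - β| ≤ 1 / 2 ^ i / (A i + 1) := by
    intro i
    rw [← Real.dist_eq]
    refine dist_le_of_le_geometric_two_of_tendsto₀ (f := fun n => b (i + n)) (hdist i) ?_
    simpa only [add_comm i] using (tendsto_add_atTop_iff_nat i).2 hβ
  have hclose : ∀ (i q : ℕ) (p : ℤ), q < A (i + 1) →
      |(q * |q * α - p - β|) - (q * |q * α - p - b (i + 1)|)| ≤ 1 / 2 ^ (i + 1) := by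
    intro i q p hq
    have hq' : (q : ℝ) ≤ A (i + 1) + 1 := by
      have : (q : ℝ) < A (i + 1) := by exact_mod_cast hq
      linarith
    rw [← mul_sub, abs_mul, Nat.abs_cast]
    have h1 := abs_abs_sub_abs_le_abs_sub (q * α - p - β) (q * α - p - b (i + 1))
    rw [show q * α - p - β - (q * α - p - b (i + 1)) = b (i + 1) - β by ring] at h1
    calc _ ≤ (A (i + 1) + 1 : ℝ) * (1 / 2 ^ (i + 1) / (A (i + 1) + 1)) := by
          gcongr
          exact h1.trans (hlim (i + 1))
      _ = _ := by field_simp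
  refine ⟨β, Mplus_eq_of_forall ?_ ?_⟩
  · intro ε hε
    obtain ⟨I, hI⟩ := exists_pow_lt_of_lt_one hε (by norm_num : (1 / 2 : ℝ) < 1)
    filter_upwards [eventually_ge_atTop (A I)] with q hq p
    obtain ⟨i, hIi, hi1, hi2⟩ : ∃ i, I ≤ i ∧ A i ≤ q ∧ q < A (i + 1) := by
      have hex : ∃ j, q < A j := ⟨q + 1, hAmono.le_apply⟩
      classical
      have h0 := Nat.find_spec hex
      have hIj : I < Nat.find hex := by
        by_contra! hle
        have := hAmono.monotone hle
        omega
      obtain ⟨i, hi⟩ := Nat.exists_eq_succ_of_ne_zero (Nat.ne_of_gt (Nat.zero_lt_of_lt hIj))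
      refine ⟨i, by omega, not_lt.1 (Nat.find_min hex (by omega)), ?_⟩
      rwa [hi] at h0
    have h1 : (1 - 1 / 2 ^ i / (A i + 1) / 2) * C i ≤ q * |q * α - p - b (i + 1)| :=
      (hN i (s i)).2.2.2 q hi1 p
    have h2 := (abs_le.1 (hclose i q p hi2)).1
    have h3 : 1 / 2 ^ i / ((A i : ℝ) + 1) / 2 ≤ 1 / 2 ^ (i + 1) := by
      rw [pow_succ, ← div_div]
      refine div_le_div_of_nonneg_right ?_ zero_le_two
      exact div_le_self (by positivity) (by linarith [Nat.cast_nonneg (α := ℝ) (A i)])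
    have h4 : 1 / 2 ^ i / ((A i : ℝ) + 1) / 2 * C i ≤ 1 / 2 ^ (i + 1) * 1 := by
      gcongr
      exact (hCM i).trans hM1
    have h5 : 1 / 2 ^ (i + 1) + 1 / 2 ^ (i + 1) = (1 / 2 : ℝ) ^ i := by
      rw [div_pow, one_pow, pow_succ]; field_simp; norm_num
    have h6 : (1 / 2 : ℝ) ^ i ≤ (1 / 2) ^ I :=
      pow_le_pow_of_le_one (by norm_num) (by norm_num) hIi
    linarith [hcC i]
  · intro ε hε
    rw [frequently_atTop]
    intro a
    have hlim0 : Tendsto (fun i : ℕ => M / 2 / ((i : ℝ) + 1) + (1 / 2) * (1 / 2) ^ i)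
        atTop (nhds (0 + 1 / 2 * 0)) := by
      refine Tendsto.add ?_ (Tendsto.const_mul _ ?_)
      · exact tendsto_const_nhds.div_atTop
          (tendsto_atTop_add_const_right _ _ tendsto_natCast_atTop_atTop)
      · exact tendsto_pow_atTop_nhds_zero_of_lt_one (by norm_num) (by norm_num)
    obtain ⟨i, hi, hia⟩ := ((hlim0.eventually_lt_const (u := ε) (by linarith)).and
      (eventually_ge_atTop a)).exists
    refine ⟨N i (s i), ?_, ?_⟩
    · exact (hia.trans hAmono.le_apply).trans (hAN i)
    · obtain ⟨p, hp⟩ : ∃ p : ℤ, N i (s i) * |N i (s i) * α - p - b (i + 1)| ≤ C i :=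
        (hN i (s i)).2.2.1
      refine ⟨p, ?_⟩
      have h2 := (abs_le.1 (hclose i _ p (hNA i))).2
      have h5 : 1 / 2 ^ (i + 1) = (1 / 2) * (1 / 2 : ℝ) ^ i := by
        rw [div_pow, one_pow, pow_succ]; field_simp
      have h6 : C i = c + M / 2 / (i + 1) := rfl
      linarith

/-- For irrational `α`, the one-sided inhomogeneous approximation spectrum
`S₊(α) = {M₊(α,β) : β ∈ ℝ}` contains an interval `[0, μ_α]` with `μ_α > 0`. -/
theorem stmt0 (α : ℝ) (hα : Irrational α) :
    ∃ μ : ℝ, 0 < μ ∧ Set.Icc (0 : ℝ) μ ⊆ {x : ℝ | ∃ β : ℝ, Mplus α β = x} := by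
  obtain ⟨μ, κ, hμ, hκ, hs⟩ := exists_hasGoodScales hα
  obtain ⟨M, hM, hM1, hMκ, hMμ⟩ : ∃ M : ℝ, 0 < M ∧ M ≤ 1 / 2 ^ 24 ∧ M ≤ κ / 4 ∧ M ≤ μ / 2 :=
    ⟨min (1 / 2 ^ 24) (min (κ / 4) (μ / 2)), by positivity, min_le_left _ _,
      (min_le_right _ _).trans (min_le_left _ _), (min_le_right _ _).trans (min_le_right _ _)⟩
  refine ⟨M / 2, by positivity, fun c hc => ?_⟩
  exact exists_Mplus_eq hα hs hM hM1 (by linarith) (by linarith) hc.1 hc.2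
end

section
/- Let α be an irrational real number. Define the two-sided constant M(α,β) = liminf_{|q|→∞} |q|·‖qα−β‖, the liminf taken over nonzero integers q. Then the set {M(α,β) : β ∈ ℝ} contains an interval of the form [0, μ] for some real μ > 0. -/
open Filter Finset

/-- Two-sided inhomogeneous approximation constant
`M(α,β) = liminf_{|q|→∞} |q|‖qα−β‖` over nonzero integers `q`. -/
noncomputable def Mtwo (α β : ℝ) : ℝ :=
  Filter.liminf (fun q : ℤ => |(q : ℝ)| * nint (q * α - β))
    (Filter.comap (fun q : ℤ => |q|) Filter.atTop)

lemma nint_nonneg (x : ℝ) : 0 ≤ nint x := abs_nonneg _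

lemma nint_le_abs_sub (x : ℝ) (z : ℤ) : nint x ≤ |x - z| := round_le x z

lemma nint_le_abs (x : ℝ) : nint x ≤ |x| := by simpa using nint_le_abs_sub x 0

lemma exists_nint_eq (x : ℝ) : ∃ z : ℤ, nint x = |x - z| := ⟨round x, rfl⟩

lemma le_nint {x t : ℝ} (h : ∀ z : ℤ, t ≤ |x - z|) : t ≤ nint x := h _

lemma nint_add_int (x : ℝ) (z : ℤ) : nint (x + z) = nint x := by
  simp [nint, round_add_intCast]

lemma nint_add_le (x y : ℝ) : nint (x + y) ≤ nint x + nint y := by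
  have h := nint_le_abs_sub (x + y) (round x + round y)
  refine h.trans ?_
  unfold nint
  push_cast
  calc |x + y - ((round x : ℝ) + round y)| = |(x - round x) + (y - round y)| := by ring_nf
    _ ≤ _ := abs_add_le _ _

lemma nint_neg (x : ℝ) : nint (-x) = nint x := by
  have key : ∀ y : ℝ, nint (-y) ≤ nint y := fun y => by
    have h := nint_le_abs_sub (-y) (-round y)
    refine h.trans (le_of_eq ?_)
    unfold nint
    push_cast
    rw [← abs_neg]; ring_nf
  refine le_antisymm (key x) ?_
  simpa using key (-x)

lemma nint_sub_le (x y : ℝ) : nint x - |x - y| ≤ nint y := by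
  have h1 := nint_add_le y (x - y)
  have h2 := nint_le_abs (x - y)
  have : y + (x - y) = x := by ring
  rw [this] at h1
  linarith

lemma nint_int_mul_le (k : ℤ) (x : ℝ) : nint (k * x) ≤ |(k : ℝ)| * nint x := by
  have h := nint_le_abs_sub (k * x) (k * round x)
  refine h.trans (le_of_eq ?_)
  unfold nint
  push_cast
  rw [← abs_mul]; ring_nf

lemma nint_mul_eq_of_abs_eq {x y : ℝ} (h : |x| = |y|) : nint x = nint y := by
  rcases abs_eq_abs.1 h with h | h
  · rw [h]
  · rw [h, nint_neg]

/-- Convergent vectors `(q n, q n * α - p n)` of `α`, with `D n = |q n * α - p n|`. -/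
structure IsConvergents (α : ℝ) (q p : ℕ → ℤ) (D : ℕ → ℝ) : Prop where
  one_le : ∀ n, 1 ≤ q n
  le_succ : ∀ n, q n ≤ q (n + 1)
  two_mul_le : ∀ n, 2 * q n ≤ q (n + 2)
  pos : ∀ n, 0 < D n
  succ_le : ∀ n, D (n + 1) ≤ D n
  two_mul_add_two_le : ∀ n, 2 * D (n + 2) ≤ D n
  abs_eq : ∀ n, |q n * α - p n| = D n
  mul_le_one : ∀ n, q (n + 1) * D n ≤ 1
  half_le_mul : ∀ n, 1 / 2 ≤ q (n + 1) * D n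
  coprime : ∀ n, IsCoprime (q n) (p n)

/-- One step of the continued fraction algorithm on two consecutive convergent vectors. -/
noncomputable def cfStep (α : ℝ) (v : (ℤ × ℤ) × (ℤ × ℤ)) : (ℤ × ℤ) × (ℤ × ℤ) :=
  (v.2, v.1 + ⌊|v.1.1 * α - v.1.2| / |v.2.1 * α - v.2.2|⌋ • v.2)

/-- Consecutive convergent vectors with errors of opposite sign and determinant `±1`. -/
def CFInv (α : ℝ) (v : (ℤ × ℤ) × (ℤ × ℤ)) : Prop :=
  ∃ s : ℤ, (s = 1 ∨ s = -1) ∧ 0 ≤ v.1.1 ∧ 1 ≤ v.2.1 ∧ v.1.1 ≤ v.2.1 ∧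
    0 < s * (v.1.1 * α - v.1.2) ∧ 0 < -s * (v.2.1 * α - v.2.2) ∧
    -s * (v.2.1 * α - v.2.2) < s * (v.1.1 * α - v.1.2) ∧
    v.1.1 * v.2.2 - v.2.1 * v.1.2 = s

lemma cfInv_step {α : ℝ} (hα : Irrational α) {v : (ℤ × ℤ) × (ℤ × ℤ)} (h : CFInv α v) :
    CFInv α (cfStep α v) ∧ v.1.1 + v.2.1 ≤ (cfStep α v).2.1 ∧
      |((cfStep α v).2.1 : ℝ) * α - (cfStep α v).2.2| + |(v.2.1 : ℝ) * α - v.2.2|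
        ≤ |(v.1.1 : ℝ) * α - v.1.2| := by
  obtain ⟨⟨a, b⟩, ⟨c, d⟩⟩ := v
  obtain ⟨s, hs, h1, h2, h3, h4, h5, h6, h7⟩ := h
  simp only at h1 h2 h3 h4 h5 h6 h7
  have hs2 : (s : ℝ) * s = 1 := by rcases hs with rfl | rfl <;> norm_num
  have hsabs : |(s : ℝ)| = 1 := by rcases hs with rfl | rfl <;> norm_num
  have e1 : |(a : ℝ) * α - b| = s * (a * α - b) := by
    rw [← abs_of_pos h4, abs_mul, hsabs, one_mul]
  have e2 : |(c : ℝ) * α - d| = -s * (c * α - d) := by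
    rw [← abs_of_pos h5, abs_mul, abs_neg, hsabs, one_mul]
  set x := (s : ℝ) * (a * α - b) with hx
  set y := -(s : ℝ) * (c * α - d) with hy
  set k := ⌊x / y⌋ with hk
  have hk1 : 1 ≤ k := by
    rw [hk, Int.le_floor]; push_cast; rw [le_div_iff₀ h5]; linarith
  have hk1' : (1 : ℝ) ≤ k := by exact_mod_cast hk1
  have hky : k * y ≤ x := by
    rw [← le_div_iff₀ h5]; exact Int.floor_le _
  have hky2 : x < (k + 1) * y := by
    rw [← div_lt_iff₀ h5]; exact Int.lt_floor_add_one _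
  have step : cfStep α ((a, b), (c, d)) = ((c, d), (a + k * c, b + k * d)) := by
    simp [cfStep, e1, e2, hk, hx, hy]
  have hnew : (s : ℝ) * (((a + k * c : ℤ) : ℝ) * α - ((b + k * d : ℤ) : ℝ)) = x - k * y := by
    push_cast; rw [hx, hy]; ring
  have hqpos : 1 ≤ a + k * c := by nlinarith
  have hne : x - k * y ≠ 0 := by
    rw [← hnew]
    intro h0
    have hs0 : (s : ℝ) ≠ 0 := by intro h; rw [h] at hsabs; norm_num at hsabs
    have h0' := (mul_eq_zero.1 h0).resolve_left hs0
    have := (hα.intCast_mul (m := a + k * c) (by omega)).sub_intCast (b + k * d)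
    exact this.ne_zero h0'
  have hpos : 0 < x - k * y := lt_of_le_of_ne (by linarith) (Ne.symm hne)
  rw [step]
  refine ⟨⟨-s, by omega, by simp; omega, by simpa using hqpos, ?_, ?_, ?_, ?_, ?_⟩, ?_, ?_⟩
  · simp; nlinarith
  · simpa [hy] using h5
  · push_cast at hnew ⊢; rw [neg_neg, hnew]; exact hpos
  · push_cast at hnew ⊢; rw [neg_neg, hnew]
    have : -(s : ℝ) * (c * α - d) = y := rfl
    rw [this]; linarith
  · simp only; linear_combination -h7
  · simp only; nlinarith
  · simp only
    rw [e1, e2]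
    have : |((a + k * c : ℤ) : ℝ) * α - ((b + k * d : ℤ) : ℝ)| = x - k * y := by
      rw [← abs_of_pos hpos, ← hnew, abs_mul, hsabs, one_mul]
    rw [this]; nlinarith

lemma exists_isConvergents {α : ℝ} (hα : Irrational α) :
    ∃ q p : ℕ → ℤ, ∃ D : ℕ → ℝ, IsConvergents α q p D := by
  set v : ℕ → (ℤ × ℤ) × (ℤ × ℤ) := fun n => (cfStep α)^[n] ((0, 1), (1, ⌊α⌋)) with hv
  have hv1 : ∀ n, v (n + 1) = cfStep α (v n) := fun n => Function.iterate_succ_apply' _ _ _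
  have hinv : ∀ n, CFInv α (v n) := by
    intro n
    induction n with
    | zero =>
      have h1 : (⌊α⌋ : ℝ) ≤ α := Int.floor_le α
      have h2 : α < ⌊α⌋ + 1 := Int.lt_floor_add_one α
      have h3 : α ≠ ⌊α⌋ := hα.ne_int _
      have h4 : (⌊α⌋ : ℝ) < α := lt_of_le_of_ne h1 (Ne.symm h3)
      have h5 : 0 < Int.fract α := Int.fract_pos.2 h3
      have h6 := Int.fract_lt_one α
      refine ⟨-1, Or.inr rfl, ?_⟩
      simp [hv, h5, h6]
    | succ n ih => rw [hv1]; exact (cfInv_step hα ih).1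
  have hfst : ∀ n, (v (n + 1)).1 = (v n).2 := fun n => by rw [hv1]; rfl
  have hq : ∀ n, (v n).1.1 + (v n).2.1 ≤ (v (n + 1)).2.1 := fun n => by
    rw [hv1]; exact (cfInv_step hα (hinv n)).2.1
  have hD : ∀ n, |((v (n + 1)).2.1 : ℝ) * α - (v (n + 1)).2.2| +
      |((v n).2.1 : ℝ) * α - (v n).2.2| ≤ |((v n).1.1 : ℝ) * α - (v n).1.2| := fun n => by
    rw [hv1]; exact (cfInv_step hα (hinv n)).2.2
  have hlt : ∀ n, |((v n).2.1 : ℝ) * α - (v n).2.2| < |((v n).1.1 : ℝ) * α - (v n).1.2| ∧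
      0 < |((v n).2.1 : ℝ) * α - (v n).2.2| ∧
      ((v n).1.1 : ℝ) * |((v n).2.1 : ℝ) * α - (v n).2.2| +
      ((v n).2.1 : ℝ) * |((v n).1.1 : ℝ) * α - (v n).1.2| = 1 := by
    intro n
    obtain ⟨s, hs, h1, h2, h3, h4, h5, h6, h7⟩ := hinv n
    have h7' : ((v n).1.1 : ℝ) * (v n).2.2 - (v n).2.1 * (v n).1.2 = s := by exact_mod_cast h7
    rcases hs with rfl | rfl
    · push_cast at *
      have e1 := abs_of_pos (a := ((v n).1.1 : ℝ) * α - (v n).1.2) (by linarith)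
      have e2 := abs_of_neg (a := ((v n).2.1 : ℝ) * α - (v n).2.2) (by linarith)
      rw [e1, e2]
      refine ⟨by linarith, by linarith, by linear_combination h7'⟩
    · push_cast at *
      have e1 := abs_of_neg (a := ((v n).1.1 : ℝ) * α - (v n).1.2) (by linarith)
      have e2 := abs_of_pos (a := ((v n).2.1 : ℝ) * α - (v n).2.2) (by linarith)
      rw [e1, e2]
      refine ⟨by linarith, by linarith, by linear_combination -h7'⟩
  have hone : ∀ n, 1 ≤ (v n).2.1 := fun n => by
    obtain ⟨s, hs, h1, h2, h3, h4, h5, h6, h7⟩ := hinv n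
    exact h2
  have hmono : ∀ n, (v n).2.1 ≤ (v (n + 1)).2.1 := fun n => by
    obtain ⟨s, hs, h1, h2, h3, h4, h5, h6, h7⟩ := hinv n
    have := hq n
    omega
  refine ⟨fun n => (v n).2.1, fun n => (v n).2.2, fun n => |((v n).2.1 : ℝ) * α - (v n).2.2|,
    hone, hmono, ?_, fun n => (hlt n).2.1, ?_, ?_, fun n => rfl, ?_, ?_, ?_⟩
  · intro n
    have h1 : (v (n + 1)).1.1 + (v (n + 1)).2.1 ≤ (v (n + 2)).2.1 := hq (n + 1)
    have h2 := hmono n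
    rw [hfst] at h1
    show 2 * (v n).2.1 ≤ (v (n + 2)).2.1
    omega
  · intro n
    have := (hlt (n + 1)).1
    rw [hfst] at this
    exact this.le
  · intro n
    have h1 := hD (n + 1)
    have h2 := (hlt (n + 2)).1
    rw [hfst] at h1 h2
    linarith
  · intro n
    have h1 := (hlt (n + 1)).2.2
    have h2 := (hlt (n + 1)).2.1
    rw [hfst] at h1
    have h3 : (1 : ℝ) ≤ (v n).2.1 := by exact_mod_cast hone n
    nlinarith
  · intro n
    have h1 := (hlt (n + 1)).2.2
    have h2 := (hlt (n + 1)).2.1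
    have h4 := (hlt (n + 1)).1
    rw [hfst] at h1 h4
    have h3 : (1 : ℝ) ≤ (v n).2.1 := by exact_mod_cast hone n
    have h5 : ((v n).2.1 : ℝ) ≤ (v (n + 1)).2.1 := by exact_mod_cast hmono n
    nlinarith
  · intro n
    obtain ⟨s, hs, h1, h2, h3, h4, h5, h6, h7⟩ := hinv n
    refine ⟨-s * (v n).1.2, s * (v n).1.1, ?_⟩
    have : s * s = 1 := by rcases hs with rfl | rfl <;> norm_num
    linear_combination s * h7 + this

lemma exists_child_disjoint {ι : Type*} {M F : ℕ} (hMF : 3 * F < M) {a w : ℝ} (hw : 0 < w)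
    (B : ι → Set ℝ) (t : Finset ι) (ht : #t ≤ F)
    (h : ∀ i ∈ t, ∀ u ∈ B i, ∀ v ∈ B i, u ∈ Set.Icc a (a + M * w) → v ∈ Set.Icc a (a + M * w) →
      |u - v| ≤ w) :
    ∃ b, a ≤ b ∧ b + w ≤ a + M * w ∧ ∀ i ∈ t, ∀ u ∈ B i, u ∉ Set.Icc b (b + w) := by
  classical
  set K : ι → Finset ℕ := fun i =>
    (range M).filter fun j => ∃ u ∈ B i, u ∈ Set.Icc (a + j * w) (a + j * w + w) with hK
  have hin : ∀ j < M, ∀ u ∈ Set.Icc (a + j * w) (a + j * w + w), u ∈ Set.Icc a (a + M * w) := by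
    intro j hj u hu
    have h1 : (j : ℝ) + 1 ≤ M := by exact_mod_cast hj
    have h2 : (0 : ℝ) ≤ j := by positivity
    exact ⟨by nlinarith [hu.1], by nlinarith [hu.2]⟩
  have hcard : ∀ i ∈ t, #(K i) ≤ 3 := by
    intro i hi
    rcases (K i).eq_empty_or_nonempty with h0 | h0
    · simp [h0]
    · have hsub : K i ⊆ Finset.Icc ((K i).min' h0) ((K i).min' h0 + 2) := by
        intro j hj
        have hm := (K i).min'_mem h0
        set m := (K i).min' h0
        have hmj : m ≤ j := (K i).min'_le j hj
        obtain ⟨hj1, u, hu, hu'⟩ := mem_filter.1 hj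
        obtain ⟨hm1, v, hv, hv'⟩ := mem_filter.1 hm
        have := h i hi u hu v hv (hin j (mem_range.1 hj1) u hu') (hin m (mem_range.1 hm1) v hv')
        have h3 := (abs_le.1 this).2
        have h4 : ((j : ℝ) - m - 2) * w ≤ 0 := by nlinarith [hu'.1, hv'.2]
        have h5 : (j : ℝ) - m - 2 ≤ 0 := by
          by_contra hc
          push Not at hc
          nlinarith
        have h6 : (j : ℝ) ≤ m + 2 := by linarith
        exact mem_Icc.2 ⟨hmj, by exact_mod_cast h6⟩
      refine (card_le_card hsub).trans ?_
      rw [Nat.card_Icc]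
      omega
  have h1 : #(t.biUnion K) < #(range M) := by
    calc #(t.biUnion K) ≤ #t * 3 := card_biUnion_le_card_mul _ _ _ hcard
      _ ≤ F * 3 := by gcongr
      _ < #(range M) := by simpa using by omega
  obtain ⟨j, hj, hj'⟩ := exists_mem_notMem_of_card_lt_card h1
  rw [mem_range] at hj
  have h1 : (j : ℝ) + 1 ≤ M := by exact_mod_cast hj
  refine ⟨a + j * w, by nlinarith [(by positivity : (0 : ℝ) ≤ j * w)], by nlinarith, ?_⟩
  intro i hi u hu hu'
  exact hj' (mem_biUnion.2 ⟨i, hi, mem_filter.2 ⟨mem_range.2 hj, u, hu, hu'⟩⟩)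

lemma exists_avoid {ι : Type*} {M F : ℕ} (hMF : 3 * F < M) {x₀ L : ℝ} (hL : 0 < L)
    (B : ι → Set ℝ) (t : ℕ → Finset ι) (ht : ∀ k, #(t k) ≤ F)
    (h : ∀ k, ∀ i ∈ t k, ∀ a, x₀ ≤ a → a + L / M ^ k ≤ x₀ + L → ∀ u ∈ B i, ∀ v ∈ B i,
      u ∈ Set.Icc a (a + L / M ^ k) → v ∈ Set.Icc a (a + L / M ^ k) → |u - v| ≤ L / M ^ (k + 1)) :
    ∃ x ∈ Set.Icc x₀ (x₀ + L), ∀ k, ∀ i ∈ t k, x ∉ B i := by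
  have hM : (0 : ℝ) < M := by exact_mod_cast (by omega : 0 < M)
  have hmul : ∀ k : ℕ, M * (L / M ^ (k + 1)) = L / (M : ℝ) ^ k := by
    intro k; field_simp; ring
  have step : ∀ (k : ℕ) (a : ℝ), x₀ ≤ a ∧ a + L / M ^ k ≤ x₀ + L →
      ∃ b, a ≤ b ∧ b + L / M ^ (k + 1) ≤ a + L / M ^ k ∧
        ∀ i ∈ t k, ∀ u ∈ B i, u ∉ Set.Icc b (b + L / M ^ (k + 1)) := by
    intro k a ha
    have := exists_child_disjoint hMF (a := a) (w := L / M ^ (k + 1)) (by positivity) B (t k)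
      (ht k) (by rw [hmul]; exact fun i hi => h k i hi a ha.1 ha.2)
    rwa [hmul] at this
  choose! f hf using step
  let a : ℕ → ℝ := fun n => Nat.rec x₀ f n
  have ha0 : a 0 = x₀ := rfl
  have has : ∀ n, a (n + 1) = f n (a n) := fun n => rfl
  have hbase : ∀ n, x₀ ≤ a n ∧ a n + L / M ^ n ≤ x₀ + L := by
    intro n
    induction n with
    | zero => simp [ha0]
    | succ n ih =>
      rw [has]
      have := hf n (a n) ih
      exact ⟨ih.1.trans this.1, this.2.1.trans ih.2⟩
  have hf' : ∀ n, a n ≤ a (n + 1) ∧ a (n + 1) + L / M ^ (n + 1) ≤ a n + L / M ^ n ∧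
        ∀ i ∈ t n, ∀ u ∈ B i, u ∉ Set.Icc (a (n + 1)) (a (n + 1) + L / M ^ (n + 1)) :=
    fun n => hf n (a n) (hbase n)
  have hanti : Antitone fun n => Set.Icc (a n) (a n + L / M ^ n) :=
    antitone_nat_of_succ_le fun n => Set.Icc_subset_Icc (hf' n).1 (hf' n).2.1
  have hmem := ciSup_mem_iInter_Icc_of_antitone_Icc hanti
    (fun n => by have : 0 < L / (M : ℝ) ^ n := by positivity
                 linarith)
  rw [Set.mem_iInter] at hmem
  refine ⟨_, ?_, fun k i hi hx => (hf' k).2.2 i hi _ hx (hmem (k + 1))⟩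
  simpa [ha0] using hmem 0

lemma exists_forall_far_from_pos_int {ι : Type*} {S : ℝ} (hS : 0 < S) (z : ι → ℝ)
    (g : ι → ℝ → ℝ)
    (hlow : ∀ i, ∀ s ∈ Set.Icc S (2 * S), ∀ t ∈ Set.Icc S (2 * S),
      z i / (4 * S) * |s - t| ≤ |g i s - g i t|)
    (hup : ∀ i, ∀ s ∈ Set.Icc S (2 * S), ∀ t ∈ Set.Icc S (2 * S),
      |g i s - g i t| ≤ z i / S * |s - t|)
    (hle : ∀ i, ∀ s ∈ Set.Icc S (2 * S), g i s ≤ 2 * z i)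
    (hfin : ∀ X > 0, ∃ T : Finset ι, #T ≤ 48 ∧ ∀ i, X < z i → z i ≤ 256 * X → i ∈ T) :
    ∃ s ∈ Set.Icc S (2 * S), ∀ i, ∀ j : ℕ, 1 ≤ j → 1 / 2 ^ 21 ≤ |g i s - j| := by
  choose! T hT1 hT2 using hfin
  have hX : ∀ k : ℕ, (0 : ℝ) < 256 ^ k / 1024 := fun k => by positivity
  set B : ι → Set ℝ := fun i => {s | 1 / 1024 < z i ∧ ∃ j : ℕ, |g i s - j| < 1 / 2 ^ 21} with hB
  obtain ⟨x, hx, hx'⟩ := exists_avoid (M := 256) (F := 48) (by norm_num) (x₀ := S) hS B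
    (fun k => (T (256 ^ k / 1024)).filter
      fun i => (256 : ℝ) ^ k / 1024 < z i ∧ z i ≤ 256 * (256 ^ k / 1024))
    (fun k => (card_filter_le _ _).trans (hT1 _ (hX k))) (by
      intro k i hi a ha1 ha2 u hu v hv hu' hv'
      obtain ⟨-, hz1, hz2⟩ := mem_filter.1 hi
      obtain ⟨-, j, hj⟩ := hu
      obtain ⟨-, j', hj'⟩ := hv
      push_cast at hu' hv' ha2 ⊢
      have hp : (0 : ℝ) < 256 ^ k := by positivity
      have huS : u ∈ Set.Icc S (2 * S) := ⟨ha1.trans hu'.1, by linarith [hu'.2]⟩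
      have hvS : v ∈ Set.Icc S (2 * S) := ⟨ha1.trans hv'.1, by linarith [hv'.2]⟩
      have huv : |u - v| ≤ S / 256 ^ k := by
        rw [abs_le]; constructor <;> linarith [hu'.1, hu'.2, hv'.1, hv'.2]
      have h1 : |g i u - g i v| ≤ 1 / 4 := by
        refine (hup i u huS v hvS).trans ?_
        calc z i / S * |u - v| ≤ (256 * (256 ^ k / 1024)) / S * (S / 256 ^ k) := by
              have : 0 < z i := (hX k).trans hz1
              gcongr
          _ = 1 / 4 := by field_simp; norm_num
      have hjj : (j : ℤ) = j' := by
        have h2 : |((j : ℤ) - (j' : ℤ) : ℝ)| < 1 := by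
          push_cast
          rw [abs_lt]
          rw [abs_lt] at hj hj'
          rw [abs_le] at h1
          constructor <;> linarith [hj.1, hj.2, hj'.1, hj'.2, h1.1, h1.2]
        have h3 : |(j : ℤ) - j'| < 1 := by exact_mod_cast h2
        have := Int.abs_lt_one_iff.1 h3
        omega
      have hjj' : (j : ℝ) = j' := by exact_mod_cast hjj
      have h2 : |g i u - g i v| ≤ 2 / 2 ^ 21 := by
        rw [hjj', abs_lt] at hj
        rw [abs_lt] at hj'
        rw [abs_le]
        constructor <;> linarith [hj.1, hj.2, hj'.1, hj'.2]
      have h3 := (hlow i u huS v hvS).trans h2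
      have h4 : (256 : ℝ) ^ k / 1024 / (4 * S) * |u - v| ≤ 2 / 2 ^ 21 := by
        refine le_trans ?_ h3
        gcongr
      rw [le_div_iff₀ (by positivity), pow_succ]
      rw [div_div, div_mul_eq_mul_div, div_le_iff₀ (by positivity)] at h4
      norm_num at h4
      linarith)
  refine ⟨x, ⟨hx.1, by linarith [hx.2]⟩, ?_⟩
  have hxS : x ∈ Set.Icc S (2 * S) := ⟨hx.1, by linarith [hx.2]⟩
  intro i j hj
  have hj1 : (1 : ℝ) ≤ j := by exact_mod_cast hj
  by_contra hcon
  push Not at hcon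
  by_cases hz : 1 / 1024 < z i
  · obtain ⟨k, hk⟩ : ∃ k : ℕ, z i ≤ 256 * (256 ^ k / 1024) := by
      obtain ⟨k, hk⟩ := pow_unbounded_of_one_lt (z i * 4) (by norm_num : (1 : ℝ) < 256)
      exact ⟨k, by linarith⟩
    classical
    have hex : ∃ k : ℕ, z i ≤ 256 * (256 ^ k / 1024) := ⟨k, hk⟩
    have hspec := Nat.find_spec hex
    set m := Nat.find hex with hm
    have hlt : (256 : ℝ) ^ m / 1024 < z i := by
      rcases Nat.eq_zero_or_pos m with h0 | h0
      · rw [h0]; simpa using hz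
      · have := Nat.find_min hex (m := m - 1) (by omega)
        push Not at this
        obtain ⟨m', hm'⟩ : ∃ m', m = m' + 1 := ⟨m - 1, by omega⟩
        simp only [hm', Nat.add_sub_cancel] at this
        rw [hm', pow_succ]
        linarith
    exact hx' m i (mem_filter.2 ⟨hT2 _ (hX m) i hlt hspec, hlt, hspec⟩) ⟨hz, j, hcon⟩
  · push Not at hz
    have h1 := hle i x hxS
    have := (abs_lt.1 hcon).1
    norm_num at this
    linarith

namespace IsConvergents

variable {α : ℝ} {q p : ℕ → ℤ} {D : ℕ → ℝ}

lemma mono (h : IsConvergents α q p D) : Monotone q := monotone_nat_of_le_succ h.le_succ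

lemma anti (h : IsConvergents α q p D) : Antitone D := antitone_nat_of_succ_le h.succ_le

lemma cast_mono (h : IsConvergents α q p D) {m n : ℕ} (hmn : m ≤ n) : (q m : ℝ) ≤ q n := by
  exact_mod_cast h.mono hmn

lemma cast_one_le (h : IsConvergents α q p D) (n : ℕ) : (1 : ℝ) ≤ q n := by
  exact_mod_cast h.one_le n

lemma cast_pos (h : IsConvergents α q p D) (n : ℕ) : (0 : ℝ) < q n :=
  one_pos.trans_le (h.cast_one_le n)

lemma two_pow_mul_le (h : IsConvergents α q p D) (a k : ℕ) :
    (2 : ℝ) ^ k * q a ≤ q (a + 2 * k) := by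
  induction k with
  | zero => simp
  | succ k ih =>
    have : (2 : ℝ) * q (a + 2 * k) ≤ q (a + 2 * k + 2) := by exact_mod_cast h.two_mul_le _
    rw [pow_succ, show a + 2 * (k + 1) = a + 2 * k + 2 by ring]
    linarith

lemma two_pow_mul_le_of_le (h : IsConvergents α q p D) {a b k : ℕ} (hab : a + 2 * k ≤ b) :
    (2 : ℝ) ^ k * q a ≤ q b :=
  (h.two_pow_mul_le a k).trans (h.cast_mono hab)

lemma two_pow_mul_D_le (h : IsConvergents α q p D) (a k : ℕ) :
    (2 : ℝ) ^ k * D (a + 2 * k) ≤ D a := by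
  induction k with
  | zero => simp
  | succ k ih =>
    have := h.two_mul_add_two_le (a + 2 * k)
    rw [pow_succ, show a + 2 * (k + 1) = a + 2 * k + 2 by ring]
    have h2 : (0 : ℝ) < 2 ^ k := by positivity
    nlinarith

lemma two_pow_mul_D_le_of_le (h : IsConvergents α q p D) {a b k : ℕ} (hab : a + 2 * k ≤ b) :
    (2 : ℝ) ^ k * D b ≤ D a :=
  le_trans (by gcongr; exact h.anti hab) (h.two_pow_mul_D_le a k)

end IsConvergents

lemma exists_card_le_sixteen {P : ℕ → Prop} (h : ∀ a n, P a → P n → n < a + 16) :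
    ∃ T : Finset ℕ, #T ≤ 16 ∧ ∀ n, P n → n ∈ T := by
  classical
  by_cases hP : ∃ n, P n
  · refine ⟨Finset.Ico (Nat.find hP) (Nat.find hP + 16), by simp, fun n hn => ?_⟩
    exact mem_Ico.2 ⟨Nat.find_min' hP hn, h _ n (Nat.find_spec hP) hn⟩
  · exact ⟨∅, by simp, fun n hn => (hP ⟨n, hn⟩).elim⟩

lemma abs_div_sub_div_bounds {S C s t : ℝ} (hS : 0 < S) (hC : 0 < C) (hs : s ∈ Set.Icc S (2 * S))
    (ht : t ∈ Set.Icc S (2 * S)) :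
    C / S / (4 * S) * |s - t| ≤ |C / s - C / t| ∧ |C / s - C / t| ≤ C / S / S * |s - t| := by
  have hs0 : 0 < s := hS.trans_le hs.1
  have ht0 : 0 < t := hS.trans_le ht.1
  have e : C / s - C / t = C / (s * t) * (t - s) := by field_simp
  rw [e, abs_mul, abs_sub_comm t s, abs_of_pos (by positivity : 0 < C / (s * t)), div_div, div_div]
  constructor
  · have : s * t ≤ S * (4 * S) := by nlinarith [hs.1, hs.2, ht.1, ht.2]
    exact mul_le_mul_of_nonneg_right (by gcongr) (abs_nonneg _)
  · gcongr
    · exact hs.1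
    · exact ht.1

lemma IsConvergents.exists_scale {α : ℝ} {q p : ℕ → ℤ} {D : ℕ → ℝ} (h : IsConvergents α q p D)
    {c S : ℝ} (hc : 0 < c) (hS : 0 < S) :
    ∃ s ∈ Set.Icc S (2 * S), ∀ n, ∀ j : ℕ, 1 ≤ j → 1 / 2 ^ 21 ≤ |s * D n - j| ∧
      1 / 2 ^ 21 ≤ |q n * c / s - j| ∧ 1 / 2 ^ 21 ≤ |c / D n / s - j| := by
  obtain ⟨s, hs, hs'⟩ := exists_forall_far_from_pos_int (ι := ℕ ⊕ ℕ ⊕ ℕ) hS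
    (Sum.elim (fun n => S * D n) (Sum.elim (fun n => q n * c / S) (fun n => c / D n / S)))
    (Sum.elim (fun n s => s * D n) (Sum.elim (fun n s => q n * c / s) (fun n s => c / D n / s)))
    (by
      rintro (n | n | n) s hs t ht
      · simp only [Sum.elim_inl]
        rw [← sub_mul, abs_mul, abs_of_pos (h.pos n)]
        have : S * D n / (4 * S) = D n / 4 := by field_simp
        rw [this]
        nlinarith [h.pos n, abs_nonneg (s - t), mul_nonneg (h.pos n).le (abs_nonneg (s - t))]
      · exact (abs_div_sub_div_bounds hS (mul_pos (h.cast_pos n) hc) hs ht).1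
      · exact (abs_div_sub_div_bounds hS (div_pos hc (h.pos n)) hs ht).1)
    (by
      rintro (n | n | n) s hs t ht
      · simp only [Sum.elim_inl]
        rw [← sub_mul, abs_mul, abs_of_pos (h.pos n)]
        have : S * D n / S = D n := by field_simp
        rw [this, mul_comm]
      · exact (abs_div_sub_div_bounds hS (mul_pos (h.cast_pos n) hc) hs ht).2
      · exact (abs_div_sub_div_bounds hS (div_pos hc (h.pos n)) hs ht).2)
    (by
      have key : ∀ C > 0, ∀ s ∈ Set.Icc S (2 * S), C / s ≤ 2 * (C / S) := fun C hC s hs => by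
        have h1 : C / s ≤ C / S := by gcongr; exact hs.1
        have h2 : 0 < C / S := by positivity
        linarith
      rintro (n | n | n) s hs
      · simp only [Sum.elim_inl]
        nlinarith [h.pos n, hs.2]
      · exact key _ (mul_pos (h.cast_pos n) hc) s hs
      · exact key _ (div_pos hc (h.pos n)) s hs)
    (by
      intro X hX
      obtain ⟨T1, hT1, hT1'⟩ := exists_card_le_sixteen
        (P := fun n => X < S * D n ∧ S * D n ≤ 256 * X) (by
          intro a n ha hn
          by_contra! hcon
          have := h.two_pow_mul_D_le_of_le (a := a) (b := n) (k := 8) (by omega)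
          nlinarith [ha.2, hn.1])
      obtain ⟨T2, hT2, hT2'⟩ := exists_card_le_sixteen
        (P := fun n => X < q n * c / S ∧ q n * c / S ≤ 256 * X) (by
          intro a n ha hn
          by_contra! hcon
          have := h.two_pow_mul_le_of_le (a := a) (b := n) (k := 8) (by omega)
          have h1 := ha.1
          have h2 := hn.2
          rw [lt_div_iff₀ hS] at h1
          rw [div_le_iff₀ hS] at h2
          nlinarith)
      obtain ⟨T3, hT3, hT3'⟩ := exists_card_le_sixteen
        (P := fun n => X < c / D n / S ∧ c / D n / S ≤ 256 * X) (by
          intro a n ha hn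
          by_contra! hcon
          have := h.two_pow_mul_D_le_of_le (a := a) (b := n) (k := 8) (by omega)
          have h1 := ha.1
          have h2 := hn.2
          rw [div_div, lt_div_iff₀ (mul_pos (h.pos _) hS)] at h1
          rw [div_div, div_le_iff₀ (mul_pos (h.pos _) hS)] at h2
          have : X * S * (256 * D n) ≤ X * S * D a :=
            mul_le_mul_of_nonneg_left (by linarith) (by positivity)
          linarith)
      refine ⟨T1.disjSum (T2.disjSum T3), by simp; omega, ?_⟩
      rintro (n | n | n) h1 h2
      · simpa using hT1' n ⟨h1, h2⟩
      · simpa using hT2' n ⟨h1, h2⟩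
      · simpa using hT3' n ⟨h1, h2⟩)
  exact ⟨s, hs, fun n j hj => ⟨hs' (.inl n) j hj, hs' (.inr (.inl n)) j hj,
    hs' (.inr (.inr n)) j hj⟩⟩

lemma Finset.card_le_of_forall_sub_le {T : Finset ℤ} {d : ℝ} (hd : 0 ≤ d)
    (h : ∀ x ∈ T, ∀ y ∈ T, (x : ℝ) - y ≤ d) : (#T : ℝ) ≤ d + 1 := by
  rcases T.eq_empty_or_nonempty with rfl | hT
  · simp; linarith
  · have hsub : T ⊆ Icc (T.min' hT) (T.max' hT) := fun x hx =>
      mem_Icc.2 ⟨T.min'_le x hx, T.le_max' x hx⟩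
    have h1 := card_le_card hsub
    have h2 := h _ (T.max'_mem hT) _ (T.min'_mem hT)
    have h3 : T.min' hT ≤ T.max' hT := T.min'_le _ (T.max'_mem hT)
    rw [Int.card_Icc] at h1
    have h4 : (#T : ℤ) ≤ T.max' hT + 1 - T.min' hT := by omega
    have h5 : (#T : ℝ) ≤ T.max' hT + 1 - T.min' hT := by exact_mod_cast h4
    linarith

lemma card_filter_nint_lt_le_of_pos {ω ε τ : ℝ} {R : ℕ} (hω : 0 < ω) (hωε : ω ≤ ε)
    (hτ : 0 < τ) (hτ1 : τ ≤ 1) (hR : τ ≤ R * ω) (φ : ℝ) :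
    (#{a ∈ range R | nint (φ + (a : ℕ) * ω) < ε} : ℝ) ≤ 9 * (ε / τ) * R := by
  classical
  set T := {a ∈ range R | nint (φ + (a : ℕ) * ω) < ε} with hT
  set f : ℕ → ℤ := fun a => round (φ + a * ω) with hf
  have hε : 0 < ε := hω.trans_le hωε
  have hfib : ∀ b ∈ T.image f, #{x ∈ T | f x = b} ≤ ⌊2 * ε / ω + 1⌋₊ := by
    intro b _
    rw [Nat.le_floor_iff (by positivity), ← card_map (Nat.castEmbedding (R := ℤ))]
    apply card_le_of_forall_sub_le (by positivity)
    intro x hx y hy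
    obtain ⟨x, hx1, rfl⟩ := mem_map.1 hx
    obtain ⟨y, hy1, rfl⟩ := mem_map.1 hy
    obtain ⟨hx2, hxb⟩ := mem_filter.1 hx1
    obtain ⟨hy2, hyb⟩ := mem_filter.1 hy1
    have h1 := (mem_filter.1 hx2).2
    have h2 := (mem_filter.1 hy2).2
    simp only [nint, hf] at h1 h2 hxb hyb
    rw [hxb] at h1
    rw [hyb] at h2
    rw [abs_lt] at h1 h2
    rw [le_div_iff₀ hω]
    simp
    linarith [h1.1, h1.2, h2.1, h2.2]
  have himg : (#(T.image f) : ℝ) ≤ R * ω + 1 + 1 := by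
    apply card_le_of_forall_sub_le (by positivity)
    intro x hx y hy
    obtain ⟨x, hxT, rfl⟩ := mem_image.1 hx
    obtain ⟨y, hyT, rfl⟩ := mem_image.1 hy
    have h1 := mem_range.1 (mem_filter.1 hxT).1
    have h2 := abs_le.1 (abs_sub_round (φ + x * ω))
    have h3 := abs_le.1 (abs_sub_round (φ + y * ω))
    have h4 : (x : ℝ) ≤ R := by exact_mod_cast h1.le
    have h5 : (0 : ℝ) ≤ y := by positivity
    simp only [hf]
    nlinarith [h2.1, h3.2]
  have h1 : (#T : ℝ) ≤ ⌊2 * ε / ω + 1⌋₊ * #(T.image f) := by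
    exact_mod_cast card_le_mul_card_image T _ hfib
  have h2 : ((⌊2 * ε / ω + 1⌋₊ : ℕ) : ℝ) ≤ 3 * ε / ω := by
    refine (Nat.floor_le (by positivity)).trans ?_
    rw [div_add_one hω.ne', div_le_div_iff_of_pos_right hω]
    linarith
  calc (#T : ℝ) ≤ 3 * ε / ω * (R * ω + 1 + 1) := h1.trans (by gcongr)
    _ = 3 * ε * R + 6 * ε * (1 / ω) := by field_simp; ring
    _ ≤ 3 * ε * (R * (1 / τ)) + 6 * ε * (R * (1 / τ)) := by
        gcongr
        · have : 1 ≤ 1 / τ := by rw [le_div_iff₀ hτ]; linarith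
          have h0 : (0 : ℝ) ≤ R := by positivity
          nlinarith
        · rw [mul_one_div, div_le_div_iff₀ hω hτ]; linarith
    _ = 9 * (ε / τ) * R := by ring

lemma card_filter_nint_lt_le {ω ε τ σ : ℝ} {R : ℕ} (hσ : |σ| = ω) (hω : 0 < ω) (hωε : ω ≤ ε)
    (hτ : 0 < τ) (hτ1 : τ ≤ 1) (hR : τ ≤ R * ω) (φ : ℝ) :
    (#{a ∈ range R | nint (φ + (a : ℕ) * σ) < ε} : ℝ) ≤ 9 * (ε / τ) * R := by
  rcases le_or_gt 0 σ with h | h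
  · rw [abs_of_nonneg h] at hσ
    rw [hσ]
    exact card_filter_nint_lt_le_of_pos hω hωε hτ hτ1 hR φ
  · rw [abs_of_neg h] at hσ
    have e : ∀ a : ℕ, nint (φ + a * σ) = nint (-φ + a * ω) := fun a => by
      rw [← nint_neg, ← hσ]; ring_nf
    simp only [e]
    exact card_filter_nint_lt_le_of_pos hω hωε hτ hτ1 hR (-φ)

lemma apply_nat_mul_le {N : ℤ → ℝ} (h0 : N 0 = 0) (hadd : ∀ x y, N (x + y) ≤ N x + N y)
    (a : ℕ) (w : ℤ) : N (a * w) ≤ a * N w := by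
  induction a with
  | zero => simp [h0]
  | succ a ih =>
    have := hadd (a * w) w
    push_cast
    rw [add_mul, one_mul, add_mul, one_mul]
    linarith

lemma exists_sum_le_of_average {ι : Type*} (F : Finset ι) (P : ℝ) (L : List (ℤ × ℕ))
    (hL : ∀ v ∈ L, 0 < v.2) (r : ℤ) (g : ι → ℤ → ℝ)
    (hg : ∀ m ∈ F, (∃ v ∈ L, ∀ r : ℤ, ∑ a ∈ range v.2, g m (r + a * v.1) ≤ P * v.2) ∨
      ∀ r, g m r ≤ P) :
    ∃ r' : ℤ, ∑ m ∈ F, g m r' ≤ #F * P ∧ ∀ N : ℤ → ℝ, N 0 = 0 → (∀ x, 0 ≤ N x) →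
      (∀ x y, N (x + y) ≤ N x + N y) → N (r' - r) ≤ (L.map fun v => v.2 * N v.1).sum := by
  induction L generalizing g with
  | nil =>
    refine ⟨r, ?_, fun N h0 _ _ => by simp [h0]⟩
    rw [← nsmul_eq_mul]
    refine sum_le_card_nsmul _ _ _ fun m hm => ?_
    rcases hg m hm with ⟨v, hv, -⟩ | h
    · simp at hv
    · exact h r
  | cons v L ih =>
    have hv : 0 < v.2 := hL v (by simp)
    have hv' : (0 : ℝ) < v.2 := by exact_mod_cast hv
    obtain ⟨r₁, h1, h2⟩ := ih (fun u hu => hL u (by simp [hu]))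
      (fun m r => (∑ a ∈ range v.2, g m (r + a * v.1)) / v.2) (by
        intro m hm
        rcases hg m hm with ⟨u, hu, h⟩ | h
        · rcases List.mem_cons.1 hu with rfl | hu
          · right
            intro r
            rw [div_le_iff₀ hv']
            exact h r
          · left
            refine ⟨u, hu, fun r => ?_⟩
            rw [← sum_div, div_le_iff₀ hv', sum_comm]
            calc ∑ a ∈ range v.2, ∑ b ∈ range u.2, g m (r + b * u.1 + a * v.1)
                ≤ #(range v.2) • (P * u.2) := sum_le_card_nsmul _ _ _ fun a _ => by
                  have := h (r + a * v.1)
                  refine le_trans (le_of_eq (sum_congr rfl fun b _ => ?_)) this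
                  congr 1; ring
              _ = P * u.2 * v.2 := by rw [card_range, nsmul_eq_mul]; ring
        · right
          intro r
          rw [div_le_iff₀ hv']
          calc ∑ a ∈ range v.2, g m (r + a * v.1) ≤ #(range v.2) • P :=
                sum_le_card_nsmul _ _ _ fun a _ => h _
            _ = P * v.2 := by rw [card_range, nsmul_eq_mul]; ring)
    obtain ⟨a, ha, ha'⟩ : ∃ a ∈ range v.2, ∑ m ∈ F, g m (r₁ + a * v.1) ≤ #F * P := by
      apply exists_le_of_sum_le (by simpa using hv.ne')
      rw [sum_const, card_range, nsmul_eq_mul, sum_comm]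
      rw [← sum_div, div_le_iff₀ hv'] at h1
      linarith
    refine ⟨r₁ + a * v.1, ha', fun N h0 hN hadd => ?_⟩
    have h3 := h2 N h0 hN hadd
    have h4 := hadd (a * v.1) (r₁ - r)
    have h5 := apply_nat_mul_le h0 hadd a v.1
    have h6 : (a : ℝ) * N v.1 ≤ v.2 * N v.1 := by
      gcongr
      · exact hN _
      · exact (mem_range.1 ha).le
    have h7 : r₁ + a * v.1 - r = a * v.1 + (r₁ - r) := by ring
    rw [h7, List.map_cons, List.sum_cons]
    linarith

namespace IsConvergents

variable {α : ℝ} {q p : ℕ → ℤ} {D : ℕ → ℝ}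

lemma exists_abs_eq (h : IsConvergents α q p D) (n : ℕ) (x : ℤ) :
    ∃ σ : ℝ, |σ| = |(x : ℝ)| * D n ∧ ∃ z : ℤ, ((q n * x : ℤ) : ℝ) * α = σ + z := by
  refine ⟨x * (q n * α - p n), by rw [abs_mul, h.abs_eq], p n * x, ?_⟩
  push_cast; ring

lemma nint_mul_le (h : IsConvergents α q p D) (n : ℕ) (x : ℤ) :
    nint (((q n * x : ℤ) : ℝ) * α) ≤ |(x : ℝ)| * D n := by
  obtain ⟨σ, hσ, z, hz⟩ := h.exists_abs_eq n x
  rw [hz, nint_add_int, ← hσ]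
  exact nint_le_abs _

/-- Moving in steps of `q i` or of `q m`, the orbit of `q m * r * α` rarely comes near `ℤ`. -/
lemma card_filter_lt_le (h : IsConvergents α q p D) {m i : ℕ} {ω ε τ : ℝ} {R : ℕ}
    (hω : ω = q m * D i ∨ ω = q i * D m) (hωε : ω ≤ ε)
    (hτ : 0 < τ) (hτ1 : τ ≤ 1) (hR : τ ≤ R * ω) (r : ℤ) :
    (#{a ∈ range R | nint (((q m * (r + (a : ℕ) * q i) : ℤ) : ℝ) * α) < ε} : ℝ)
      ≤ 9 * (ε / τ) * R := by
  obtain ⟨σ, hσ, z, hz⟩ : ∃ σ : ℝ, |σ| = ω ∧ ∃ z : ℤ, ((q m * q i : ℤ) : ℝ) * α = σ + z := by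
    rcases hω with rfl | rfl
    · obtain ⟨σ, hσ, z, hz⟩ := h.exists_abs_eq i (q m)
      refine ⟨σ, by rw [hσ, abs_of_pos (h.cast_pos m)], z, by rw [← hz, mul_comm (q m)]⟩
    · obtain ⟨σ, hσ, z, hz⟩ := h.exists_abs_eq m (q i)
      exact ⟨σ, by rw [hσ, abs_of_pos (h.cast_pos i)], z, hz⟩
  have hω0 : 0 < ω := by
    rcases hω with rfl | rfl
    · exact mul_pos (h.cast_pos m) (h.pos i)
    · exact mul_pos (h.cast_pos i) (h.pos m)
  have e : ∀ a : ℕ, nint (((q m * (r + (a : ℕ) * q i) : ℤ) : ℝ) * α) =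
      nint (q m * r * α + a * σ) := fun a => by
    rw [← nint_add_int (q m * r * α + a * σ) (a * z)]
    congr 1
    push_cast at hz ⊢
    linear_combination (a : ℝ) * hz
  simp only [e]
  exact card_filter_nint_lt_le hσ hω0 hωε hτ hτ1 hR _

/-- Every inhomogeneous target is approximated within distance `q l` of any prescribed position. -/
lemma exists_near (h : IsConvergents α q p D) (l : ℕ) (s : ℤ) (β : ℝ) :
    ∃ r : ℤ, |(r : ℝ) - s| ≤ q l ∧ nint (r * α - β) ≤ 2 / q l := by
  obtain ⟨u, v, huv⟩ := h.coprime l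
  have hq := h.cast_pos l
  have hq0 : 0 < q l := by have := h.one_le l; omega
  set k := round (q l * (β - s * α)) with hk
  set j := (k * v) % q l with hj
  have hj0 : 0 ≤ j := Int.emod_nonneg _ hq0.ne'
  have hj1 : j < q l := Int.emod_lt_of_pos _ hq0
  have hj0' : (0 : ℝ) ≤ j := by exact_mod_cast hj0
  have hj1' : (j : ℝ) ≤ q l := by exact_mod_cast hj1.le
  obtain ⟨t, ht⟩ : ∃ t, j * p l = k + t * q l := by
    refine ⟨-(k * v / q l) * p l - k * u, ?_⟩
    have := Int.emod_add_mul_ediv (k * v) (q l)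
    rw [← hj] at this
    linear_combination p l * this + k * huv
  have ht' : (j : ℝ) * p l = k + t * q l := by exact_mod_cast ht
  refine ⟨s + j, by push_cast; rw [add_sub_cancel_left, abs_of_nonneg hj0']; exact hj1', ?_⟩
  refine (nint_le_abs_sub _ t).trans ?_
  rw [le_div_iff₀ hq, ← abs_of_pos hq, ← abs_mul]
  have e : (((s + j : ℤ) : ℝ) * α - β - t) * q l =
      j * (q l * α - p l) - (q l * (β - s * α) - k) := by
    push_cast
    linear_combination ht'
  rw [e]
  refine (abs_sub _ _).trans ?_
  have h1 := abs_sub_round (q l * (β - s * α))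
  rw [abs_mul, h.abs_eq, abs_of_nonneg hj0']
  have h2 : (j : ℝ) * D l ≤ q (l + 1) * D l :=
    mul_le_mul_of_nonneg_right (hj1'.trans (h.cast_mono (Nat.le_succ l))) (h.pos l).le
  have h3 := h.mul_le_one l
  linarith

end IsConvergents

lemma exists_nat_mul_bounds {ω : ℝ} (hω : 0 < ω) (hω1 : ω ≤ 1) :
    ∃ R : ℕ, 0 < R ∧ 1 ≤ R * ω ∧ R * ω ≤ 2 := by
  refine ⟨⌈1 / ω⌉₊, Nat.ceil_pos.2 (by positivity), ?_, ?_⟩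
  · rw [← div_le_iff₀ hω]; exact Nat.le_ceil _
  · have h1 := (Nat.ceil_lt_add_one (by positivity : 0 ≤ 1 / ω)).le
    have h2 := mul_le_mul_of_nonneg_right h1 hω.le
    rw [add_mul, one_div_mul_cancel hω.ne'] at h2
    linarith

namespace IsConvergents

variable {α : ℝ} {q p : ℕ → ℤ} {D : ℕ → ℝ}

lemma exists_D_le (h : IsConvergents α q p D) {t : ℝ} (ht : 0 < t) : ∃ n, D n ≤ t := by
  obtain ⟨k, hk⟩ := pow_unbounded_of_one_lt (D 0 / t) (by norm_num : (1 : ℝ) < 2)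
  refine ⟨0 + 2 * k, ?_⟩
  have := h.two_pow_mul_D_le 0 k
  rw [div_lt_iff₀ ht] at hk
  have h2 : (0 : ℝ) < 2 ^ k := by positivity
  by_contra! hc
  nlinarith

lemma exists_le_q (h : IsConvergents α q p D) (t : ℝ) : ∃ n, t ≤ q n := by
  obtain ⟨k, hk⟩ := pow_unbounded_of_one_lt t (by norm_num : (1 : ℝ) < 2)
  refine ⟨0 + 2 * k, ?_⟩
  have := h.two_pow_mul_le 0 k
  have h1 := h.cast_one_le 0
  have h2 : (0 : ℝ) < 2 ^ k := by positivity
  nlinarith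

/-- A step `q i`, taken up to `R` times, that randomizes the orbit at level `n ∈ [A, B)` and
perturbs levels outside `[A, B)` only slightly. -/
lemma exists_step (h : IsConvergents α q p D) {ε : ℝ} (hε : 0 < ε) (hε1 : ε ≤ 1 / 4)
    {A B l : ℕ} (hA0 : 1 ≤ A) (hA : ∀ m < A, q m * D l ≤ ε ^ 2)
    (hB : q (l + 1) * D B ≤ ε ^ 2) {n : ℕ} (hn : n ∈ Ico A B) :
    ∃ i R : ℕ, 0 < R ∧ (∃ ω : ℝ, (ω = q n * D i ∨ ω = q i * D n) ∧ ω ≤ ε ∧ 1 ≤ R * ω) ∧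
      (∀ m < A, q m * D i ≤ ε) ∧ (∀ m, B ≤ m → q i * D m ≤ ε) ∧
      R * D i ≤ 2 / (ε * q (A - 1)) ∧ R * q i ≤ 2 / (ε * D B) := by
  classical
  obtain ⟨hnA, hnB⟩ := mem_Ico.1 hn
  have hεε : ε ^ 2 ≤ ε := by nlinarith
  rcases le_or_gt n l with hnl | hnl
  · have hBle : q n * D B ≤ ε ^ 2 := le_trans
      (mul_le_mul_of_nonneg_right (h.cast_mono (by omega)) (h.pos B).le) hB
    have hex : ∃ i, q n * D i ≤ ε := ⟨B, hBle.trans hεε⟩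
    have hi1 := Nat.find_spec hex
    have hi2 : Nat.find hex ≤ B := Nat.find_min' hex (hBle.trans hεε)
    have hi3 : q (Nat.find hex) * ε ≤ q n := by
      rcases Nat.eq_zero_or_pos (Nat.find hex) with h0 | h0
      · rw [h0]
        have := h.cast_mono (Nat.zero_le n)
        nlinarith [h.cast_pos 0]
      · obtain ⟨j, hj⟩ : ∃ j, Nat.find hex = j + 1 := ⟨Nat.find hex - 1, by omega⟩
        have h1 := Nat.find_min hex (m := j) (by omega)
        push Not at h1
        rw [hj]
        have h2 := h.mul_le_one j
        nlinarith [h.pos j, h.cast_pos (j + 1), h.cast_pos n]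
    set i := Nat.find hex
    have hω : 0 < q n * D i := mul_pos (h.cast_pos n) (h.pos i)
    obtain ⟨R, hR0, hR1, hR2⟩ := exists_nat_mul_bounds hω (by linarith)
    have hR0' : (0 : ℝ) < R := by exact_mod_cast hR0
    refine ⟨i, R, hR0, ⟨_, Or.inl rfl, hi1, hR1⟩, fun m hm => ?_, fun m hm => ?_, ?_, ?_⟩
    · exact (mul_le_mul_of_nonneg_right (h.cast_mono (by omega)) (h.pos i).le).trans hi1
    · have h1 : q n * D m ≤ ε ^ 2 :=
        (mul_le_mul_of_nonneg_left (h.anti hm) (h.cast_pos n).le).trans hBle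
      have h2 := mul_le_mul_of_nonneg_right hi3 (h.pos m).le
      by_contra! hc
      nlinarith
    · rw [le_div_iff₀ (mul_pos hε (h.cast_pos _))]
      have h1 : ε * q (A - 1) ≤ q n := by
        have := h.cast_mono (show A - 1 ≤ n by omega)
        nlinarith [h.cast_pos (A - 1)]
      have h2 := mul_le_mul_of_nonneg_left h1 (mul_pos hR0' (h.pos i)).le
      linarith
    · rw [le_div_iff₀ (mul_pos hε (h.pos _))]
      have h1 : (q i * ε) * D B ≤ q n * D i :=
        mul_le_mul hi3 (h.anti hi2) (h.pos B).le (h.cast_pos n).le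
      have h2 := mul_le_mul_of_nonneg_left h1 hR0'.le
      linarith
  · have hAle : ∀ m < A, q m * D n ≤ ε ^ 2 := fun m hm => le_trans
      (mul_le_mul_of_nonneg_left (h.anti hnl.le) (h.cast_pos m).le) (hA m hm)
    have hA1 : q (A - 1) * D n ≤ ε := (hAle (A - 1) (by omega)).trans hεε
    set i := Nat.findGreatest (fun i => q i * D n ≤ ε) n with hi
    have hi1 : q i * D n ≤ ε := Nat.findGreatest_spec (P := fun i => q i * D n ≤ ε)
      (show A - 1 ≤ n by omega) hA1
    have hi2 : A - 1 ≤ i := Nat.le_findGreatest (by omega) hA1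
    have hi3 : ε * D i ≤ D n := by
      rcases (Nat.findGreatest_le n : i ≤ n).eq_or_lt with h0 | h0
      · have h0' : i = n := h0
        rw [h0']
        nlinarith [h.pos n]
      · have h1 : ¬ (q (i + 1) * D n ≤ ε) :=
          Nat.findGreatest_is_greatest (Nat.lt_succ_self i) (by omega)
        push Not at h1
        have h2 := h.mul_le_one i
        nlinarith [h.pos i, h.cast_pos (i + 1), h.pos n]
    have hω : 0 < q i * D n := mul_pos (h.cast_pos i) (h.pos n)
    obtain ⟨R, hR0, hR1, hR2⟩ := exists_nat_mul_bounds hω (by linarith)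
    have hR0' : (0 : ℝ) < R := by exact_mod_cast hR0
    refine ⟨i, R, hR0, ⟨_, Or.inr rfl, hi1, hR1⟩, fun m hm => ?_, fun m hm => ?_, ?_, ?_⟩
    · have h1 := hAle m hm
      have h2 := mul_le_mul_of_nonneg_left hi3 (h.cast_pos m).le
      by_contra! hc
      nlinarith
    · exact (mul_le_mul_of_nonneg_left (h.anti (by omega)) (h.cast_pos i).le).trans hi1
    · rw [le_div_iff₀ (mul_pos hε (h.cast_pos _))]
      have h1 : (ε * D i) * q (A - 1) ≤ D n * q i :=
        mul_le_mul hi3 (h.cast_mono hi2) (h.cast_pos _).le (h.pos n).le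
      have h2 := mul_le_mul_of_nonneg_left h1 hR0'.le
      linarith
    · rw [le_div_iff₀ (mul_pos hε (h.pos _))]
      have h1 : ε * D B ≤ D n := by
        have := h.anti hnB.le
        nlinarith [h.pos B]
      have h2 := mul_le_mul_of_nonneg_left h1 (mul_pos hR0' (h.cast_pos i)).le
      linarith

lemma exists_shift_avoiding (h : IsConvergents α q p D) {ε τ : ℝ} (hτ : 0 < τ)
    (hτ1 : τ ≤ 1) (J : Finset ℕ) (i R : ℕ → ℕ) (hR : ∀ n ∈ J, 0 < R n) (F : Finset ℕ)
    (hF : ∀ m ∈ F, ∃ n ∈ J, ∃ ω : ℝ, (ω = q m * D (i n) ∨ ω = q (i n) * D m) ∧ ω ≤ ε ∧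
      τ ≤ R n * ω)
    (hcard : #F * (9 * (ε / τ)) < 1) (r : ℤ) :
    ∃ r' : ℤ, (∀ m ∈ F, ε ≤ nint (((q m * r' : ℤ) : ℝ) * α)) ∧
      ∀ N : ℤ → ℝ, N 0 = 0 → (∀ x, 0 ≤ N x) → (∀ x y, N (x + y) ≤ N x + N y) →
      N (r' - r) ≤ ∑ n ∈ J, R n * N (q (i n)) := by
  classical
  obtain ⟨r', h1, h2⟩ := exists_sum_le_of_average F (9 * (ε / τ))
    (J.toList.map fun n => (q (i n), R n)) (by
      intro v hv
      obtain ⟨n, hn, rfl⟩ := List.mem_map.1 hv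
      exact hR n (mem_toList.1 hn)) r
    (fun m r => if nint (((q m * r : ℤ) : ℝ) * α) < ε then 1 else 0) (by
      intro m hm
      obtain ⟨n, hn, ω, hω, hωε, hRω⟩ := hF m hm
      refine Or.inl ⟨(q (i n), R n), List.mem_map.2 ⟨n, mem_toList.2 hn, rfl⟩, fun r => ?_⟩
      have := h.card_filter_lt_le hω hωε hτ hτ1 hRω r
      rw [sum_boole]
      exact this)
  refine ⟨r', fun m hm => ?_, fun N h0 hN hadd => ?_⟩
  · by_contra! hc
    rw [sum_boole] at h1
    have h3 : 0 < #{m ∈ F | nint (((q m * r' : ℤ) : ℝ) * α) < ε} :=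
      card_pos.2 ⟨m, mem_filter.2 ⟨hm, hc⟩⟩
    have h4 : (1 : ℝ) ≤ #{m ∈ F | nint (((q m * r' : ℤ) : ℝ) * α) < ε} := by exact_mod_cast h3
    linarith
  · have := h2 N h0 hN hadd
    rw [List.map_map] at this
    rw [← sum_map_toList]
    exact this

lemma nint_add_mul_le (m x y : ℤ) :
    nint (((m * (x + y) : ℤ) : ℝ) * α) ≤
      nint (((m * x : ℤ) : ℝ) * α) + nint (((m * y : ℤ) : ℝ) * α) := by
  refine le_trans (le_of_eq ?_) (nint_add_le _ _)
  push_cast; ring_nf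

lemma exists_join (h : IsConvergents α q p D) {β₀ η : ℝ} {n₁ : ℕ}
    (hβ : ∀ n, n₁ ≤ n → 1 / 2 ^ 25 ≤ nint (q n * β₀)) (hη : 0 < η) :
    ∃ G : ℝ, ∀ (s : ℤ) (ν : ℕ), (∀ n, n₁ ≤ n → n < ν → 1 / 2 ^ 26 ≤ nint (s * D n)) →
      ∃ r : ℤ, |(r : ℝ) - s| ≤ G ∧ nint (r * α - β₀) ≤ η ∧
        ∀ n, n₁ ≤ n → n < ν → 1 / 2 ^ 100 ≤ nint (((q n * r : ℤ) : ℝ) * α) := by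
  classical
  obtain ⟨n₃, hn₃⟩ := h.exists_le_q (2 ^ 112 / η)
  obtain ⟨l, hl⟩ := h.exists_D_le (t := 1 / 2 ^ 200 / q n₃) (div_pos (by norm_num) (h.cast_pos _))
  rw [le_div_iff₀ (h.cast_pos _)] at hl
  have hl1 := h.half_le_mul l
  have hl2 := h.mul_le_one l
  have hDl := h.pos l
  have exA : ∃ n, 1 / 2 ^ 200 < q n * D l := ⟨l + 1, by linarith⟩
  have exB : ∃ n, q (l + 1) * D n ≤ 1 / 2 ^ 200 := by
    obtain ⟨n, hn⟩ := h.exists_D_le (t := 1 / 2 ^ 200 / q (l + 1))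
      (div_pos (by norm_num) (h.cast_pos _))
    rw [le_div_iff₀ (h.cast_pos _)] at hn
    exact ⟨n, by linarith⟩
  obtain ⟨A, hA1, hA2⟩ : ∃ A, 1 / 2 ^ 200 < q A * D l ∧ ∀ m < A, q m * D l ≤ 1 / 2 ^ 200 :=
    ⟨Nat.find exA, Nat.find_spec exA, fun m hm => not_lt.1 (Nat.find_min exA hm)⟩
  obtain ⟨B, hB1, hB2⟩ : ∃ B, q (l + 1) * D B ≤ 1 / 2 ^ 200 ∧
      ∀ m < B, 1 / 2 ^ 200 < q (l + 1) * D m :=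
    ⟨Nat.find exB, Nat.find_spec exB, fun m hm => not_le.1 (Nat.find_min exB hm)⟩
  have hn₃A : n₃ < A := by
    by_contra! hc
    have := mul_le_mul_of_nonneg_right (h.cast_mono hc) hDl.le
    linarith
  have hAl : A ≤ l + 1 := by
    by_contra! hc
    have := hA2 (l + 1) hc
    linarith
  have hlB : l < B := by
    by_contra! hc
    have := mul_le_mul_of_nonneg_left (h.anti hc) (h.cast_pos (l + 1)).le
    linarith
  have hlA : l + 1 < A + 400 := by
    by_contra! hc
    have h1 := h.two_pow_mul_le_of_le (a := A) (b := l + 1) (k := 200) (by omega)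
    have h2 := mul_le_mul_of_nonneg_right h1 hDl.le
    norm_num at hA1 h2
    linarith
  have hBl : B ≤ l + 402 := by
    by_contra! hc
    have h1 := h.two_pow_mul_D_le_of_le (a := l) (b := l + 402) (k := 201) (by omega)
    have h2 := hB2 (l + 402) (by omega)
    have h3 := mul_le_mul_of_nonneg_left h1 (h.cast_pos (l + 1)).le
    norm_num at h2 h3
    linarith
  have hε2 : ((1 : ℝ) / 2 ^ 100) ^ 2 = 1 / 2 ^ 200 := by norm_num
  have step := fun (n : ℕ) (hn : n ∈ Ico A B) => h.exists_step (ε := 1 / 2 ^ 100) (by norm_num)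
    (by norm_num) (A := A) (B := B) (l := l) (by omega) (by rw [hε2]; exact hA2)
    (by rw [hε2]; exact hB1) hn
  choose! i R hR0 hown hAi hBi hRD hRq using step
  refine ⟨q (l + 1) + ∑ n ∈ Ico A B, R n * (q (i n) : ℝ), fun s ν hs => ?_⟩
  obtain ⟨r₀, hr1, hr2⟩ := h.exists_near (l + 1) s β₀
  have hcardJ : (#(Ico A B) : ℝ) ≤ 2 ^ 10 := by
    have : #(Ico A B) ≤ 2 ^ 10 := by rw [Nat.card_Ico]; omega
    exact_mod_cast this
  set wit : ℕ → ℕ → Prop := fun m n => ∃ ω : ℝ, (ω = q m * D (i n) ∨ ω = q (i n) * D m) ∧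
    ω ≤ 1 / 2 ^ 100 ∧ 1 / 2 ^ 50 ≤ R n * ω with hwit
  set F := {m ∈ Ico (A - 304) (B + 304) | ∃ n ∈ Ico A B, wit m n} with hF
  have hcardF : (#F : ℝ) ≤ 2 ^ 11 := by
    have : #F ≤ 2 ^ 11 := by
      refine (card_filter_le _ _).trans ?_
      rw [Nat.card_Ico]; omega
    exact_mod_cast this
  obtain ⟨r, hrF, hrN⟩ := h.exists_shift_avoiding (ε := 1 / 2 ^ 100) (τ := 1 / 2 ^ 50)
    (by norm_num) (by norm_num) (Ico A B) i R hR0 F (fun m hm => (mem_filter.1 hm).2)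
    (lt_of_le_of_lt (mul_le_mul_of_nonneg_right hcardF (by positivity)) (by norm_num)) r₀
  have hQA : 2 ^ 112 / η ≤ q (A - 1) := hn₃.trans (h.cast_mono (by omega))
  rw [div_le_iff₀ hη] at hQA
  have hlow : ∀ m < A, m ∉ F → ∀ n ∈ Ico A B, R n * (q m * D (i n)) ≤ 1 / 2 ^ 50 := by
    intro m hm hmF n hn
    by_contra! hc
    refine hmF (mem_filter.2 ⟨mem_Ico.2 ⟨?_, by omega⟩, n, hn, _, Or.inl rfl, hAi n hn m hm, hc.le⟩)
    by_contra! hmA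
    have h1 := h.two_pow_mul_le_of_le (a := m) (b := A - 1) (k := 152) (by omega)
    have h2 := hRD n hn
    rw [le_div_iff₀ (mul_pos (by norm_num) (h.cast_pos _))] at h2
    have h3 := mul_le_mul_of_nonneg_left h2 (h.cast_pos m).le
    have h4 := mul_lt_mul_of_pos_right hc (h.cast_pos (A - 1))
    have h5 := h.cast_pos m
    norm_num at h1 h3 h4
    linarith
  have hhigh : ∀ m, B ≤ m → m ∉ F → ∀ n ∈ Ico A B, R n * (q (i n) * D m) ≤ 1 / 2 ^ 50 := by
    intro m hm hmF n hn
    by_contra! hc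
    refine hmF (mem_filter.2 ⟨mem_Ico.2 ⟨by omega, ?_⟩, n, hn, _, Or.inr rfl, hBi n hn m hm, hc.le⟩)
    by_contra! hmB
    have h1 := h.two_pow_mul_D_le_of_le (a := B) (b := m) (k := 152) (by omega)
    have h2 := hRq n hn
    rw [le_div_iff₀ (mul_pos (by norm_num) (h.pos _))] at h2
    have h3 := mul_le_mul_of_nonneg_left h2 (h.pos m).le
    have h4 := mul_lt_mul_of_pos_right hc (h.pos B)
    have h5 := h.pos m
    norm_num at h1 h3 h4
    linarith
  have hmid : ∀ m ∈ Ico A B, m ∈ F := by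
    intro m hm
    obtain ⟨ω, h1, h2, h3⟩ := hown m hm
    have hm' := mem_Ico.1 hm
    exact mem_filter.2 ⟨mem_Ico.2 ⟨by omega, by omega⟩, m, hm, ω, h1, h2, le_trans (by norm_num) h3⟩
  clear_value F
  have hshift : ∀ (m : ℕ) (u : ℕ → ℝ), (∀ n, nint (((q m * q (i n) : ℤ) : ℝ) * α) ≤ u n) →
      (∀ n ∈ Ico A B, R n * u n ≤ 1 / 2 ^ 50) →
      nint (((q m * r₀ : ℤ) : ℝ) * α) - 1 / 2 ^ 40 ≤ nint (((q m * r : ℤ) : ℝ) * α) := by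
    intro m u hu hRu
    have h1 := hrN (fun x => nint (((q m * x : ℤ) : ℝ) * α)) (by simp [nint])
      (fun x => nint_nonneg _) (fun x y => nint_add_mul_le (q m) x y)
    have h2 : ∑ n ∈ Ico A B, R n * nint (((q m * q (i n) : ℤ) : ℝ) * α) ≤
        #(Ico A B) • (1 / 2 ^ 50 : ℝ) := sum_le_card_nsmul _ _ _ fun n hn =>
      (mul_le_mul_of_nonneg_left (hu n) (Nat.cast_nonneg _)).trans (hRu n hn)
    rw [nsmul_eq_mul] at h2
    have h3 := nint_add_mul_le (α := α) (q m) r (r₀ - r)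
    have h4 : nint (((q m * (r₀ - r) : ℤ) : ℝ) * α) = nint (((q m * (r - r₀) : ℤ) : ℝ) * α) := by
      rw [← nint_neg]; congr 1; push_cast; ring
    rw [add_sub_cancel, h4] at h3
    have h5 : (#(Ico A B) : ℝ) * (1 / 2 ^ 50) ≤ 2 ^ 10 * (1 / 2 ^ 50) :=
      mul_le_mul_of_nonneg_right hcardJ (by norm_num)
    norm_num at h1 h2 h3 h5 ⊢
    linarith
  refine ⟨r, ?_, ?_, fun m hm1 hm2 => ?_⟩
  · have h1 := hrN (fun x => |(x : ℝ)|) (by simp) (fun x => abs_nonneg _)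
      (fun x y => by push_cast; exact abs_add_le _ _)
    have h2 : ∑ n ∈ Ico A B, R n * |(q (i n) : ℝ)| = ∑ n ∈ Ico A B, R n * (q (i n) : ℝ) :=
      sum_congr rfl fun n _ => by rw [abs_of_pos (h.cast_pos _)]
    simp only [h2] at h1
    push_cast at h1
    calc |(r : ℝ) - s| = |((r₀ : ℝ) - s) + (r - r₀)| := by ring_nf
      _ ≤ _ := (abs_add_le _ _).trans (add_le_add hr1 h1)
  · have h1 := hrN (fun x => nint ((x : ℝ) * α)) (by simp [nint])
      (fun x => nint_nonneg _) (fun x y => by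
        push_cast; rw [add_mul]; exact nint_add_le _ _)
    have h2 : ∑ n ∈ Ico A B, R n * nint ((q (i n) : ℝ) * α) ≤
        #(Ico A B) • (2 / (1 / 2 ^ 100 * q (A - 1)) : ℝ) := sum_le_card_nsmul _ _ _ fun n hn => by
      refine le_trans (mul_le_mul_of_nonneg_left ?_ (Nat.cast_nonneg _)) (hRD n hn)
      rw [← h.abs_eq]
      exact nint_le_abs_sub _ _
    rw [nsmul_eq_mul] at h2
    have h3 := nint_add_le (r₀ * α - β₀) (((r - r₀ : ℤ) : ℝ) * α)
    have e : (r₀ * α - β₀) + ((r - r₀ : ℤ) : ℝ) * α = r * α - β₀ := by push_cast; ring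
    rw [e] at h3
    have hQ := h.cast_pos (A - 1)
    have h4 : (2 : ℝ) / q (l + 1) ≤ 2 / q (A - 1) := by
      have := h.cast_mono (show A - 1 ≤ l + 1 by omega)
      gcongr
    have h5 : (#(Ico A B) : ℝ) * (2 / (1 / 2 ^ 100 * q (A - 1))) ≤
        2 ^ 10 * (2 / (1 / 2 ^ 100 * q (A - 1))) :=
      mul_le_mul_of_nonneg_right hcardJ (by positivity)
    have h6 : 2 / q (A - 1) + 2 ^ 10 * (2 / (1 / 2 ^ 100 * q (A - 1))) ≤ η := by
      have e : 2 / (q (A - 1) : ℝ) + 2 ^ 10 * (2 / (1 / 2 ^ 100 * q (A - 1))) =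
        (2 + 2 ^ 111) / q (A - 1) := by field_simp
      rw [e, div_le_iff₀ hQ]
      refine le_trans ?_ (hQA.trans (le_of_eq (mul_comm _ _)))
      norm_num
    linarith
  · by_cases hmF : m ∈ F
    · exact hrF m hmF
    rcases lt_or_ge m A with hmA | hmA
    · have h1 := hshift m (fun n => q m * D (i n)) (fun n => by
        have := h.nint_mul_le (i n) (q m)
        rwa [abs_of_pos (h.cast_pos m), mul_comm (q (i n))] at this) (hlow m hmA hmF)
      have h2 := hβ m hm1
      have h3 := nint_add_le (((q m * r₀ : ℤ) : ℝ) * α) (((q m : ℤ) : ℝ) * (β₀ - r₀ * α))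
      have e : ((q m * r₀ : ℤ) : ℝ) * α + ((q m : ℤ) : ℝ) * (β₀ - r₀ * α) = q m * β₀ := by
        push_cast; ring
      rw [e] at h3
      have h4 := nint_int_mul_le (q m) (β₀ - r₀ * α)
      rw [abs_of_pos (h.cast_pos m), ← nint_neg (β₀ - r₀ * α), neg_sub] at h4
      have h5 := mul_le_mul_of_nonneg_left hr2 (h.cast_pos m).le
      have h6 := hA2 m hmA
      have h7 : (2 : ℝ) / q (l + 1) ≤ 4 * D l := by
        rw [div_le_iff₀ (h.cast_pos _)]; linarith
      have h8 := mul_le_mul_of_nonneg_left h7 (h.cast_pos m).le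
      linarith
    · rcases lt_or_ge m B with hmB | hmB
      · exact absurd (hmid m (mem_Ico.2 ⟨hmA, hmB⟩)) hmF
      · have h1 := hshift m (fun n => q (i n) * D m) (fun n => by
          have := h.nint_mul_le m (q (i n))
          rwa [abs_of_pos (h.cast_pos _)] at this) (hhigh m hmB hmF)
        have h2 := hs m hm1 hm2
        have h3 := nint_add_mul_le (α := α) (q m) r₀ (s - r₀)
        rw [add_sub_cancel] at h3
        have h4 := h.nint_mul_le m (s - r₀)
        have h5 : |((s - r₀ : ℤ) : ℝ)| * D m ≤ q (l + 1) * D B := by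
          push_cast
          rw [abs_sub_comm]
          exact mul_le_mul hr1 (h.anti hmB) (h.pos m).le (h.cast_pos _).le
        have h6 : nint (((q m * s : ℤ) : ℝ) * α) = nint (s * D m) := by
          obtain ⟨σ, hσ, z, hz⟩ := h.exists_abs_eq m s
          rw [hz, nint_add_int]
          apply nint_mul_eq_of_abs_eq
          rw [hσ, abs_mul, abs_of_pos (h.pos m)]
        linarith

end IsConvergents

lemma le_nint_of_far {t τ : ℝ} (h0 : τ ≤ t) (h : ∀ j : ℕ, 1 ≤ j → τ ≤ |t - j|) : τ ≤ nint t := by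
  refine le_nint fun z => ?_
  rcases le_or_gt z 0 with hz | hz
  · have : (z : ℝ) ≤ 0 := by exact_mod_cast hz
    exact le_trans (by linarith) (le_abs_self _)
  · have := h z.toNat (by omega)
    have e : ((z.toNat : ℕ) : ℝ) = z := by exact_mod_cast Int.toNat_of_nonneg hz.le
    rwa [e] at this

lemma le_mul_abs_sub_of_far {c y J N Q δ : ℝ} (hJ : 1 ≤ J) (hQ : 0 < Q) (hδ : 0 < δ) (hy : 0 < y)
    (hN : N ≤ Q) (hNy : 2 ^ 23 * c ≤ y * N) (h : 1 / 2 ^ 21 ≤ |y / δ - J|) :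
    c ≤ J * Q / 2 * |J * δ - y| := by
  have hQy : 2 ^ 23 * c ≤ y * Q := hNy.trans (mul_le_mul_of_nonneg_left hN hy.le)
  have hJQ : Q ≤ J * Q := le_mul_of_one_le_left hQ.le hJ
  have hJy : y * Q ≤ y * (J * Q) := mul_le_mul_of_nonneg_left hJQ hy.le
  have hyQ : 0 < y * Q := mul_pos hy hQ
  have hJ2 : 0 ≤ J * Q / 2 := by linarith
  by_cases hmid : y / 2 < J * δ ∧ J * δ < 2 * y
  · have h4 : 1 / 2 ^ 21 * δ ≤ |J * δ - y| := by
      refine (mul_le_mul_of_nonneg_right h hδ.le).trans (le_of_eq ?_)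
      rw [← abs_of_pos hδ, ← abs_mul, abs_of_pos hδ, abs_sub_comm]
      congr 1
      field_simp
    have h5 := mul_le_mul_of_nonneg_left h4 hJ2
    have h7 := mul_le_mul_of_nonneg_left hmid.1.le hQ.le
    linarith
  · have h2 : y / 2 ≤ |J * δ - y| := by
      rw [le_abs]
      by_contra! h3
      exact hmid ⟨by linarith, by linarith⟩
    have h3 := mul_le_mul_of_nonneg_left h2 hJ2
    linarith

namespace IsConvergents

variable {α : ℝ} {q p : ℕ → ℤ} {D : ℕ → ℝ}

lemma mul_self_le_one (h : IsConvergents α q p D) (n : ℕ) : q n * D n ≤ 1 :=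
  le_trans (mul_le_mul_of_nonneg_right (h.cast_mono (Nat.le_succ n)) (h.pos n).le) (h.mul_le_one n)

/-- Approximation at scale `n` is bounded below by the distance of `q n * β` to `ℤ`. -/
lemma le_mul_nint_of_le_nint (h : IsConvergents α q p D) {ε β : ℝ} {n : ℕ} {x : ℤ} (hε : 0 < ε)
    (hβ : ε ≤ nint (q n * β)) (hx : |(x : ℝ)| * D n ≤ ε / 2) (hx' : ε * q n / 2 ≤ |(x : ℝ)|) :
    ε ^ 2 / 4 ≤ |(x : ℝ)| * nint (x * α - β) := by
  have h1 := nint_sub_le (q n * β) 0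
  have h2 := nint_add_le (((q n * x : ℤ) : ℝ) * α) ((q n : ℝ) * (β - x * α))
  have e : ((q n * x : ℤ) : ℝ) * α + (q n : ℝ) * (β - x * α) = q n * β := by push_cast; ring
  rw [e] at h2
  have h3 := nint_int_mul_le (q n) (β - x * α)
  rw [abs_of_pos (h.cast_pos n), ← nint_neg (β - x * α), neg_sub] at h3
  have h4 := h.nint_mul_le n x
  have h5 : ε / 2 ≤ q n * nint (x * α - β) := by linarith
  have h6 := nint_nonneg (x * α - β)
  calc ε ^ 2 / 4 = ε / 2 * (ε / 2) := by ring
    _ ≤ ε / 2 * (q n * nint (x * α - β)) := by gcongr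
    _ = ε * q n / 2 * nint (x * α - β) := by ring
    _ ≤ |(x : ℝ)| * nint (x * α - β) := by gcongr

lemma le_mul_nint_of_ne (h : IsConvergents α q p D) {c s y : ℝ} {n₁ ν : ℕ} {r z : ℤ}
    (hc : 0 < c) (hcμ : c ≤ 1 / 2 ^ 250) (hs1 : 1 / 2 ^ 24 * q ν ≤ s)
    (hs2 : s ≤ 1 / 2 ^ 23 * q ν) (hy : y = c / s) (hr : |(r : ℝ)| ≤ 2 * s)
    (hlevel : ∀ n, n₁ ≤ n → 1 / 2 ^ 101 ≤ nint (q n * (r * α - z + y)) ∨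
      (ν ≤ n ∧ q n * y < 1 / 2 ^ 100))
    (hfar : ∀ n, ∀ j : ℕ, 1 ≤ j → 1 / 2 ^ 21 ≤ |y / D n - j|)
    {x : ℤ} (hxr : x ≠ r) (hx : 1 / 2 ^ 102 < |(x : ℝ)| * D n₁) :
    c ≤ |(x : ℝ)| * nint (x * α - (r * α - z + y)) := by
  classical
  have hN := h.cast_pos ν
  have hs0 : 0 < s := lt_of_lt_of_le (by positivity) hs1
  have hy0 : 0 < y := hy ▸ div_pos hc hs0
  have hys : y * s = c := by rw [hy, div_mul_cancel₀ _ hs0.ne']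
  have hNy : 2 ^ 23 * c ≤ y * q ν := by
    have := mul_le_mul_of_nonneg_left hs2 hy0.le
    linarith
  set β := r * α - z + y with hβ
  by_contra! hcon
  have hx0 : 0 < |(x : ℝ)| := by
    by_contra! h0
    have : |(x : ℝ)| * D n₁ ≤ 0 := mul_nonpos_of_nonpos_of_nonneg h0 (h.pos _).le
    norm_num at hx
    linarith
  have hex : ∃ n, |(x : ℝ)| * D n ≤ 1 / 2 ^ 102 := by
    obtain ⟨n, hn⟩ := h.exists_D_le (t := 1 / 2 ^ 102 / |(x : ℝ)|) (by positivity)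
    rw [le_div_iff₀ hx0] at hn
    exact ⟨n, by linarith⟩
  obtain ⟨n, hn1, hn2⟩ : ∃ n, |(x : ℝ)| * D n ≤ 1 / 2 ^ 102 ∧
      ∀ m < n, 1 / 2 ^ 102 < |(x : ℝ)| * D m :=
    ⟨Nat.find hex, Nat.find_spec hex, fun m hm => not_le.1 (Nat.find_min hex hm)⟩
  have hn₁n : n₁ < n := by
    by_contra! hc
    have := mul_le_mul_of_nonneg_left (h.anti hc) hx0.le
    linarith
  have hxq : 1 / 2 ^ 101 * q n / 2 ≤ |(x : ℝ)| := by
    obtain ⟨k, rfl⟩ : ∃ k, n = k + 1 := ⟨n - 1, by omega⟩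
    have h1 := hn2 k (by omega)
    have h2 := h.mul_le_one k
    have h3 := mul_lt_mul_of_pos_right h1 (h.cast_pos (k + 1))
    have h4 := mul_le_mul_of_nonneg_left h2 hx0.le
    norm_num at h3 ⊢
    linarith
  rcases hlevel n hn₁n.le with h1 | ⟨hνn, hqy⟩
  · have := h.le_mul_nint_of_le_nint (x := x) (by norm_num) h1 (by norm_num at hn1 ⊢; exact hn1) hxq
    linarith
  have hqn := h.cast_pos n
  have hNn := h.cast_mono hνn
  have hqD := h.mul_self_le_one n
  have hDn := h.pos n
  obtain ⟨w, hw⟩ := exists_nint_eq (x * α - β)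
  set ζ := x * α - β - w with hζ
  rw [hw] at hcon
  have hrD : |(r : ℝ)| * D n ≤ 1 / 2 ^ 22 := by
    have h1 : |(r : ℝ)| * D n ≤ (1 / 2 ^ 22 * q n) * D n := by
      apply mul_le_mul_of_nonneg_right _ hDn.le
      linarith
    linarith
  have hqζ : q n * |ζ| ≤ 2 ^ 102 * c := by
    have := mul_le_mul_of_nonneg_right hxq (abs_nonneg ζ)
    norm_num at this ⊢
    linarith
  obtain ⟨m, hm⟩ : ∃ m, x = r + m := ⟨x - r, by ring⟩
  have hm' : (x : ℝ) = r + m := by exact_mod_cast hm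
  have hdel : (m : ℝ) * α - (w - z : ℤ) = y + ζ := by
    rw [hζ, hβ, hm']; push_cast; ring
  have hint : |((q n * (w - z) - m * p n : ℤ) : ℝ)| < 1 := by
    have e : ((q n * (w - z) - m * p n : ℤ) : ℝ) =
        (x * (q n * α - p n) - r * (q n * α - p n)) - (q n * y + q n * ζ) := by
      rw [← mul_add, ← hdel, hm']; push_cast; ring
    rw [e]
    have h1 := abs_sub (x * (q n * α - p n) - r * (q n * α - p n)) (q n * y + q n * ζ)
    have h2 := abs_sub (x * (q n * α - p n)) (r * (q n * α - p n))
    have h3 := abs_add_le (q n * y) (q n * ζ)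
    rw [abs_mul, abs_mul, h.abs_eq] at h2
    rw [abs_mul, abs_mul, abs_of_pos hqn, abs_of_pos hy0] at h3
    linarith
  have hzero : q n * (w - z) - m * p n = 0 := by
    have : |q n * (w - z) - m * p n| < 1 := by exact_mod_cast hint
    exact Int.abs_lt_one_iff.1 this
  obtain ⟨j, hj⟩ : q n ∣ m := by
    refine (h.coprime n).dvd_of_dvd_mul_right ⟨w - z, by linarith⟩
  have hj' : (m : ℝ) = q n * j := by exact_mod_cast hj
  have hP : w - z = j * p n := by
    have h1 : q n ≠ 0 := by have := h.one_le n; omega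
    apply mul_left_cancel₀ h1
    rw [hj] at hzero
    linarith
  have hj0 : j ≠ 0 := by
    rintro rfl
    apply hxr
    rw [hm, hj]; ring
  have hjabs : (1 : ℝ) ≤ |(j : ℝ)| := by exact_mod_cast Int.one_le_abs hj0
  have hζ' : |(|(j : ℝ)| * D n - y)| ≤ |ζ| := by
    have e : ζ = j * (q n * α - p n) - y := by
      have : ζ = m * α - (w - z : ℤ) - y := by rw [hdel]; ring
      rw [this, hP, hj']; push_cast; ring
    have h1 := abs_abs_sub_abs_le (j * (q n * α - p n)) y
    rw [abs_mul, h.abs_eq, abs_of_pos hy0] at h1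
    rwa [e]
  have hxj : |(j : ℝ)| * q n / 2 ≤ |(x : ℝ)| := by
    have h1 := abs_sub_abs_le_abs_sub (q n * j : ℝ) (-r)
    rw [abs_neg, abs_mul, abs_of_pos hqn] at h1
    rw [hm', hj']
    have h2 : (q n : ℝ) ≤ |(j : ℝ)| * q n := le_mul_of_one_le_left hqn.le hjabs
    have e : (q n : ℝ) * j - -r = r + q n * j := by ring
    rw [e] at h1
    linarith
  have hprod : |(j : ℝ)| * q n / 2 * |(|(j : ℝ)| * D n - y)| < c :=
    lt_of_le_of_lt (mul_le_mul hxj hζ' (abs_nonneg _) hx0.le) hcon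
  have hfar' := hfar n j.natAbs (by omega)
  rw [Nat.cast_natAbs, Int.cast_abs] at hfar'
  exact absurd (le_mul_abs_sub_of_far hjabs hqn hDn hy0 hNn hNy hfar') (not_le.2 hprod)

/-- Multiplying `r * α - z + y` by `q n`: the two contributions to the distance to `ℤ`. -/
lemma nint_mul_shift_bounds (h : IsConvergents α q p D) {y : ℝ} (hy : 0 ≤ y) (r z : ℤ) (n : ℕ) :
    nint (((q n * r : ℤ) : ℝ) * α) - q n * y ≤ nint (q n * (r * α - z + y)) ∧
      nint (q n * y) - |(r : ℝ)| * D n ≤ nint (q n * (r * α - z + y)) := by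
  have e : (q n : ℝ) * (r * α - z + y) =
      (((q n * r : ℤ) : ℝ) * α + q n * y) + (-(q n * z) : ℤ) := by push_cast; ring
  have hqy : 0 ≤ q n * y := mul_nonneg (h.cast_pos n).le hy
  have h1 := nint_sub_le (((q n * r : ℤ) : ℝ) * α) (((q n * r : ℤ) : ℝ) * α + q n * y)
  have h2 := nint_add_le (((q n * r : ℤ) : ℝ) * α + q n * y) (-(((q n * r : ℤ) : ℝ) * α))
  have h3 := h.nint_mul_le n r
  rw [e, nint_add_int]
  rw [sub_add_cancel_left, abs_neg, abs_of_nonneg hqy] at h1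
  rw [nint_neg, add_neg_cancel_comm] at h2
  constructor <;> linarith

/-- For large `n`, a real number of the form `r * α - z + c / s` with `s` a good scale stays away
from `ℤ` when multiplied by `q n`. -/
lemma exists_forall_le_nint (h : IsConvergents α q p D) {y : ℝ} (hy : 0 < y)
    (hfar : ∀ n, ∀ j : ℕ, 1 ≤ j → 1 / 2 ^ 21 ≤ |q n * y - j|) (r z : ℤ) :
    ∃ n₂, ∀ n, n₂ ≤ n → 1 / 2 ^ 25 ≤ nint (q n * (r * α - z + y)) := by
  obtain ⟨a, ha⟩ := h.exists_le_q (1 / y)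
  obtain ⟨b, hb⟩ := h.exists_D_le (t := 1 / 2 ^ 22 / (|(r : ℝ)| + 1)) (by positivity)
  refine ⟨max a b, fun n hn => ?_⟩
  have h1 := (h.nint_mul_shift_bounds hy.le r z n).2
  have h2 : 1 ≤ q n * y := by
    rw [← div_le_iff₀ hy]
    exact ha.trans (h.cast_mono ((le_max_left _ _).trans hn))
  have h3 := le_nint_of_far (by linarith) (hfar n)
  have h4 := (h.anti ((le_max_right _ _).trans hn)).trans hb
  rw [le_div_iff₀ (by positivity)] at h4
  have h5 := (h.pos n).le
  linarith

lemma exists_hit (h : IsConvergents α q p D) {β₀ η c ρ : ℝ} (K : ℝ) {n₁ : ℕ}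
    (hβ : ∀ n, n₁ ≤ n → 1 / 2 ^ 25 ≤ nint (q n * β₀)) (hD : D n₁ ≤ 1 / 2 ^ 25) (hη : 0 < η)
    (hc : 0 < c) (hcμ : c ≤ 1 / 2 ^ 250) (hρ : 0 < ρ) :
    ∃ β, |β - β₀| ≤ η ∧ (∃ n₂, ∀ n, n₂ ≤ n → 1 / 2 ^ 25 ≤ nint (q n * β)) ∧
      (∃ x : ℤ, K ≤ |(x : ℝ)| ∧ |(x : ℝ)| * nint (x * α - β) ≤ c + ρ) ∧
      ∀ x : ℤ, 1 / 2 ^ 102 < |(x : ℝ)| * D n₁ → c - ρ ≤ |(x : ℝ)| * nint (x * α - β) := by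
  obtain ⟨G, hG⟩ := h.exists_join hβ (half_pos hη)
  set G' := |G| + 1 with hG'
  have hG'1 : 1 ≤ G' := by have := abs_nonneg G; linarith
  set Y := 2 * c / η + G' * c / ρ + |K| + G' + 1 with hY
  have hY1 : 0 ≤ 2 * c / η := by positivity
  have hY2 : 0 ≤ G' * c / ρ := by positivity
  have hY3 := abs_nonneg K
  obtain ⟨ν, hν⟩ := h.exists_le_q (2 ^ 24 * Y)
  have hN := h.cast_pos ν
  obtain ⟨s, ⟨hs1, hs2⟩, hfar⟩ := h.exists_scale hc (S := 1 / 2 ^ 24 * q ν) (by positivity)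
  have hs2' : s ≤ 1 / 2 ^ 23 * q ν := by linarith
  have hsY : Y ≤ s := by linarith
  have hs0 : 0 < s := by linarith
  have hround := abs_sub_round s
  obtain ⟨r, hrs, hrβ, hrn⟩ := hG (round s) ν (by
    intro n hn hnν
    have hDn := h.anti hn
    have hD0 := h.pos n
    have h1 : 1 / 2 ^ 25 ≤ s * D n := by
      have h2 := h.half_le_mul n
      have h3 : (q (n + 1) : ℝ) * D n ≤ q ν * D n :=
        mul_le_mul_of_nonneg_right (h.cast_mono hnν) hD0.le
      have h4 := mul_le_mul_of_nonneg_right hs1 hD0.le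
      linarith
    have h2 : 1 / 2 ^ 25 ≤ nint (s * D n) :=
      le_nint_of_far h1 fun j hj => le_trans (by norm_num) (hfar n j hj).1
    have h3 := nint_sub_le (s * D n) ((round s : ℤ) * D n)
    rw [← sub_mul, abs_mul, abs_of_pos hD0] at h3
    have h4 := mul_le_mul_of_nonneg_right hround hD0.le
    linarith)
  have hrs' : |r - s| ≤ G' := by
    have h1 := abs_sub_le (r : ℝ) (round s : ℤ) s
    rw [abs_sub_comm ((round s : ℤ) : ℝ) s] at h1
    have := le_abs_self G
    linarith
  have hrs1 := abs_sub_abs_le_abs_sub (r : ℝ) s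
  have hrs2 := abs_sub_abs_le_abs_sub s (r : ℝ)
  rw [abs_sub_comm] at hrs2
  rw [abs_of_pos hs0] at hrs1 hrs2
  obtain ⟨z, hz⟩ := exists_nint_eq (r * α - β₀)
  set y := c / s with hy
  have hy0 : 0 < y := div_pos hc hs0
  have hys : y * s = c := div_mul_cancel₀ _ hs0.ne'
  have hyc : y ≤ c := div_le_self hc.le (by linarith)
  have hyη : y ≤ η / 2 := by
    rw [hy, div_le_iff₀ hs0]
    have : 2 * c / η ≤ s := by linarith
    rw [div_le_iff₀ hη] at this
    linarith
  have hyρ : G' * y ≤ ρ := by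
    have : G' * c / ρ ≤ s := by linarith
    rw [div_le_iff₀ hρ] at this
    rw [hy, ← mul_div_assoc, div_le_iff₀ hs0]
    linarith
  have hqy : ∀ n (j : ℕ), 1 ≤ j → 1 / 2 ^ 21 ≤ |q n * y - j| := fun n j hj => by
    rw [hy, ← mul_div_assoc]
    exact (hfar n j hj).2.1
  have hr1 := mul_le_mul_of_nonneg_right hrs1 hy0.le
  have hr2 := mul_le_mul_of_nonneg_right hrs2 hy0.le
  have hr3 := mul_le_mul_of_nonneg_right hrs' hy0.le
  have hself : (r : ℝ) * α - (r * α - z + y) = -y + z := by ring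
  have hnr : nint ((r : ℝ) * α - (r * α - z + y)) = nint y := by
    rw [hself, nint_add_int, nint_neg]
  have hny : nint y = y := by
    refine le_antisymm ((nint_le_abs y).trans_eq (abs_of_pos hy0)) (le_nint_of_far le_rfl ?_)
    intro j hj
    have hj' : (1 : ℝ) ≤ j := by exact_mod_cast hj
    rw [abs_sub_comm]
    exact le_trans (by linarith) (le_abs_self _)
  refine ⟨r * α - z + y, ?_, h.exists_forall_le_nint hy0 hqy r z, ⟨r, ?_, ?_⟩, ?_⟩
  · have e : (r : ℝ) * α - z + y - β₀ = (r * α - β₀ - z) + y := by ring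
    have := abs_add_le (r * α - β₀ - z) y
    rw [e]
    rw [abs_of_pos hy0] at this
    linarith
  · have := le_abs_self K
    linarith
  · rw [hnr, hny]
    linarith
  · intro x hx
    by_cases hxr : x = r
    · rw [hxr, hnr, hny]
      linarith
    · refine le_trans (by linarith) (h.le_mul_nint_of_ne hc hcμ hs1 hs2' hy (by linarith)
        (fun n hn => ?_) (fun n j hj => ?_) hxr hx)
      · obtain ⟨h1, h2⟩ := h.nint_mul_shift_bounds hy0.le r z n
        have hqn := h.cast_pos n
        rcases lt_or_ge n ν with hnν | hnν
        · left
          have h3 := hrn n hn hnν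
          have h4 := mul_le_mul_of_nonneg_right (h.cast_mono hnν.le) hy0.le
          have h5 := mul_le_mul_of_nonneg_left hs1 hy0.le
          linarith
        · by_cases h3 : q n * y < 1 / 2 ^ 100
          · exact Or.inr ⟨hnν, h3⟩
          · left
            have h4 : 1 / 2 ^ 100 ≤ nint (q n * y) :=
              le_nint_of_far (not_lt.1 h3) fun j hj => le_trans (by norm_num) (hqy n j hj)
            have hDn := h.pos n
            have h5 := mul_le_mul_of_nonneg_left (h.mul_self_le_one n) hy0.le
            have h6 := mul_le_mul_of_nonneg_right (not_lt.1 h3) hDn.le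
            have h7 : D n ≤ 2 ^ 100 * y := by linarith
            have h8 : |(r : ℝ)| * D n ≤ 2 * s * (2 ^ 100 * y) :=
              mul_le_mul (by linarith) h7 hDn.le (by linarith)
            have h9 : 2 * s * (2 ^ 100 * y) = 2 ^ 101 * c := by rw [← hys]; ring
            linarith
      · rw [hy, div_right_comm]
        exact (hfar n j hj).2.2

lemma exists_stage (h : IsConvergents α q p D) {β₀ η c ρ : ℝ} (K : ℝ) {n₁ : ℕ}
    (hβ : ∀ n, n₁ ≤ n → 1 / 2 ^ 25 ≤ nint (q n * β₀)) (hD : D n₁ ≤ 1 / 2 ^ 25) (hη : 0 < η)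
    (hc : 0 < c) (hcμ : c ≤ 1 / 2 ^ 250) (hρ : 0 < ρ) :
    ∃ (β η' : ℝ) (n₂ : ℕ), 0 < η' ∧ D n₂ ≤ 1 / 2 ^ 25 ∧
      (∀ n, n₂ ≤ n → 1 / 2 ^ 25 ≤ nint (q n * β)) ∧ n₁ < n₂ ∧
      Metric.closedBall β η' ⊆ Metric.closedBall β₀ η ∧ ∀ b ∈ Metric.closedBall β η',
        (∃ x : ℤ, K ≤ |(x : ℝ)| ∧ |(x : ℝ)| * nint (x * α - b) ≤ c + ρ) ∧
        ∀ x : ℤ, 1 / 2 ^ 102 < |(x : ℝ)| * D n₁ → |(x : ℝ)| * D n₂ ≤ 1 / 2 ^ 102 →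
          c - ρ ≤ |(x : ℝ)| * nint (x * α - b) := by
  obtain ⟨β, hββ, ⟨n₂, hn₂⟩, ⟨x₀, hx₀K, hx₀⟩, hlow⟩ :=
    h.exists_hit K hβ hD (half_pos hη) hc hcμ (half_pos hρ)
  set m := max n₂ (n₁ + 1) with hm
  have hDm := h.pos m
  set B := |(x₀ : ℝ)| + 1 / 2 ^ 102 / D m + 1 with hB
  have hB1 : 0 ≤ 1 / 2 ^ 102 / D m := by positivity
  have hB2 := abs_nonneg (x₀ : ℝ)
  have hB0 : 0 < B := by linarith
  have hclose : ∀ (x : ℤ) (b : ℝ), |(x : ℝ)| ≤ B → |b - β| ≤ ρ / 2 / B →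
      |(|(x : ℝ)| * nint (x * α - b) - |(x : ℝ)| * nint (x * α - β))| ≤ ρ / 2 := by
    intro x b hx hb
    have h1 := nint_sub_le (x * α - b) (x * α - β)
    have h2 := nint_sub_le (x * α - β) (x * α - b)
    rw [sub_sub_sub_cancel_left] at h1 h2
    rw [abs_sub_comm] at h1
    rw [← mul_sub, abs_mul, abs_abs]
    have h3 : |nint (x * α - b) - nint (x * α - β)| ≤ |b - β| := abs_le.2 ⟨by linarith, by linarith⟩
    refine (mul_le_mul hx (h3.trans hb) (abs_nonneg _) hB0.le).trans_eq ?_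
    field_simp
  refine ⟨β, min (η / 2) (ρ / 2 / B), m, by positivity, ?_, ?_, ?_, ?_, ?_⟩
  · exact (h.anti (by omega)).trans hD
  · exact fun n hn => hn₂ n (by omega)
  · omega
  · refine Metric.closedBall_subset_closedBall' ?_
    rw [Real.dist_eq]
    have := min_le_left (η / 2) (ρ / 2 / B)
    linarith
  · intro b hb
    have hb' : |b - β| ≤ ρ / 2 / B := (Metric.mem_closedBall.1 hb).trans (min_le_right _ _)
    refine ⟨⟨x₀, hx₀K, ?_⟩, fun x hx1 hx2 => ?_⟩
    · have := (abs_le.1 (hclose x₀ b (by linarith) hb')).2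
      linarith
    · rw [← le_div_iff₀ hDm] at hx2
      have h1 := (abs_le.1 (hclose x b (by linarith) hb')).1
      have h2 := hlow x hx1
      linarith

/-- An admissible centre for the nested ball construction. -/
lemma exists_base (h : IsConvergents α q p D) :
    ∃ (β : ℝ) (n₁ : ℕ), D n₁ ≤ 1 / 2 ^ 25 ∧ ∀ n, n₁ ≤ n → 1 / 2 ^ 25 ≤ nint (q n * β) := by
  obtain ⟨s, hs, hfar⟩ := h.exists_scale one_pos one_pos
  have hs0 : 0 < s := one_pos.trans_le hs.1
  obtain ⟨n₂, hn₂⟩ := h.exists_forall_le_nint (y := 1 / s) (by positivity)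
    (fun n j hj => by rw [← mul_div_assoc]; exact (hfar n j hj).2.1) 0 0
  obtain ⟨n₁, hn₁⟩ := h.exists_D_le (t := 1 / 2 ^ 25) (by positivity)
  exact ⟨_, max n₁ n₂, (h.anti (le_max_left _ _)).trans hn₁,
    fun n hn => hn₂ n ((le_max_right _ _).trans hn)⟩

lemma exists_limit (h : IsConvergents α q p D) {c : ℕ → ℝ} (hc : ∀ k, 0 < c k)
    (hcμ : ∀ k, c k ≤ 1 / 2 ^ 250) {ρ : ℕ → ℝ} (hρ : ∀ k, 0 < ρ k) :
    ∃ (b : ℝ) (n : ℕ → ℕ), StrictMono n ∧ ∀ k : ℕ,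
      (∃ x : ℤ, (k : ℝ) ≤ |(x : ℝ)| ∧ |(x : ℝ)| * nint (x * α - b) ≤ c k + ρ k) ∧
      ∀ x : ℤ, 1 / 2 ^ 102 < |(x : ℝ)| * D (n k) → |(x : ℝ)| * D (n (k + 1)) ≤ 1 / 2 ^ 102 →
        c k - ρ k ≤ |(x : ℝ)| * nint (x * α - b) := by
  let S := {t : ℝ × ℝ × ℕ // 0 < t.2.1 ∧ D t.2.2 ≤ 1 / 2 ^ 25 ∧
    ∀ n, t.2.2 ≤ n → 1 / 2 ^ 25 ≤ nint (q n * t.1)}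
  have step : ∀ (k : ℕ) (t : S), ∃ t' : S, t.1.2.2 < t'.1.2.2 ∧
      Metric.closedBall t'.1.1 t'.1.2.1 ⊆ Metric.closedBall t.1.1 t.1.2.1 ∧
      ∀ b ∈ Metric.closedBall t'.1.1 t'.1.2.1,
        (∃ x : ℤ, (k : ℝ) ≤ |(x : ℝ)| ∧ |(x : ℝ)| * nint (x * α - b) ≤ c k + ρ k) ∧
        ∀ x : ℤ, 1 / 2 ^ 102 < |(x : ℝ)| * D t.1.2.2 → |(x : ℝ)| * D t'.1.2.2 ≤ 1 / 2 ^ 102 →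
          c k - ρ k ≤ |(x : ℝ)| * nint (x * α - b) := by
    rintro k ⟨⟨β₀, η, n₁⟩, hη, hD, hβ⟩
    obtain ⟨β, η', n₂, h1, h2, h3, h4⟩ := h.exists_stage k hβ hD hη (hc k) (hcμ k) (hρ k)
    exact ⟨⟨⟨β, η', n₂⟩, h1, h2, h3⟩, h4⟩
  choose f hf1 hf2 hf3 using step
  obtain ⟨β₀, n₁, hD, hβ⟩ := h.exists_base
  let t : ℕ → S := fun k => Nat.rec ⟨⟨β₀, 1, n₁⟩, one_pos, hD, hβ⟩ f k
  have ht : ∀ k, t (k + 1) = f k (t k) := fun k => rfl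
  obtain ⟨b, hb⟩ := IsCompact.nonempty_iInter_of_sequence_nonempty_isCompact_isClosed
    (fun k => Metric.closedBall (t k).1.1 (t k).1.2.1) (fun k => hf2 k (t k))
    (fun k => Metric.nonempty_closedBall.2 (t k).2.1.le) (isCompact_closedBall _ _)
    (fun k => Metric.isClosed_closedBall)
  rw [Set.mem_iInter] at hb
  exact ⟨b, fun k => (t k).1.2.2, strictMono_nat_of_lt_succ fun k => hf1 k (t k),
    fun k => hf3 k (t k) b (hb (k + 1))⟩

end IsConvergents

lemma eventually_comap_abs_atTop {P : ℤ → Prop} :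
    (∀ᶠ x in comap (fun x : ℤ => |x|) atTop, P x) ↔ ∃ N : ℤ, ∀ x, N ≤ |x| → P x := by
  rw [(atTop_basis.comap (fun x : ℤ => |x|)).eventually_iff]
  simp

lemma frequently_comap_abs_atTop {P : ℤ → Prop} :
    (∃ᶠ x in comap (fun x : ℤ => |x|) atTop, P x) ↔ ∀ N : ℤ, ∃ x, N ≤ |x| ∧ P x := by
  rw [Filter.Frequently, eventually_comap_abs_atTop]
  push Not
  rfl

lemma Mtwo_eq_of_forall {α b c : ℝ}
    (hup : ∀ ε > 0, ∀ N : ℤ, ∃ x : ℤ, N ≤ |x| ∧ |(x : ℝ)| * nint (x * α - b) ≤ c + ε)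
    (hlow : ∀ ε > 0, ∃ N : ℤ, ∀ x : ℤ, N ≤ |x| → c - ε ≤ |(x : ℝ)| * nint (x * α - b)) :
    Mtwo α b = c := by
  have hfreq : ∀ ε > 0, ∃ᶠ x : ℤ in comap (fun x : ℤ => |x|) atTop,
      |(x : ℝ)| * nint (x * α - b) ≤ c + ε := fun ε hε => frequently_comap_abs_atTop.2 (hup ε hε)
  have hbdd : IsBoundedUnder (· ≥ ·) (comap (fun x : ℤ => |x|) atTop)
      fun x : ℤ => |(x : ℝ)| * nint (x * α - b) :=
    isBoundedUnder_of ⟨0, fun x => mul_nonneg (abs_nonneg _) (nint_nonneg _)⟩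
  refine le_antisymm (le_of_forall_pos_le_add fun ε hε => ?_)
    (le_of_forall_pos_sub_le fun ε hε => ?_)
  · exact liminf_le_of_frequently_le (hfreq ε hε) hbdd
  · exact le_liminf_of_le (IsCoboundedUnder.of_frequently_le (hfreq 1 one_pos))
      (eventually_comap_abs_atTop.2 (hlow ε hε))

lemma IsConvergents.exists_Mtwo_eq {α : ℝ} {q p : ℕ → ℤ} {D : ℕ → ℝ}
    (h : IsConvergents α q p D) {c : ℝ} (hc : 0 ≤ c) (hcμ : c ≤ 1 / 2 ^ 250) :
    ∃ β, Mtwo α β = c := by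
  have hk : ∀ k : ℕ, (0 : ℝ) < 1 / (k + 1) := fun k => Nat.one_div_pos_of_nat
  have hk1 : ∀ k : ℕ, (1 : ℝ) / (k + 1) ≤ 1 := fun k => by
    rw [div_le_one (by positivity)]
    linarith [k.cast_nonneg (α := ℝ)]
  obtain ⟨b, n, hn, hb⟩ := h.exists_limit (c := fun k => max c (1 / 2 ^ 250 * (1 / (k + 1))))
    (fun k => lt_max_of_lt_right (mul_pos (by positivity) (hk k)))
    (fun k => max_le hcμ (mul_le_of_le_one_right (by positivity) (hk1 k))) hk
  refine ⟨b, Mtwo_eq_of_forall (fun ε hε N => ?_) fun ε hε => ?_⟩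
  · obtain ⟨k₀, hk₀⟩ := exists_nat_one_div_lt (half_pos hε)
    set k := max k₀ N.toNat with hkdef
    obtain ⟨⟨x, hx1, hx2⟩, -⟩ := hb k
    refine ⟨x, ?_, ?_⟩
    · have h1 : (k : ℤ) ≤ |x| := by exact_mod_cast hx1
      omega
    · have h1 : (1 : ℝ) / (k + 1) ≤ 1 / (k₀ + 1) :=
        Nat.one_div_le_one_div (le_max_left _ _)
      have h2 : max c (1 / 2 ^ 250 * (1 / ((k : ℝ) + 1))) ≤ c + 1 / (k + 1) := by
        have := hk k
        refine max_le (by linarith) ?_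
        have : (1 : ℝ) / 2 ^ 250 * (1 / (k + 1)) ≤ 1 / (k + 1) :=
          mul_le_of_le_one_left this.le (by norm_num)
        linarith
      linarith
  · obtain ⟨k₀, hk₀⟩ := exists_nat_one_div_lt hε
    obtain ⟨N, hN⟩ := exists_nat_gt (1 / 2 ^ 102 / D (n k₀))
    refine ⟨N, fun x hx => ?_⟩
    have hD := h.pos (n k₀)
    have hNx : (N : ℝ) ≤ |(x : ℝ)| := by exact_mod_cast hx
    rw [div_lt_iff₀ hD] at hN
    have hx0 : 1 / 2 ^ 102 < |(x : ℝ)| * D (n k₀) :=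
      hN.trans_le (mul_le_mul_of_nonneg_right hNx hD.le)
    have hxpos : 0 < |(x : ℝ)| := pos_of_mul_pos_left (lt_trans (by positivity) hx0) hD.le
    have hex : ∃ k, k₀ ≤ k ∧ |(x : ℝ)| * D (n (k + 1)) ≤ 1 / 2 ^ 102 := by
      obtain ⟨m, hm⟩ := h.exists_D_le (t := 1 / 2 ^ 102 / |(x : ℝ)|) (by positivity)
      refine ⟨max k₀ m, le_max_left _ _, ?_⟩
      rw [mul_comm, ← le_div_iff₀ hxpos]
      refine (h.anti ?_).trans hm
      have := hn.id_le (max k₀ m + 1)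
      simp only [id] at this
      omega
    classical
    obtain ⟨hk1, hk2⟩ := Nat.find_spec hex
    set k := Nat.find hex with hkdef
    have hk3 : 1 / 2 ^ 102 < |(x : ℝ)| * D (n k) := by
      rcases hk1.eq_or_lt with he | hlt
      · rwa [← he]
      · obtain ⟨l, hl⟩ : ∃ l, k = l + 1 := ⟨k - 1, by omega⟩
        have := Nat.find_min hex (m := l) (by omega)
        rw [hl]
        by_contra! hcon
        exact this ⟨by omega, hcon⟩
    have h1 := (hb k).2 x hk3 hk2
    have h2 : (1 : ℝ) / (k + 1) ≤ 1 / (k₀ + 1) := Nat.one_div_le_one_div hk1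
    have h3 := le_max_left c (1 / 2 ^ 250 * (1 / ((k : ℝ) + 1)))
    linarith

/-- For irrational `α`, the set `{M(α,β) : β ∈ ℝ}` contains an interval
`[0, μ]` with `μ > 0`. -/
theorem stmt1 (α : ℝ) (hα : Irrational α) :
    ∃ μ : ℝ, 0 < μ ∧ Set.Icc (0 : ℝ) μ ⊆ {x : ℝ | ∃ β : ℝ, Mtwo α β = x} := by
  obtain ⟨q, p, D, h⟩ := exists_isConvergents hα
  exact ⟨1 / 2 ^ 250, by positivity, fun c hc => h.exists_Mtwo_eq hc.1 hc.2⟩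
end
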